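/- Suppose cr(K_{a,b}) = Z(a,b) holds for all positive integers a, b (Zarankiewicz's conjecture). If m and n are both even positive integers, then cr(K_{1,1,m,n}) = Z(m+2,n+2) − mn + ⌊m/2⌋⌊n/2⌋. -/

import Mathlib

open SimpleGraph

variable {V : Type*}

/-- A drawing of a simple graph in the plane: an injective placement of the
vertices in `ℝ²` together with, for each edge, a continuous arc joining the
positions of its endpoints (parametrised compatibly in both directions),
such that no arc passes through the position of a vertex other than its
endpoints. -/
structure Drawing (G : SimpleGraph V) where
  pos : V → ℝ × ℝ
  pos_inj : Function.Injective pos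
  arc : V → V → ℝ → ℝ × ℝ
  arc_cont : ∀ ⦃a b⦄, G.Adj a b → ContinuousOn (arc a b) (Set.Icc 0 1)
  arc_zero : ∀ ⦃a b⦄, G.Adj a b → arc a b 0 = pos a
  arc_one : ∀ ⦃a b⦄, G.Adj a b → arc a b 1 = pos b
  arc_symm : ∀ ⦃a b⦄, G.Adj a b → ∀ t, arc b a t = arc a b (1 - t)
  arc_avoid : ∀ ⦃a b⦄, G.Adj a b → ∀ c, c ≠ a → c ≠ b →
      pos c ∉ arc a b '' Set.Icc 0 1

namespace Drawing

variable {G : SimpleGraph V} (D : Drawing G)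

/-- The set of points of the plane used by the edge `e`. -/
def edgePoints (e : Sym2 V) : Set (ℝ × ℝ) :=
  {p | ∃ a b, e = s(a, b) ∧ G.Adj a b ∧ p ∈ D.arc a b '' Set.Icc 0 1}

/-- The positions of the endpoints of an edge. -/
def ends (e : Sym2 V) : Set (ℝ × ℝ) := {p | ∃ a ∈ e, p = D.pos a}

/-- `p` is a crossing of the (distinct) edges `e` and `f` in the drawing `D`:
a common point of the two edges other than an endpoint. -/
def IsCrossing (e f : Sym2 V) (p : ℝ × ℝ) : Prop :=
  e ∈ G.edgeSet ∧ f ∈ G.edgeSet ∧ e ≠ f ∧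
    p ∈ D.edgePoints e ∧ p ∈ D.edgePoints f ∧ p ∉ D.ends e ∧ p ∉ D.ends f

/-- The crossings between an edge of `A` and an edge of `B`: a crossing is
recorded as a point of the plane together with the unordered pair of edges
crossing there. -/
def crossings (A B : Set (Sym2 V)) : Set ((ℝ × ℝ) × Sym2 (Sym2 V)) :=
  {q | ∃ e f, q.2 = s(e, f) ∧ e ∈ A ∧ f ∈ B ∧ D.IsCrossing e f q.1}

/-- `cr_D(A, B)`: the number of crossings between an edge of `A` and an
edge of `B`. -/
noncomputable def crBetween (A B : Set (Sym2 V)) : ℕ := Nat.card (D.crossings A B)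

/-- `cr(D)`: the total number of crossings of the drawing `D`. -/
noncomputable def crNum : ℕ := D.crBetween G.edgeSet G.edgeSet

/-- A good drawing: no edge crosses itself (each arc is a simple arc),
no two adjacent edges cross, no two edges cross more than once, and no three
edges cross at a common point. -/
structure IsGood : Prop where
  arc_inj : ∀ ⦃a b⦄, G.Adj a b → Set.InjOn (D.arc a b) (Set.Icc 0 1)
  adj_no_cross : ∀ e f : Sym2 V, (∃ a, a ∈ e ∧ a ∈ f) → ∀ p, ¬ D.IsCrossing e f p
  cross_once : ∀ e f : Sym2 V, {p | D.IsCrossing e f p}.Subsingleton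
  no_triple : ∀ p, ∀ e f g : Sym2 V, e ≠ f → e ≠ g → f ≠ g →
      ¬ (D.IsCrossing e f p ∧ D.IsCrossing f g p ∧ D.IsCrossing e g p)

end Drawing

/-- The crossing number of a graph: the minimum number of crossings among
all good drawings of `G` in the plane. -/
noncomputable def crossingNumber (G : SimpleGraph V) : ℕ :=
  sInf {n | ∃ D : Drawing G, D.IsGood ∧ D.crNum = n}

/-- The Zarankiewicz function `Z(m,n) = ⌊m/2⌋⌊(m-1)/2⌋⌊n/2⌋⌊(n-1)/2⌋`. -/
def Z (m n : ℕ) : ℕ := m / 2 * ((m - 1) / 2) * (n / 2) * ((n - 1) / 2)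

/-- The complete bipartite graph `K_{a,b}`. -/
abbrev bipK (a b : ℕ) : SimpleGraph (Fin a ⊕ Fin b) :=
  completeBipartiteGraph (Fin a) (Fin b)

/-- The complete tripartite graph `K_{a,b,c}`. -/
abbrev triK (a b c : ℕ) : SimpleGraph (Σ i : Fin 3, ![Fin a, Fin b, Fin c] i) :=
  completeMultipartiteGraph ![Fin a, Fin b, Fin c]

/-- The complete 4-partite graph `K_{a,b,c,d}`. -/
abbrev quadK (a b c d : ℕ) : SimpleGraph (Σ i : Fin 4, ![Fin a, Fin b, Fin c, Fin d] i) :=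
  completeMultipartiteGraph ![Fin a, Fin b, Fin c, Fin d]

/-- `E(V₁, V₂)`: the set of pairs `{v₁, v₂}` with `v₁ ∈ V₁` and `v₂ ∈ V₂`. -/
def pairEdges {α : Type*} (V₁ V₂ : Set α) : Set (Sym2 α) :=
  {e | ∃ a ∈ V₁, ∃ b ∈ V₂, e = s(a, b)}

namespace CN

/-- underlying edge of a dart -/
def edg (d : V × V) : Sym2 V := s(d.1, d.2)

/-- reversal of a word of darts -/
def rb (w : List (V × V)) : List (V × V) := (w.map Prod.swap).reverse

lemma edg_swap (d : V × V) : edg d.swap = edg d := Sym2.eq_swap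

@[simp] lemma rb_nil : rb ([] : List (V × V)) = [] := rfl

@[simp] lemma rb_rb (w : List (V × V)) : rb (rb w) = w := by
  simp [rb, Function.comp_def]

lemma rb_append (u v : List (V × V)) : rb (u ++ v) = rb v ++ rb u := by
  simp [rb]

lemma rb_cons (d : V × V) (v : List (V × V)) : rb (d :: v) = rb v ++ [d.swap] := by
  simp [rb]

/-- elementary moves on words of darts -/
inductive Step : Multiset (V × List V) → Multiset (Sym2 (Sym2 V)) →
    List (V × V) → List (V × V) → Prop
  | birth (p q : List (V × V)) (v : V) (N : List V) :
      Step {(v, N)} 0 (p ++ q) (p ++ N.map (Prod.mk v) ++ q)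
  | cup (p q : List (V × V)) (d : V × V) : Step 0 0 (p ++ q) (p ++ [d, d.swap] ++ q)
  | cap (p q : List (V × V)) (d : V × V) : Step 0 0 (p ++ [d, d.swap] ++ q) (p ++ q)
  | swap (p q : List (V × V)) (d d' : V × V) :
      Step 0 {s(edg d, edg d')} (p ++ [d, d'] ++ q) (p ++ [d', d] ++ q)

/-- derivations: sequences of moves, with the multiset of births and crossings -/
inductive Der : Multiset (V × List V) → Multiset (Sym2 (Sym2 V)) →
    List (V × V) → List (V × V) → Prop
  | refl (w : List (V × V)) : Der 0 0 w w
  | tail {B C B' C' u v w} : Der B C u v → Step B' C' v w → Der (B + B') (C + C') u w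

lemma Der.single {B : Multiset (V × List V)} {C u v} (h : Step B C u v) : Der B C u v := by
  have := Der.tail (Der.refl u) h
  simpa using this

lemma Der.trans {B C B' C'} {u v w : List (V × V)} (h : Der B C u v) (h' : Der B' C' v w) :
    Der (B + B') (C + C') u w := by
  induction h' with
  | refl => simpa using h
  | tail _ hs ih => rw [← add_assoc, ← add_assoc]; exact Der.tail (ih h) hs

lemma Step.ctx {B C} {u v : List (V × V)} (h : Step B C u v) (p q : List (V × V)) :
    Step B C (p ++ u ++ q) (p ++ v ++ q) := by
  cases h with
  | birth a b v N => simpa [List.append_assoc] using Step.birth (p ++ a) (b ++ q) v N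
  | cup a b d => simpa [List.append_assoc] using Step.cup (p ++ a) (b ++ q) d
  | cap a b d => simpa [List.append_assoc] using Step.cap (p ++ a) (b ++ q) d
  | swap a b d d' => simpa [List.append_assoc] using Step.swap (p ++ a) (b ++ q) d d'

lemma Der.ctx {B C} {u v : List (V × V)} (h : Der B C u v) (p q : List (V × V)) :
    Der B C (p ++ u ++ q) (p ++ v ++ q) := by
  induction h with
  | refl => exact Der.refl _
  | tail _ hs ih => exact Der.tail ih (hs.ctx p q)

lemma Der.cast {B B' C C'} {u u' v v' : List (V × V)} (h : Der B C u v) (hB : B = B')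
    (hC : C = C') (hu : u = u') (hv : v = v') : Der B' C' u' v' := by
  subst hB hC hu hv; exact h

/-- transitivity with context, zero-friendly versions -/
lemma Der.trans0 {B C} {u v w : List (V × V)} (h : Der B C u v) (h' : Der 0 0 v w) :
    Der B C u w := by simpa using h.trans h'

lemma Der.trans0' {B C} {u v w : List (V × V)} (h : Der 0 0 u v) (h' : Der B C v w) :
    Der B C u w := by simpa using h.trans h'

lemma caps (u : List (V × V)) : Der 0 0 (u ++ rb u) [] := by
  induction u using List.reverseRecOn with
  | nil => exact Der.refl _
  | append_singleton u d ih =>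
    have h := Der.single (Step.cap u (rb u) d)
    refine (h.cast rfl rfl ?_ rfl).trans0 ih
    simp [rb]

lemma cups (u : List (V × V)) : Der 0 0 [] (u ++ rb u) := by
  induction u using List.reverseRecOn with
  | nil => exact Der.refl _
  | append_singleton u d ih =>
    have h := Der.single (Step.cup u (rb u) d)
    refine ih.trans0 (h.cast rfl rfl rfl ?_)
    simp [rb]

lemma caps' (u : List (V × V)) : Der 0 0 (rb u ++ u) [] := by simpa using caps (rb u)
lemma cups' (u : List (V × V)) : Der 0 0 [] (rb u ++ u) := by simpa using cups (rb u)

lemma bend {B C} {u v : List (V × V)} (h : Der B C (u ++ rb v) []) : Der B C u v := by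
  have h1 := (cups' v).ctx u []
  have h2 := h.ctx [] v
  refine Der.trans0' (h1.cast rfl rfl (by simp) rfl) (h2.cast rfl rfl (by simp) (by simp))

lemma rot {B C} {u v : List (V × V)} (h : Der B C [] (u ++ v)) : Der B C [] (v ++ u) := by
  have h1 := h.ctx v (rb v)
  have h2 := (caps v).ctx (v ++ u) []
  exact ((cups v).trans0' (h1.cast rfl rfl (by simp) rfl)).trans0
    (h2.cast rfl rfl (by simp) (by simp))

/-- product of crossings -/
def X (u v : List (V × V)) : Multiset (Sym2 (Sym2 V)) :=
  ((u.flatMap fun d => v.map fun d' => s(edg d, edg d') : List _) : Multiset _)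

@[simp] lemma X_nil_left (v : List (V × V)) : X [] v = 0 := rfl
@[simp] lemma X_nil_right (v : List (V × V)) : X v [] = 0 := by simp [X]
lemma X_cons_left (d : V × V) (u v : List (V × V)) : X (d :: u) v = X [d] v + X u v := by
  simp [X]
lemma X_append_left (u u' v : List (V × V)) : X (u ++ u') v = X u v + X u' v := by
  simp [X]
lemma X_comm (u v : List (V × V)) : X u v = X v u := by
  induction u with
  | nil => simp
  | cons d u ih =>
    rw [X_cons_left, ih]
    clear ih
    induction v with
    | nil => simp
    | cons e v ih =>
      rw [X_cons_left e v (d :: u), X_cons_left e v u, ← ih]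
      simp only [X, List.flatMap_cons, List.flatMap_nil, List.map_cons, List.append_nil]
      rw [Sym2.eq_swap (a := edg d) (b := edg e)]
      simp only [← Multiset.cons_coe, ← Multiset.singleton_add]
      abel
lemma X_append_right (u v v' : List (V × V)) : X u (v ++ v') = X u v + X u v' := by
  rw [X_comm, X_append_left, X_comm v, X_comm v']
lemma X_cons_right (u : List (V × V)) (d : V × V) (v : List (V × V)) :
    X u (d :: v) = X u [d] + X u v := by
  rw [X_comm, X_cons_left, X_comm [d], X_comm v]
@[simp] lemma card_X (u v : List (V × V)) : (X u v).card = u.length * v.length := by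
  simp [X, List.length_flatMap]

lemma mem_X {u v : List (V × V)} {z} : z ∈ X u v ↔ ∃ d ∈ u, ∃ d' ∈ v, z = s(edg d, edg d') := by
  simp only [X, Multiset.mem_coe, List.mem_flatMap, List.mem_map]
  constructor
  · rintro ⟨a, ha, b, hb, rfl⟩; exact ⟨a, ha, b, hb, rfl⟩
  · rintro ⟨a, ha, b, hb, rfl⟩; exact ⟨a, ha, b, hb, rfl⟩

lemma move1 (d : V × V) (v : List (V × V)) : Der 0 (X [d] v) ([d] ++ v) (v ++ [d]) := by
  induction v using List.reverseRecOn with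
  | nil => simpa using Der.refl [d]
  | append_singleton v e ih =>
    have h1 := ih.ctx [] [e]
    have h2 := Der.single (Step.swap v [] d e)
    refine ((h1.trans (h2.cast rfl rfl ?_ rfl)).cast ?_ ?_ ?_ ?_)
    · simp
    · simp
    · rw [X_append_right]
      have : X [d] [e] = {s(edg d, edg e)} := rfl
      rw [this]
    · simp
    · simp

lemma move (u v : List (V × V)) : Der 0 (X u v) (u ++ v) (v ++ u) := by
  induction u with
  | nil => simpa using Der.refl v
  | cons d u ih =>
    have h1 := ih.ctx [d] []
    have h2 := (move1 d v).ctx [] u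
    refine (h1.trans (h2.cast rfl rfl ?_ rfl)).cast ?_ ?_ ?_ ?_
    · simp
    · simp
    · rw [X_cons_left d u, add_comm]
    · simp
    · simp

/-- cabling -/
theorem Der.cable {V' : Type*} (φ : V × V → List (V' × V'))
    (hφ : ∀ d, φ d.swap = rb (φ d))
    (gB : V × List V → Multiset (V' × List V')) (gC : V × List V → Multiset (Sym2 (Sym2 V')))
    (ω : Sym2 (Sym2 V) → Multiset (Sym2 (Sym2 V')))
    (hω : ∀ d d', ω s(edg d, edg d') = X (φ d) (φ d'))
    {B C} {u v : List (V × V)} (h : Der B C u v)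
    (hg : ∀ b ∈ B, Der (gB b) (gC b) [] ((b.2.map (Prod.mk b.1)).flatMap φ)) :
    Der (B.map gB).sum ((C.map ω).sum + (B.map gC).sum) (u.flatMap φ) (v.flatMap φ) := by
  induction h with
  | refl => simpa using Der.refl _
  | @tail B C B' C' u v w h hs ih =>
    have ih' := ih (fun b hb => hg b (by simp [hb]))
    have key : Der (B'.map gB).sum ((C'.map ω).sum + (B'.map gC).sum)
        (v.flatMap φ) (w.flatMap φ) := by
      cases hs with
      | birth p q x N =>
        have := (hg (x, N) (by simp)).ctx (p.flatMap φ) (q.flatMap φ)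
        simpa [List.flatMap_append] using this
      | cup p q d =>
        have := (cups (φ d)).ctx (p.flatMap φ) (q.flatMap φ)
        simpa [List.flatMap_append, hφ] using this
      | cap p q d =>
        have := (caps (φ d)).ctx (p.flatMap φ) (q.flatMap φ)
        simpa [List.flatMap_append, hφ] using this
      | swap p q d d' =>
        have := (move (φ d) (φ d')).ctx (p.flatMap φ) (q.flatMap φ)
        simpa [List.flatMap_append, hω] using this
    refine (ih'.trans key).cast ?_ ?_ rfl rfl
    · simp
    · simp only [Multiset.map_add, Multiset.sum_add]; abel

end CN

namespace CN

section Tiles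
variable (vs hs : ℤ → ℤ → List (V × V))

/-- word on a vertical segment, read top to bottom -/
def colw (i j : ℤ) : ℕ → List (V × V)
  | 0 => []
  | b + 1 => vs i (j + b) ++ colw i j b

/-- word on a horizontal segment, read left to right -/
def roww (i j : ℤ) : ℕ → List (V × V)
  | 0 => []
  | a + 1 => roww i j a ++ hs (i + a) j

lemma colw_add (i j : ℤ) (b c : ℕ) :
    colw vs i j (b + c) = colw vs i (j + b) c ++ colw vs i j b := by
  induction c with
  | zero => simp [colw]
  | succ c ih =>
    rw [← add_assoc, colw, ih, colw]
    simp only [List.append_assoc, Nat.cast_add, add_assoc]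

lemma roww_add (i j : ℤ) (b c : ℕ) :
    roww hs i j (b + c) = roww hs i j b ++ roww hs (i + b) j c := by
  induction c with
  | zero => simp [roww]
  | succ c ih =>
    rw [← add_assoc, roww, ih, roww]
    simp only [List.append_assoc, Nat.cast_add, add_assoc]

/-- the tile relation of a rectangle -/
def Tile (B : Multiset (V × List V)) (C : Multiset (Sym2 (Sym2 V))) (i j : ℤ) (a b : ℕ) : Prop :=
  Der B C (colw vs i j b ++ roww hs i j a) (roww hs i (j + b) a ++ colw vs (i + a) j b)

variable {vs hs}

lemma Tile.hcomp {B C B' C'} {i j : ℤ} {a a' b : ℕ} (h : Tile vs hs B C i j a b)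
    (h' : Tile vs hs B' C' (i + a) j a' b) : Tile vs hs (B + B') (C + C') i j (a + a') b := by
  have h1 := Der.ctx h [] (roww hs (i + a) j a')
  have h2 := Der.ctx h' (roww hs i (j + b) a) []
  refine (h1.trans (h2.cast rfl rfl ?_ rfl)).cast rfl rfl ?_ ?_
  · simp
  · simp [roww_add]
  · simp [roww_add, add_assoc]

lemma Tile.vcomp {B C B' C'} {i j : ℤ} {a b b' : ℕ} (h : Tile vs hs B C i j a b)
    (h' : Tile vs hs B' C' i (j + b) a b') : Tile vs hs (B + B') (C + C') i j a (b + b') := by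
  have h1 := Der.ctx h (colw vs i (j + b) b') []
  have h2 := Der.ctx h' [] (colw vs (i + a) j b)
  refine (h1.trans (h2.cast rfl rfl ?_ rfl)).cast rfl rfl ?_ ?_
  · simp
  · simp [colw_add]
  · simp [colw_add, add_assoc]

lemma Tile.zero_w (i j : ℤ) (b : ℕ) : Tile vs hs 0 0 i j 0 b := by
  simpa [Tile, roww] using Der.refl _

lemma Tile.zero_h (i j : ℤ) (a : ℕ) : Tile vs hs 0 0 i j a 0 := by
  simpa [Tile, colw] using Der.refl _

lemma Tile.grid (M : ℕ) (Bf : ℤ → ℤ → Multiset (V × List V))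
    (Cf : ℤ → ℤ → Multiset (Sym2 (Sym2 V))) (k0 l0 : ℤ) (K L : ℕ)
    (h : ∀ k l : ℕ, k < K → l < L → Tile vs hs (Bf (k0 + k) (l0 + l)) (Cf (k0 + k) (l0 + l))
      (M * (k0 + k)) (M * (l0 + l)) M M) :
    Tile vs hs (∑ l ∈ Finset.range L, ∑ k ∈ Finset.range K, Bf (k0 + k) (l0 + l))
      (∑ l ∈ Finset.range L, ∑ k ∈ Finset.range K, Cf (k0 + k) (l0 + l))
      (M * k0) (M * l0) (M * K) (M * L) := by
  have hrow : ∀ l : ℕ, l < L → ∀ K' : ℕ, K' ≤ K →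
      Tile vs hs (∑ k ∈ Finset.range K', Bf (k0 + k) (l0 + l))
      (∑ k ∈ Finset.range K', Cf (k0 + k) (l0 + l)) (M * k0) (M * (l0 + l)) (M * K') M := by
    intro l hl K'
    induction K' with
    | zero => intro _; simpa using Tile.zero_w _ _ _
    | succ K' ih =>
      intro hK
      have h1 := ih (by omega)
      have h2 := h K' l (by omega) hl
      rw [Finset.sum_range_succ, Finset.sum_range_succ, mul_add_one]
      refine h1.hcomp ?_
      convert h2 using 1
      push_cast; ring
  have : ∀ L' : ℕ, L' ≤ L → Tile vs hs
      (∑ l ∈ Finset.range L', ∑ k ∈ Finset.range K, Bf (k0 + k) (l0 + l))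
      (∑ l ∈ Finset.range L', ∑ k ∈ Finset.range K, Cf (k0 + k) (l0 + l))
      (M * k0) (M * l0) (M * K) (M * L') := by
    intro L'
    induction L' with
    | zero => intro _; simpa using Tile.zero_h _ _ _
    | succ L' ih =>
      intro hL
      have h1 := ih (by omega)
      have h2 := hrow L' (by omega) K le_rfl
      rw [Finset.sum_range_succ, Finset.sum_range_succ, mul_add_one]
      refine h1.vcomp ?_
      convert h2 using 1
      push_cast; ring
  exact this L le_rfl

end Tiles

section Passages

/-- word of the side between `a` and `b`, oriented from `a` to `b` -/
def sw (P : List ((ℤ × ℤ) × (ℤ × ℤ) × (V × V))) (a b : ℤ × ℤ) : List (V × V) :=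
  P.flatMap fun z => if z.1 = a ∧ z.2.1 = b then [z.2.2] else
    if z.1 = b ∧ z.2.1 = a then [z.2.2.swap] else []

def vsP (P : List ((ℤ × ℤ) × (ℤ × ℤ) × (V × V))) (i j : ℤ) : List (V × V) :=
  sw P (i - 1, j) (i, j)

def hsP (P : List ((ℤ × ℤ) × (ℤ × ℤ) × (V × V))) (i j : ℤ) : List (V × V) :=
  sw P (i, j - 1) (i, j)

/-- side adjacency of cells -/
def Sadj (a b : ℤ × ℤ) : Prop :=
  (a.2 = b.2 ∧ (a.1 = b.1 + 1 ∨ b.1 = a.1 + 1)) ∨ (a.1 = b.1 ∧ (a.2 = b.2 + 1 ∨ b.2 = a.2 + 1))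

/-- rectangle of cells -/
def InR (i j : ℤ) (a b : ℕ) (c : ℤ × ℤ) : Prop :=
  i ≤ c.1 ∧ c.1 < i + a ∧ j ≤ c.2 ∧ c.2 < j + b

open Classical in
/-- inward darts -/
noncomputable def inw (U : ℤ × ℤ → Prop) (P : List ((ℤ × ℤ) × (ℤ × ℤ) × (V × V))) :
    List (V × V) :=
  P.flatMap fun z => if U z.2.1 ∧ ¬ U z.1 then [z.2.2] else
    if U z.1 ∧ ¬ U z.2.1 then [z.2.2.swap] else []

lemma colw_nil (i j : ℤ) (b : ℕ) : colw (vsP ([] : List (_ × _ × (V × V)))) i j b = [] := by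
  induction b with
  | zero => rfl
  | succ b ih => simp [colw, ih, vsP, sw]

lemma roww_nil (i j : ℤ) (b : ℕ) : roww (hsP ([] : List (_ × _ × (V × V)))) i j b = [] := by
  induction b with
  | zero => rfl
  | succ b ih => simp [roww, ih, hsP, sw]

lemma sw_cons (z) (P : List ((ℤ × ℤ) × (ℤ × ℤ) × (V × V))) (a b) :
    sw (z :: P) a b = sw [z] a b ++ sw P a b := by simp [sw]

lemma colw_cons (z) (P : List ((ℤ × ℤ) × (ℤ × ℤ) × (V × V))) (i j : ℤ) (b : ℕ) :
    (colw (vsP (z :: P)) i j b).Perm (colw (vsP [z]) i j b ++ colw (vsP P) i j b) := by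
  rw [← Multiset.coe_eq_coe]
  induction b with
  | zero => rfl
  | succ b ih =>
    simp only [colw, ← Multiset.coe_add, ih]
    simp only [vsP]; rw [sw_cons]
    simp only [← Multiset.coe_add]; abel

lemma roww_cons (z) (P : List ((ℤ × ℤ) × (ℤ × ℤ) × (V × V))) (i j : ℤ) (b : ℕ) :
    (roww (hsP (z :: P)) i j b).Perm (roww (hsP [z]) i j b ++ roww (hsP P) i j b) := by
  rw [← Multiset.coe_eq_coe]
  induction b with
  | zero => rfl
  | succ b ih =>
    simp only [roww, ← Multiset.coe_add, ih]
    simp only [hsP]; rw [sw_cons]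
    simp only [← Multiset.coe_add]; abel

lemma colw_one (x y : ℤ × ℤ) (d : V × V) (i j : ℤ) (b : ℕ) :
    colw (vsP [(x, y, d)]) i j b =
      if j ≤ y.2 ∧ y.2 < j + b ∧ x.2 = y.2 then
        (if x.1 = i - 1 ∧ y.1 = i then [d] else if x.1 = i ∧ y.1 = i - 1 then [d.swap] else [])
      else [] := by
  induction b with
  | zero => simp [colw]; intros; omega
  | succ b ih =>
    rw [colw, ih]
    obtain ⟨x1, x2⟩ := x
    obtain ⟨y1, y2⟩ := y
    simp only [vsP, sw, List.flatMap_cons, List.flatMap_nil, List.append_nil, Prod.mk.injEq]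
    push_cast
    split_ifs <;> first | rfl | (exfalso; omega)

lemma roww_one (x y : ℤ × ℤ) (d : V × V) (i j : ℤ) (b : ℕ) :
    roww (hsP [(x, y, d)]) i j b =
      if i ≤ y.1 ∧ y.1 < i + b ∧ x.1 = y.1 then
        (if x.2 = j - 1 ∧ y.2 = j then [d] else if x.2 = j ∧ y.2 = j - 1 then [d.swap] else [])
      else [] := by
  induction b with
  | zero => simp [roww]; intros; omega
  | succ b ih =>
    rw [roww, ih]
    obtain ⟨x1, x2⟩ := x
    obtain ⟨y1, y2⟩ := y
    simp only [hsP, sw, List.flatMap_cons, List.flatMap_nil, List.append_nil, Prod.mk.injEq]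
    push_cast
    split_ifs <;> first | rfl | (exfalso; omega)

end Passages
end CN

namespace CN

lemma coe_rb (w : List (V × V)) : ((rb w : List _) : Multiset (V × V)) =
    (w : Multiset (V × V)).map Prod.swap := by
  simp [rb]

/-- boundary word of a rectangle -/
def bword (P : List ((ℤ × ℤ) × (ℤ × ℤ) × (V × V))) (i j : ℤ) (a b : ℕ) : List (V × V) :=
  (colw (vsP P) i j b ++ roww (hsP P) i j a) ++
    rb (roww (hsP P) i (j + b) a ++ colw (vsP P) (i + a) j b)

lemma inw_in {U : ℤ × ℤ → Prop} {x y : ℤ × ℤ} (d : V × V) (hx : ¬ U x) (hy : U y) :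
    inw U [(x, y, d)] = [d] := by simp [inw, hx, hy]
lemma inw_out {U : ℤ × ℤ → Prop} {x y : ℤ × ℤ} (d : V × V) (hx : U x) (hy : ¬ U y) :
    inw U [(x, y, d)] = [d.swap] := by simp [inw, hx, hy]
lemma inw_same {U : ℤ × ℤ → Prop} {x y : ℤ × ℤ} (d : V × V) (h : U x ↔ U y) :
    inw U [(x, y, d)] = [] := by simp [inw, h]

set_option maxHeartbeats 1000000 in
lemma bword_one (z : (ℤ × ℤ) × (ℤ × ℤ) × (V × V)) (hz : Sadj z.1 z.2.1) (i j : ℤ) (a b : ℕ)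
    (ha : 0 < a) (hb : 0 < b) : bword [z] i j a b = inw (InR i j a b) [z] := by
  obtain ⟨x, y, d⟩ := z
  have key : inw (InR i j a b) [(x, y, d)] = [] ∧ (InR i j a b x ↔ InR i j a b y) ∨
    inw (InR i j a b) [(x, y, d)] = [d] ∧ ¬ InR i j a b x ∧ InR i j a b y ∨
    inw (InR i j a b) [(x, y, d)] = [d.swap] ∧ InR i j a b x ∧ ¬ InR i j a b y := by
    by_cases hx : InR i j a b x <;> by_cases hy : InR i j a b y
    · exact Or.inl ⟨inw_same d (by tauto), by tauto⟩
    · exact Or.inr (Or.inr ⟨inw_out d hx hy, hx, hy⟩)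
    · exact Or.inr (Or.inl ⟨inw_in d hx hy, hx, hy⟩)
    · exact Or.inl ⟨inw_same d (by tauto), by tauto⟩
  obtain ⟨x1, x2⟩ := x
  obtain ⟨y1, y2⟩ := y
  generalize inw (InR i j a b) [((x1, x2), (y1, y2), d)] = R at key ⊢
  simp only [Sadj] at hz
  simp only [bword, colw_one, roww_one]
  simp only [InR] at key
  rcases hz with ⟨h, h' | h'⟩ | ⟨h, h' | h'⟩
  · subst h h'
    have e1 : ¬ (y1 + 1 = y1) := by omega
    simp only [e1, and_false, if_false, List.append_nil, List.nil_append, and_true]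
    rcases key with ⟨rfl, k⟩ | ⟨rfl, k1, k2⟩ | ⟨rfl, k1, k2⟩ <;>
    split_ifs <;> first | rfl | (exfalso; omega)
  · subst h h'
    have e1 : ¬ (x1 = x1 + 1) := by omega
    simp only [e1, and_false, if_false, List.append_nil, List.nil_append, and_true]
    rcases key with ⟨rfl, k⟩ | ⟨rfl, k1, k2⟩ | ⟨rfl, k1, k2⟩ <;>
    split_ifs <;> first | rfl | (exfalso; omega)
  · subst h h'
    have e1 : ¬ (y2 + 1 = y2) := by omega
    simp only [e1, and_false, if_false, List.append_nil, List.nil_append, and_true]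
    rcases key with ⟨rfl, k⟩ | ⟨rfl, k1, k2⟩ | ⟨rfl, k1, k2⟩ <;>
    split_ifs <;> first | rfl | (exfalso; omega)
  · subst h h'
    have e1 : ¬ (x2 = x2 + 1) := by omega
    simp only [e1, and_false, if_false, List.append_nil, List.nil_append, and_true]
    rcases key with ⟨rfl, k⟩ | ⟨rfl, k1, k2⟩ | ⟨rfl, k1, k2⟩ <;>
    split_ifs <;> first | rfl | (exfalso; omega)

lemma bword_perm (P : List ((ℤ × ℤ) × (ℤ × ℤ) × (V × V))) (hP : ∀ z ∈ P, Sadj z.1 z.2.1)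
    (i j : ℤ) (a b : ℕ) (ha : 0 < a) (hb : 0 < b) :
    (bword P i j a b).Perm (inw (InR i j a b) P) := by
  rw [← Multiset.coe_eq_coe]
  induction P with
  | nil => simp [bword, colw_nil, roww_nil, inw]
  | cons z P ih =>
    have h1 : inw (InR i j a b) (z :: P) = inw (InR i j a b) [z] ++ inw (InR i j a b) P := by
      simp [inw]
    rw [h1, ← Multiset.coe_add, ← ih (fun z hz => hP z (by simp [hz])),
      ← bword_one z (hP z (by simp)) _ _ _ _ ha hb]
    have c1 := Multiset.coe_eq_coe.2 (colw_cons z P i j b)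
    have c2 := Multiset.coe_eq_coe.2 (colw_cons z P (i + a) j b)
    have r1 := Multiset.coe_eq_coe.2 (roww_cons z P i j a)
    have r2 := Multiset.coe_eq_coe.2 (roww_cons z P i (j + b) a)
    simp only [bword, ← Multiset.coe_add, coe_rb, Multiset.map_add] at c1 c2 r1 r2 ⊢
    rw [c1, c2, r1, r2]
    simp only [Multiset.map_add]
    abel

lemma tile_of_bword {P : List ((ℤ × ℤ) × (ℤ × ℤ) × (V × V))} {B C} {i j : ℤ} {a b : ℕ}
    (h : Der B C (bword P i j a b) []) : Tile (vsP P) (hsP P) B C i j a b := bend h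

lemma der_pair {w : List (V × V)} {d : V × V} (h : w.Perm [d, d.swap]) : Der 0 0 w [] := by
  rcases List.perm_pair.1 h with rfl | rfl
  · simpa [rb] using caps [d]
  · simpa [rb] using caps' [d]

end CN

namespace CN

/-- passages of a path of cells -/
def pas (d : V × V) (a : ℤ × ℤ) : List (ℤ × ℤ) → List ((ℤ × ℤ) × (ℤ × ℤ) × (V × V))
  | [] => []
  | b :: l => (a, b, d) :: pas d b l

lemma pas_append (d : V × V) (a b : ℤ × ℤ) (l l' : List (ℤ × ℤ)) :
    pas d a (l ++ b :: l') = pas d a (l ++ [b]) ++ pas d b l' := by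
  induction l generalizing a with
  | nil => simp [pas]
  | cons x l ih => simp [pas, ih]

lemma inw_append (U : ℤ × ℤ → Prop) (P Q : List ((ℤ × ℤ) × (ℤ × ℤ) × (V × V))) :
    inw U (P ++ Q) = inw U P ++ inw U Q := by simp [inw]

lemma inw_cons (U : ℤ × ℤ → Prop) (z) (Q : List ((ℤ × ℤ) × (ℤ × ℤ) × (V × V))) :
    inw U (z :: Q) = inw U [z] ++ inw U Q := by simp [inw]

open Classical in
lemma inw_pas (U : ℤ × ℤ → Prop) (d : V × V) (a b : ℤ × ℤ) (l : List (ℤ × ℤ)) (ha : ¬ U a)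
    (hl : ∀ x ∈ l, ¬ U x) : inw U (pas d a (l ++ [b])) = if U b then [d] else [] := by
  induction l generalizing a with
  | nil =>
    by_cases hb : U b
    · simp only [List.nil_append, pas, hb, if_true]; exact inw_in d ha hb
    · simp only [List.nil_append, pas, hb, if_false]; exact inw_same d (by tauto)
  | cons x l ih =>
    have hx := hl x (by simp)
    rw [List.cons_append, pas, inw_cons, ih x hx (fun y hy => hl y (by simp [hy])),
      inw_same d (by tauto)]
    rfl

open Classical in
lemma inw_pas_ends (U : ℤ × ℤ → Prop) (d : V × V) (a b : ℤ × ℤ) (l : List (ℤ × ℤ)) (hne : l ≠ [])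
    (hl : ∀ x ∈ l, ¬ U x) : inw U (pas d a (l ++ [b])) =
      (if U a then [d.swap] else []) ++ if U b then [d] else [] := by
  cases l with
  | nil => exact absurd rfl hne
  | cons x l =>
    have hx := hl x (by simp)
    rw [List.cons_append, pas, inw_cons, inw_pas U d x b l hx (fun y hy => hl y (by simp [hy]))]
    congr 1
    by_cases ha : U a
    · simp only [ha, if_true]; exact inw_out d ha hx
    · simp only [ha, if_false]; exact inw_same d (by tauto)

lemma inw_pas_mid (U : ℤ × ℤ → Prop) (d : V × V) (a b c : ℤ × ℤ) (l l' : List (ℤ × ℤ))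
    (ha : ¬ U a) (hb : ¬ U b) (hc : U c) (hl : ∀ x ∈ l, ¬ U x) (hl' : ∀ x ∈ l', ¬ U x) :
    inw U (pas d a (l ++ c :: l' ++ [b])) = [d, d.swap] := by
  classical
  rw [List.append_assoc, List.cons_append, pas_append, inw_append, inw_pas U d a c l ha hl,
    if_pos hc]
  have : inw U (pas d c (l' ++ [b])) = [d.swap] := by
    cases l' with
    | nil => exact inw_out d hc hb
    | cons x l' =>
      have hx := hl' x (by simp)
      rw [List.cons_append, pas, inw_cons, inw_pas U d x b l' hx (fun y hy => hl' y (by simp [hy])),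
        if_neg hb, inw_out d hc hx]
      rfl
  rw [this]; rfl

/-- coarse cell of a fine cell -/
def coarse (M : ℕ) (x : ℤ × ℤ) : ℤ × ℤ := (x.1 / M, x.2 / M)

lemma ediv_eq_iff' {M : ℕ} (hM : 0 < M) (x k : ℤ) : x / M = k ↔ M * k ≤ x ∧ x < M * k + M := by
  have hM' : (0 : ℤ) < M := by exact_mod_cast hM
  rw [Int.ediv_eq_iff_of_pos hM']
  constructor <;> intro ⟨h1, h2⟩ <;> constructor <;> nlinarith

lemma inR_coarse {M : ℕ} (hM : 0 < M) (k l : ℤ) (x : ℤ × ℤ) :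
    InR (M * k) (M * l) M M x ↔ coarse M x = (k, l) := by
  simp only [InR, coarse, Prod.mk.injEq, ediv_eq_iff' hM]
  tauto

lemma pas_chain {d : V × V} {a : ℤ × ℤ} {l : List (ℤ × ℤ)} (h : List.IsChain Sadj (a :: l)) :
    ∀ z ∈ pas d a l, Sadj z.1 z.2.1 := by
  induction l generalizing a with
  | nil => simp [pas]
  | cons b l ih =>
    rw [List.isChain_cons_cons] at h
    intro z hz
    simp only [pas, List.mem_cons] at hz
    rcases hz with rfl | hz
    · exact h.1
    · exact ih h.2 z hz

lemma inw_flatMap {J : Type*} (U : ℤ × ℤ → Prop) (Js : List J)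
    (f : J → List ((ℤ × ℤ) × (ℤ × ℤ) × (V × V))) :
    inw U (Js.flatMap f) = Js.flatMap (fun j => inw U (f j)) := by
  induction Js with
  | nil => simp [inw]
  | cons j Js ih => rw [List.flatMap_cons, inw_append, ih, List.flatMap_cons]

lemma bounded_cells (P : List ((ℤ × ℤ) × (ℤ × ℤ) × (V × V))) :
    ∃ R : ℕ, ∀ z ∈ P, ∀ x, (x = z.1 ∨ x = z.2.1) → |x.1| < R ∧ |x.2| < R := by
  induction P with
  | nil => exact ⟨0, by simp⟩
  | cons z P ih =>
    obtain ⟨R, hR⟩ := ih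
    refine ⟨R + z.1.1.natAbs + z.1.2.natAbs + z.2.1.1.natAbs + z.2.1.2.natAbs + 1, ?_⟩
    intro w hw x hx
    rcases List.mem_cons.1 hw with rfl | hw
    · rcases hx with rfl | rfl <;> rw [abs_lt, abs_lt] <;> omega
    · have := hR w hw x hx
      rw [abs_lt, abs_lt] at *
      omega

lemma sw_nil_of {P : List ((ℤ × ℤ) × (ℤ × ℤ) × (V × V))} {a b : ℤ × ℤ}
    (h : ∀ z ∈ P, ¬ (z.1 = a ∧ z.2.1 = b) ∧ ¬ (z.1 = b ∧ z.2.1 = a)) : sw P a b = [] := by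
  unfold sw
  rw [List.flatMap_eq_nil_iff]
  intro z hz
  rw [if_neg (h z hz).1, if_neg (h z hz).2]

lemma colw_nil_of {vs : ℤ → ℤ → List (V × V)} {i : ℤ} (h : ∀ j, vs i j = []) (j : ℤ) (b : ℕ) :
    colw vs i j b = [] := by
  induction b with
  | zero => rfl
  | succ b ih => simp [colw, ih, h]

lemma roww_nil_of {hs : ℤ → ℤ → List (V × V)} {j : ℤ} (h : ∀ i, hs i j = []) (i : ℤ) (b : ℕ) :
    roww hs i j b = [] := by
  induction b with
  | zero => rfl
  | succ b ih => simp [roww, ih, h]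

open Classical in
/-- inward darts at a special point -/
noncomputable def incid {J S : Type*} [Fintype J] (src tgt : J → S) (dart : J → V × V) (s : S) :
    List (V × V) :=
  (Finset.univ : Finset J).toList.flatMap fun j =>
    (if src j = s then [(dart j).swap] else []) ++ if tgt j = s then [dart j] else []

theorem tiles_main {J S : Type*} [Fintype J] [Fintype S] (M : ℕ) (hM : 0 < M)
    (c : S → ℤ × ℤ) (hc : Function.Injective c) (src tgt : J → S) (dart : J → V × V)
    (st en : J → ℤ × ℤ) (mid : J → List (ℤ × ℤ))
    (hst : ∀ j, coarse M (st j) = c (src j)) (hen : ∀ j, coarse M (en j) = c (tgt j))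
    (hch : ∀ j, List.IsChain Sadj (st j :: (mid j ++ [en j])))
    (hnd : ∀ j, (mid j).Nodup) (hne : ∀ j, mid j ≠ [])
    (hmid : ∀ j, ∀ x ∈ mid j, ∀ s, coarse M x ≠ c s)
    (hdis : ∀ j j', j ≠ j' → ∀ x ∈ mid j, x ∉ mid j')
    (Φ : S → Multiset (V × List V) → Multiset (Sym2 (Sym2 V)) → Prop)
    (hΦ : ∀ s w, w.Perm (incid src tgt dart s) → ∃ B C, Φ s B C ∧ Der B C w []) :
    ∃ (B : S → Multiset (V × List V)) (C : S → Multiset (Sym2 (Sym2 V))),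
      (∀ s, Φ s (B s) (C s)) ∧ Der (∑ s, B s) (∑ s, C s) [] [] := by
  classical
  set P : List ((ℤ × ℤ) × (ℤ × ℤ) × (V × V)) := (Finset.univ : Finset J).toList.flatMap
    (fun j => pas (dart j) (st j) (mid j ++ [en j])) with hP
  have hPadj : ∀ z ∈ P, Sadj z.1 z.2.1 := by
    intro z hz
    obtain ⟨j, _, hj⟩ := List.mem_flatMap.1 hz
    exact pas_chain (hch j) z hj
  -- special boxes
  have hspec : ∀ s, ∃ B C, Φ s B C ∧ Tile (vsP P) (hsP P) B C (M * (c s).1) (M * (c s).2) M M := by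
    intro s
    have hp := bword_perm P hPadj (M * (c s).1) (M * (c s).2) M M hM hM
    have e : inw (InR (M * (c s).1) (M * (c s).2) M M) P = incid src tgt dart s := by
      rw [hP, inw_flatMap, incid]
      congr 1
      funext j
      rw [inw_pas_ends _ _ _ _ _ (hne j)]
      · simp only [inR_coarse hM, hst, hen, Prod.mk.eta, hc.eq_iff]
      · intro x hx
        rw [inR_coarse hM]; exact hmid j x hx s
    rw [e] at hp
    obtain ⟨B, C, h1, h2⟩ := hΦ s _ hp
    exact ⟨B, C, h1, tile_of_bword h2⟩
  choose B C hBC hT using hspec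
  -- fine cells
  have hfine : ∀ x : ℤ × ℤ, (∀ s, coarse M x ≠ c s) →
      Tile (vsP P) (hsP P) 0 0 x.1 x.2 1 1 := by
    intro x hx
    apply tile_of_bword
    have hp := bword_perm P hPadj x.1 x.2 1 1 one_pos one_pos
    have hU : ∀ y, InR x.1 x.2 1 1 y ↔ y = x := by
      intro y; simp only [InR, Prod.ext_iff]; push_cast; omega
    rw [hP, inw_flatMap, ← hP] at hp
    have hs : ∀ j, st j ≠ x := fun j e => hx (src j) (by rw [← hst j, e])
    have he : ∀ j, en j ≠ x := fun j e => hx (tgt j) (by rw [← hen j, e])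
    have hnot : ∀ j, x ∉ mid j →
        inw (InR x.1 x.2 1 1) (pas (dart j) (st j) (mid j ++ [en j])) = [] := by
      intro j hj
      rw [inw_pas_ends _ _ _ _ _ (hne j)]
      · simp [hU, hs, he]
      · intro y hy; rw [hU]; rintro rfl; exact hj hy
    by_cases h : ∃ j, x ∈ mid j
    · obtain ⟨j, hj⟩ := h
      refine der_pair (d := dart j) (hp.trans ?_)
      have hmem : j ∈ (Finset.univ : Finset J).toList := by simp
      have hnd' := Finset.nodup_toList (Finset.univ : Finset J)
      obtain ⟨l1, l2, hl⟩ := List.append_of_mem hmem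
      rw [hl] at hnd' ⊢
      have hz : ∀ j' ∈ l1 ++ l2, inw (InR x.1 x.2 1 1)
          (pas (dart j') (st j') (mid j' ++ [en j'])) = [] := by
        intro j' hj'
        refine hnot j' (hdis j j' ?_ x hj)
        rintro rfl
        rw [List.nodup_append_comm, List.cons_append, List.nodup_cons] at hnd'
        apply hnd'.1
        simp only [List.mem_append] at hj' ⊢; tauto
      have h1 : l1.flatMap (fun j => inw (InR x.1 x.2 1 1)
          (pas (dart j) (st j) (mid j ++ [en j]))) = [] := by
        rw [List.flatMap_eq_nil_iff]; intro j' hj'; exact hz j' (by simp [hj'])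
      have h2 : l2.flatMap (fun j => inw (InR x.1 x.2 1 1)
          (pas (dart j) (st j) (mid j ++ [en j]))) = [] := by
        rw [List.flatMap_eq_nil_iff]; intro j' hj'; exact hz j' (by simp [hj'])
      rw [List.flatMap_append, List.flatMap_cons, h1, h2]
      obtain ⟨m1, m2, hm⟩ := List.append_of_mem hj
      have hn := hnd j
      rw [hm] at hn ⊢
      rw [List.nodup_append_comm, List.cons_append, List.nodup_cons] at hn
      rw [inw_pas_mid]
      · simp
      · rw [hU]; exact hs j
      · rw [hU]; exact he j
      · rw [hU]
      · intro y hy; rw [hU]; rintro rfl; exact hn.1 (by simp [hy])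
      · intro y hy; rw [hU]; rintro rfl; exact hn.1 (by simp [hy])
    · push Not at h
      have : bword P x.1 x.2 1 1 = [] := by
        rw [← List.perm_nil]
        refine hp.trans ?_
        rw [List.perm_nil, List.flatMap_eq_nil_iff]
        intro j _
        exact hnot j (h j)
      rw [this]; exact Der.refl _
  -- plain coarse cells
  have hplain : ∀ k l : ℤ, (∀ s, c s ≠ (k, l)) → Tile (vsP P) (hsP P) 0 0 (M * k) (M * l) M M := by
    intro k l hkl
    have := Tile.grid (vs := vsP P) (hs := hsP P) 1 (fun _ _ => 0) (fun _ _ => 0)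
      (M * k) (M * l) M M (by
        intro a b ha hb
        have := hfine ((M * k + a), (M * l + b)) (by
          intro s hs
          have : coarse M ((M * k + a), (M * l + b)) = (k, l) := by
            rw [← inR_coarse hM]; simp only [InR]; omega
          exact hkl s (by rw [← hs, this]))
        simpa using this)
    simpa using this
  set Bf : ℤ → ℤ → Multiset (V × List V) := fun k l => ∑ s, if c s = (k, l) then B s else 0 with hBf
  set Cf : ℤ → ℤ → Multiset (Sym2 (Sym2 V)) := fun k l => ∑ s, if c s = (k, l) then C s else 0
    with hCf
  have hall : ∀ k l : ℤ, Tile (vsP P) (hsP P) (Bf k l) (Cf k l) (M * k) (M * l) M M := by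
    intro k l
    by_cases h : ∃ s, c s = (k, l)
    · obtain ⟨s, hs⟩ := h
      have e1 : Bf k l = B s := by
        simp only [hBf, ← hs, hc.eq_iff]; simp
      have e2 : Cf k l = C s := by
        simp only [hCf, ← hs, hc.eq_iff]; simp
      rw [e1, e2]
      have := hT s
      rwa [hs] at this
    · push Not at h
      have e1 : Bf k l = 0 := by simp [hBf, h]
      have e2 : Cf k l = 0 := by simp [hCf, h]
      rw [e1, e2]
      exact hplain k l h
  obtain ⟨R1, hR1⟩ := bounded_cells P
  obtain ⟨R2, hR2⟩ : ∃ R2 : ℕ, ∀ s, |(c s).1| < R2 ∧ |(c s).2| < R2 := by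
    refine ⟨∑ s, ((c s).1.natAbs + (c s).2.natAbs) + 1, fun s => ?_⟩
    have := Finset.single_le_sum (f := fun s => ((c s).1.natAbs + (c s).2.natAbs))
      (fun _ _ => Nat.zero_le _) (Finset.mem_univ s)
    rw [abs_lt, abs_lt]
    omega
  set R := R1 + R2 with hR
  have hg := Tile.grid (vs := vsP P) (hs := hsP P) M Bf Cf (-R) (-R) (2 * R) (2 * R)
    (fun k l _ _ => hall _ _)
  have hMR : (R : ℤ) ≤ M * R := by
    have : (1 : ℤ) ≤ M := by exact_mod_cast hM
    nlinarith [Int.natCast_nonneg R]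
  have hv1 : ∀ j, vsP P (M * (-R : ℤ)) j = [] := by
    intro j
    apply sw_nil_of
    intro z hz
    have h1 := hR1 z hz z.1 (Or.inl rfl)
    have h2 := hR1 z hz z.2.1 (Or.inr rfl)
    rw [abs_lt, abs_lt] at h1 h2
    simp only [Prod.ext_iff]
    have : (M * (-R : ℤ)) = - (M * R) := by ring
    rw [this]
    constructor <;> omega
  have hv2 : ∀ j, vsP P (M * (-R : ℤ) + (M * (2 * R) : ℕ)) j = [] := by
    intro j
    apply sw_nil_of
    intro z hz
    have h1 := hR1 z hz z.1 (Or.inl rfl)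
    have h2 := hR1 z hz z.2.1 (Or.inr rfl)
    rw [abs_lt, abs_lt] at h1 h2
    simp only [Prod.ext_iff]
    have : (M * (-R : ℤ) + (M * (2 * R) : ℕ)) = (M * R) := by push_cast; ring
    rw [this]
    constructor <;> omega
  have hh1 : ∀ j, hsP P j (M * (-R : ℤ)) = [] := by
    intro j
    apply sw_nil_of
    intro z hz
    have h1 := hR1 z hz z.1 (Or.inl rfl)
    have h2 := hR1 z hz z.2.1 (Or.inr rfl)
    rw [abs_lt, abs_lt] at h1 h2
    simp only [Prod.ext_iff]
    have : (M * (-R : ℤ)) = - (M * R) := by ring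
    rw [this]
    constructor <;> omega
  have hh2 : ∀ j, hsP P j (M * (-R : ℤ) + (M * (2 * R) : ℕ)) = [] := by
    intro j
    apply sw_nil_of
    intro z hz
    have h1 := hR1 z hz z.1 (Or.inl rfl)
    have h2 := hR1 z hz z.2.1 (Or.inr rfl)
    rw [abs_lt, abs_lt] at h1 h2
    simp only [Prod.ext_iff]
    have : (M * (-R : ℤ) + (M * (2 * R) : ℕ)) = (M * R) := by push_cast; ring
    rw [this]
    constructor <;> omega
  rw [Tile, colw_nil_of hv1, colw_nil_of hv2, roww_nil_of hh1, roww_nil_of hh2] at hg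
  have hsum : ∀ {A : Type _} [AddCommMonoid A] (f : S → A),
      ∑ l ∈ Finset.range (2 * R), ∑ k ∈ Finset.range (2 * R),
        (∑ s, if c s = ((-R : ℤ) + k, (-R : ℤ) + l) then f s else 0) = ∑ s, f s := by
    intro A _ f
    have : ∀ l ∈ Finset.range (2 * R), ∑ k ∈ Finset.range (2 * R),
        (∑ s, if c s = ((-R : ℤ) + k, (-R : ℤ) + l) then f s else 0) =
        ∑ s, ∑ k ∈ Finset.range (2 * R),
        (if c s = ((-R : ℤ) + k, (-R : ℤ) + l) then f s else 0) := fun l _ => Finset.sum_comm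
    rw [Finset.sum_congr rfl this, Finset.sum_comm]
    refine Finset.sum_congr rfl fun s _ => ?_
    obtain ⟨h1, h2⟩ := hR2 s
    rw [abs_lt] at h1 h2
    rw [Finset.sum_eq_single ((c s).2 + R).toNat, Finset.sum_eq_single ((c s).1 + R).toNat]
    · rw [if_pos]; ext <;> simp <;> omega
    · intro b _ hb
      rw [if_neg]; intro e; apply hb; rw [e]; simp
    · intro h; exfalso; apply h; simp; omega
    · intro b _ hb
      refine Finset.sum_eq_zero fun b' _ => ?_
      rw [if_neg]; intro e; apply hb; rw [e]; simp
    · intro h; exfalso; apply h; simp; omega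
  refine ⟨B, C, hBC, hg.cast (hsum B) (hsum C) rfl rfl⟩

end CN

namespace CN

/-- closed cell of the grid of mesh `1/M` -/
def Q (M : ℕ) (x : ℤ × ℤ) : Set (ℝ × ℝ) :=
  {p | (x.1 : ℝ) ≤ M * p.1 ∧ (M * p.1 : ℝ) ≤ x.1 + 1 ∧ (x.2 : ℝ) ≤ M * p.2 ∧
    (M * p.2 : ℝ) ≤ x.2 + 1}

lemma isClosed_Q (M : ℕ) (x : ℤ × ℤ) : IsClosed (Q M x) := by
  unfold Q
  refine IsClosed.and ?_ (IsClosed.and ?_ (IsClosed.and ?_ ?_)) <;>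
    refine isClosed_le ?_ ?_ <;> fun_prop

lemma Q_corner {M : ℕ} {f g : ℤ × ℤ} {p : ℝ × ℝ} (hf : p ∈ Q M f) (hg : p ∈ Q M g) :
    p ∈ Q M (f.1, g.2) := ⟨hf.1, hf.2.1, hg.2.2.1, hg.2.2.2⟩

lemma Q_adj {M : ℕ} {f g : ℤ × ℤ} {p : ℝ × ℝ} (hf : p ∈ Q M f) (hg : p ∈ Q M g) :
    f = g ∨ Sadj f g ∨ (Sadj f (f.1, g.2) ∧ Sadj (f.1, g.2) g ∧ Sadj f (g.1, f.2) ∧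
      Sadj (g.1, f.2) g) := by
  obtain ⟨a1, a2, a3, a4⟩ := hf
  obtain ⟨b1, b2, b3, b4⟩ := hg
  have h1 : (f.1 : ℝ) ≤ g.1 + 1 := by linarith
  have h2 : (g.1 : ℝ) ≤ f.1 + 1 := by linarith
  have h3 : (f.2 : ℝ) ≤ g.2 + 1 := by linarith
  have h4 : (g.2 : ℝ) ≤ f.2 + 1 := by linarith
  norm_cast at h1 h2 h3 h4
  obtain ⟨f1, f2⟩ := f
  obtain ⟨g1, g2⟩ := g
  simp only at h1 h2 h3 h4
  by_cases e1 : f1 = g1 <;> by_cases e2 : f2 = g2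
  · exact Or.inl (by rw [e1, e2])
  · exact Or.inr (Or.inl (by simp only [Sadj]; omega))
  · exact Or.inr (Or.inl (by simp only [Sadj]; omega))
  · refine Or.inr (Or.inr ⟨?_, ?_, ?_, ?_⟩) <;> simp only [Sadj, true_and] <;> omega

lemma Q_coarse {M : ℕ} (hM : 0 < M) {x : ℤ × ℤ} {p : ℝ × ℝ} (h : p ∈ Q M x) :
    p ∈ Q 1 (coarse M x) := by
  obtain ⟨a1, a2, a3, a4⟩ := h
  have hM' : (0 : ℝ) < M := by exact_mod_cast hM
  have h1 := (ediv_eq_iff' hM x.1 _).1 rfl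
  have h2 := (ediv_eq_iff' hM x.2 _).1 rfl
  have e1 : ((M : ℝ) * ((x.1 / M : ℤ) : ℝ)) ≤ x.1 := by exact_mod_cast h1.1
  have e2 : ((x.1 : ℝ) + 1) ≤ M * ((x.1 / M : ℤ) : ℝ) + M := by exact_mod_cast h1.2
  have e3 : ((M : ℝ) * ((x.2 / M : ℤ) : ℝ)) ≤ x.2 := by exact_mod_cast h2.1
  have e4 : ((x.2 : ℝ) + 1) ≤ M * ((x.2 / M : ℤ) : ℝ) + M := by exact_mod_cast h2.2
  simp only [Q, coarse, Set.mem_ofPred_eq, Nat.cast_one, one_mul]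
  refine ⟨?_, ?_, ?_, ?_⟩
  · exact le_of_mul_le_mul_left (by linarith) hM'
  · exact le_of_mul_le_mul_left (by linarith) hM'
  · exact le_of_mul_le_mul_left (by linarith) hM'
  · exact le_of_mul_le_mul_left (by linarith) hM'

lemma exists_fine1 {M : ℕ} (hM : 0 < M) {c : ℤ} {r : ℝ} (h1 : (c : ℝ) ≤ r) (h2 : r ≤ c + 1) :
    ∃ x : ℤ, x / M = c ∧ (x : ℝ) ≤ M * r ∧ (M * r : ℝ) ≤ x + 1 := by
  have hM' : (1 : ℝ) ≤ M := by exact_mod_cast hM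
  by_cases h : r < c + 1
  · refine ⟨⌊(M * r : ℝ)⌋, ?_, Int.floor_le _, (Int.lt_floor_add_one _).le⟩
    rw [ediv_eq_iff' hM]
    constructor
    · rw [Int.le_floor]; push_cast; nlinarith
    · rw [Int.floor_lt]; push_cast; nlinarith
  · have hr : r = c + 1 := le_antisymm h2 (not_lt.1 h)
    refine ⟨M * c + M - 1, ?_, ?_, ?_⟩
    · rw [ediv_eq_iff' hM]; constructor <;> omega
    · rw [hr]; push_cast; linarith
    · rw [hr]; push_cast; linarith

lemma exists_fine {M : ℕ} (hM : 0 < M) {c : ℤ × ℤ} {p : ℝ × ℝ} (h : p ∈ Q 1 c) :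
    ∃ x, coarse M x = c ∧ p ∈ Q M x := by
  simp only [Q, Set.mem_ofPred_eq, Nat.cast_one, one_mul] at h
  obtain ⟨x, hx, hx1, hx2⟩ := exists_fine1 hM h.1 h.2.1
  obtain ⟨y, hy, hy1, hy2⟩ := exists_fine1 hM h.2.2.1 h.2.2.2
  exact ⟨(x, y), by simp [coarse, hx, hy], hx1, hx2, hy1, hy2⟩

lemma exists_Q (M : ℕ) (p : ℝ × ℝ) : ∃ x, p ∈ Q M x :=
  ⟨(⌊(M * p.1 : ℝ)⌋, ⌊(M * p.2 : ℝ)⌋), Int.floor_le _, (Int.lt_floor_add_one _).le,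
    Int.floor_le _, (Int.lt_floor_add_one _).le⟩

lemma Sadj.symm {a b : ℤ × ℤ} (h : Sadj a b) : Sadj b a := by
  simp only [Sadj] at *; omega

lemma Sadj.irrefl (a : ℤ × ℤ) : ¬ Sadj a a := by
  simp only [Sadj]; omega

lemma start_cell {M : ℕ} (hM : 0 < M) {sp : Set (ℤ × ℤ)}
    (hfar : ∀ a ∈ sp, ∀ b ∈ sp, ∀ p, p ∈ Q 1 a → p ∈ Q 1 b → a = b) {a f : ℤ × ℤ} (ha : a ∈ sp)
    {p : ℝ × ℝ} (hpa : p ∈ Q 1 a) (hf : coarse M f ∉ sp) (hpf : p ∈ Q M f) :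
    ∃ f' s, coarse M f' ∉ sp ∧ p ∈ Q M f' ∧ coarse M s = a ∧ Sadj s f' := by
  obtain ⟨g, hg, hpg⟩ := exists_fine hM hpa
  rcases Q_adj hpf hpg with h | h | ⟨h1, h2, -, -⟩
  · subst h; rw [hg] at hf; exact absurd ha hf
  · exact ⟨f, g, hf, hpf, hg, h.symm⟩
  · have hc := Q_corner hpf hpg
    by_cases hh : coarse M (f.1, g.2) ∈ sp
    · exact ⟨f, _, hf, hpf, hfar _ hh _ ha p (Q_coarse hM hc) hpa, h1.symm⟩
    · exact ⟨_, g, hh, hc, hg, h2.symm⟩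

lemma finite_cells (M : ℕ) {K : Set (ℝ × ℝ)} (hK : IsCompact K) :
    {x : ℤ × ℤ | ∃ p ∈ K, p ∈ Q M x}.Finite := by
  obtain ⟨R, hR⟩ := hK.isBounded.exists_norm_le
  obtain ⟨N, hN⟩ := exists_nat_ge (M * R)
  refine ((Set.finite_Icc (-(N : ℤ) - 1) N).prod (Set.finite_Icc (-(N : ℤ) - 1) N)).subset ?_
  rintro x ⟨p, hp, h1, h2, h3, h4⟩
  have hb := hR p hp
  have hb1 := (norm_fst_le p).trans hb
  have hb2 := (norm_snd_le p).trans hb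
  rw [Real.norm_eq_abs, abs_le] at hb1 hb2
  have hM : (0 : ℝ) ≤ M := Nat.cast_nonneg M
  have a1 : (M : ℝ) * p.1 ≤ N := by nlinarith
  have a2 : (M : ℝ) * p.2 ≤ N := by nlinarith
  have a3 : -(N : ℝ) ≤ (M : ℝ) * p.1 := by nlinarith
  have a4 : -(N : ℝ) ≤ (M : ℝ) * p.2 := by nlinarith
  have b1 : (x.1 : ℝ) ≤ N := by linarith
  have b2 : (x.2 : ℝ) ≤ N := by linarith
  have b3 : -(N : ℝ) ≤ x.1 + 1 := by linarith
  have b4 : -(N : ℝ) ≤ x.2 + 1 := by linarith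
  norm_cast at b1 b2
  have b3' : -(N : ℤ) ≤ x.1 + 1 := by exact_mod_cast b3
  have b4' : -(N : ℤ) ≤ x.2 + 1 := by exact_mod_cast b4
  simp only [Set.mem_prod, Set.mem_Icc]
  omega

/-- the graph of cells in a set -/
def cellG (F : Set (ℤ × ℤ)) : SimpleGraph (ℤ × ℤ) where
  Adj x y := x ∈ F ∧ y ∈ F ∧ Sadj x y
  symm := ⟨fun _ _ h => ⟨h.2.1, h.1, h.2.2.symm⟩⟩
  loopless := ⟨fun x h => Sadj.irrefl x h.2.2⟩

lemma cellG_support {F : Set (ℤ × ℤ)} {u v : ℤ × ℤ} (w : (cellG F).Walk u v) (hu : u ∈ F) :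
    ∀ x ∈ w.support, x ∈ F := by
  induction w with
  | nil => intro x hx; simp at hx; subst hx; exact hu
  | cons h p ih =>
    intro x hx
    rcases List.mem_cons.1 (by simpa using hx) with rfl | hx
    · exact hu
    · exact ih h.2.1 x hx

theorem cell_path {M : ℕ} (hM : 0 < M) {sp : Set (ℤ × ℤ)}
    (hfar : ∀ a ∈ sp, ∀ b ∈ sp, ∀ p, p ∈ Q 1 a → p ∈ Q 1 b → a = b) {a b : ℤ × ℤ} (ha : a ∈ sp)
    (hb : b ∈ sp) {β : ℝ → ℝ × ℝ} {τ τ' : ℝ} (hτ : τ < τ') (hβ : ContinuousOn β (Set.Icc τ τ'))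
    (h0 : β τ ∈ Q 1 a) (h1 : β τ' ∈ Q 1 b) (hmid : ∀ t ∈ Set.Ioo τ τ', ∀ s ∈ sp, β t ∉ Q 1 s) :
    ∃ (st en : ℤ × ℤ) (mid : List (ℤ × ℤ)), coarse M st = a ∧ coarse M en = b ∧
      List.IsChain Sadj (st :: (mid ++ [en])) ∧ mid.Nodup ∧ mid ≠ [] ∧
      ∀ x ∈ mid, coarse M x ∉ sp ∧ ∃ t ∈ Set.Icc τ τ', β t ∈ Q M x := by
  set F : Set (ℤ × ℤ) := {x | coarse M x ∉ sp ∧ ∃ t ∈ Set.Icc τ τ', β t ∈ Q M x} with hF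
  have hFfin : F.Finite := by
    refine (finite_cells M (isCompact_Icc.image_of_continuousOn hβ)).subset ?_
    rintro x ⟨-, t, ht, hx⟩
    exact ⟨β t, ⟨t, ht, rfl⟩, hx⟩
  set cov : Set (ℤ × ℤ) → Set ℝ := fun F' => ⋃ x ∈ F', Set.Icc τ τ' ∩ β ⁻¹' Q M x with hcov
  have hcl : ∀ F' ⊆ F, IsClosed (cov F') := by
    intro F' hF'
    refine (hFfin.subset hF').isClosed_biUnion fun x _ => ?_
    exact hβ.preimage_isClosed_of_isClosed isClosed_Icc (isClosed_Q M x)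
  have hcovF : Set.Icc τ τ' ⊆ cov F := by
    rw [← closure_Ioo hτ.ne]
    refine closure_minimal ?_ (hcl F le_rfl)
    intro t ht
    obtain ⟨x, hx⟩ := exists_Q M (β t)
    have ht' := Set.Ioo_subset_Icc_self ht
    simp only [hcov, Set.mem_iUnion]
    exact ⟨x, ⟨fun hs => hmid t ht _ hs (Q_coarse hM hx), t, ht', hx⟩, ht', hx⟩
  have hstart : ∀ t ∈ Set.Icc τ τ', ∀ a ∈ sp, β t ∈ Q 1 a → ∃ f ∈ F, ∃ s, β t ∈ Q M f ∧
      coarse M s = a ∧ Sadj s f := by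
    intro t ht a ha hta
    have := hcovF ht
    simp only [hcov, Set.mem_iUnion] at this
    obtain ⟨f, hf, -, hf2⟩ := this
    obtain ⟨f', s, h1, h2, h3, h4⟩ := start_cell hM hfar ha hta hf.1 hf2
    exact ⟨f', ⟨h1, t, ht, h2⟩, s, h2, h3, h4⟩
  obtain ⟨f0, hf0, st, hq0, hst, hadj0⟩ := hstart τ ⟨le_rfl, hτ.le⟩ a ha h0
  obtain ⟨f1, hf1, en, hq1, hen, hadj1⟩ := hstart τ' ⟨hτ.le, le_rfl⟩ b hb h1
  have hreach : (cellG F).Reachable f0 f1 := by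
    by_contra hno
    set F0 : Set (ℤ × ℤ) := {x | x ∈ F ∧ (cellG F).Reachable f0 x} with hF0
    have hpre := isPreconnected_closed_iff.1 (isPreconnected_Icc (a := τ) (b := τ'))
      (cov F0) (cov (F \ F0)) (hcl _ fun x hx => hx.1) (hcl _ fun x hx => hx.1) (by
        intro t ht
        have := hcovF ht
        simp only [hcov, Set.mem_iUnion, Set.mem_union] at this ⊢
        obtain ⟨f, hf, hf2⟩ := this
        by_cases h : f ∈ F0
        · exact Or.inl ⟨f, h, hf2⟩
        · exact Or.inr ⟨f, ⟨hf, h⟩, hf2⟩)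
      (by
        refine ⟨τ, ⟨le_rfl, hτ.le⟩, ?_⟩
        simp only [hcov, Set.mem_iUnion]
        exact ⟨f0, ⟨hf0, Reachable.refl _⟩, ⟨le_rfl, hτ.le⟩, hq0⟩)
      (by
        refine ⟨τ', ⟨hτ.le, le_rfl⟩, ?_⟩
        simp only [hcov, Set.mem_iUnion]
        exact ⟨f1, ⟨hf1, fun h => hno h.2⟩, ⟨hτ.le, le_rfl⟩, hq1⟩)
    obtain ⟨t, ht, hA, hA'⟩ := hpre
    simp only [hcov, Set.mem_iUnion] at hA hA'
    obtain ⟨f, hf, -, hf2⟩ := hA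
    obtain ⟨g, hg, -, hg2⟩ := hA'
    have hfg : ∀ x ∈ F, (cellG F).Reachable f0 x → ∀ y ∈ F, Sadj x y → (cellG F).Reachable f0 y :=
      fun x hx hr y hy hxy => hr.trans (Adj.reachable (show (cellG F).Adj x y from ⟨hx, hy, hxy⟩))
    rcases Q_adj hf2 hg2 with h | h | ⟨k1, k2, k3, k4⟩
    · subst h; exact hg.2 hf
    · exact hg.2 ⟨hg.1, hfg f hf.1 hf.2 g hg.1 h⟩
    · have c1 := Q_corner hf2 hg2
      have c2 := Q_corner hg2 hf2
      by_cases s1 : coarse M (f.1, g.2) ∈ sp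
      · by_cases s2 : coarse M (g.1, f.2) ∈ sp
        · have e := hfar _ s1 _ s2 _ (Q_coarse hM c1) (Q_coarse hM c2)
          have : coarse M f = coarse M (f.1, g.2) := by
            simp only [coarse, Prod.mk.injEq] at e ⊢
            exact ⟨trivial, e.2.symm⟩
          exact hf.1.1 (this ▸ s1)
        · have m : (g.1, f.2) ∈ F := ⟨s2, t, ht, c2⟩
          exact hg.2 ⟨hg.1, hfg _ m (hfg f hf.1 hf.2 _ m k3) g hg.1 k4⟩
      · have m : (f.1, g.2) ∈ F := ⟨s1, t, ht, c1⟩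
        exact hg.2 ⟨hg.1, hfg _ m (hfg f hf.1 hf.2 _ m k1) g hg.1 k2⟩
  obtain ⟨w, hw⟩ := hreach.exists_isPath
  refine ⟨st, en, w.support, hst, hen, ?_, hw.support_nodup, w.support_ne_nil, ?_⟩
  · have hc : List.IsChain Sadj w.support :=
      w.isChain_adj_support.imp (fun _ _ h => h.2.2)
    have h2 : List.IsChain Sadj (w.support ++ [en]) := by
      rw [List.isChain_append]
      refine ⟨hc, by simp, ?_⟩
      intro x hx y hy
      rw [List.getLast?_eq_getLast_of_ne_nil w.support_ne_nil] at hx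
      simp at hx hy
      subst hx hy
      exact hadj1.symm
    have e : w.support ++ [en] = f0 :: (w.support.tail ++ [en]) := by
      conv_lhs => rw [← w.cons_tail_support]
      rfl
    rw [e] at h2 ⊢
    rw [List.isChain_cons_cons]
    exact ⟨hadj0, h2⟩
  · intro x hx
    exact cellG_support w hf0 x hx

end CN

namespace CN

/-- open unit cell -/
def Qo (x : ℤ × ℤ) : Set (ℝ × ℝ) :=
  {p | (x.1 : ℝ) < p.1 ∧ p.1 < x.1 + 1 ∧ (x.2 : ℝ) < p.2 ∧ p.2 < (x.2 : ℝ) + 1}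

lemma isOpen_Qo (x : ℤ × ℤ) : IsOpen (Qo x) := by
  unfold Qo
  refine IsOpen.and ?_ (IsOpen.and ?_ (IsOpen.and ?_ ?_)) <;>
    refine isOpen_lt ?_ ?_ <;> fun_prop

lemma Qo_sub (x : ℤ × ℤ) : Qo x ⊆ Q 1 x := by
  rintro p ⟨h1, h2, h3, h4⟩
  simp only [Q, Set.mem_ofPred_eq, Nat.cast_one, one_mul]
  exact ⟨h1.le, h2.le, h3.le, h4.le⟩

lemma Q_dist {M : ℕ} (hM : 0 < M) {x : ℤ × ℤ} {p q : ℝ × ℝ} (hp : p ∈ Q M x) (hq : q ∈ Q M x) :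
    Dist.dist p q ≤ 1 / M := by
  obtain ⟨a1, a2, a3, a4⟩ := hp
  obtain ⟨b1, b2, b3, b4⟩ := hq
  have hM' : (0 : ℝ) < M := by exact_mod_cast hM
  rw [Prod.dist_eq, max_le_iff, Real.dist_eq, Real.dist_eq, abs_le, abs_le, neg_le_iff_add_nonneg',
    neg_le_iff_add_nonneg']
  refine ⟨⟨?_, ?_⟩, ?_, ?_⟩
  · have : 0 ≤ (1 + M * (p.1 - q.1)) / M := div_nonneg (by linarith) hM'.le
    rwa [add_div, mul_div_cancel_left₀ _ hM'.ne'] at this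
  · rw [le_div_iff₀ hM']; linarith
  · have : 0 ≤ (1 + M * (p.2 - q.2)) / M := div_nonneg (by linarith) hM'.le
    rwa [add_div, mul_div_cancel_left₀ _ hM'.ne'] at this
  · rw [le_div_iff₀ hM']; linarith

lemma exists_mesh {J : Type*} [Finite J] (K : J → Set (ℝ × ℝ)) (hK : ∀ j, IsCompact (K j))
    (hd : ∀ j j', j ≠ j' → Disjoint (K j) (K j')) :
    ∃ M : ℕ, 0 < M ∧ ∀ j j', j ≠ j' → ∀ x, ∀ p ∈ K j, ∀ q ∈ K j', p ∈ Q M x → q ∉ Q M x := by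
  have h : ∀ j j', ∀ᶠ M : ℕ in Filter.atTop,
      j ≠ j' → ∀ x, ∀ p ∈ K j, ∀ q ∈ K j', p ∈ Q M x → q ∉ Q M x := by
    intro j j'
    by_cases hjj : j = j'
    · exact Filter.Eventually.of_forall fun _ h => absurd hjj h
    obtain ⟨r, hr, hr2⟩ := Metric.exists_pos_forall_lt_edist (hK j) (hK j').isClosed (hd j j' hjj)
    obtain ⟨N, hN⟩ := exists_nat_gt (1 / (r : ℝ))
    filter_upwards [Filter.eventually_ge_atTop N, Filter.eventually_gt_atTop 0] with M hM hM0 _ x p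
      hp q hq hpx hqx
    have h1 := hr2 p hp q hq
    rw [edist_nndist, ENNReal.coe_lt_coe] at h1
    have h2 : (r : ℝ) < Dist.dist p q := by exact_mod_cast h1
    have h3 := Q_dist hM0 hpx hqx
    have hr' : (0 : ℝ) < r := by exact_mod_cast hr
    have hM0' : (0 : ℝ) < M := by exact_mod_cast hM0
    have h4 : (N : ℝ) ≤ M := by exact_mod_cast hM
    rw [div_lt_iff₀ hr'] at hN
    rw [le_div_iff₀ hM0'] at h3
    nlinarith
  have h2 := Filter.eventually_all.2 fun j => Filter.eventually_all.2 (h j)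
  obtain ⟨M, h3, h4⟩ := (h2.and (Filter.eventually_gt_atTop 0)).exists
  exact ⟨M, h4, h3⟩

theorem plane_unit {J S : Type*} [Fintype J] [Fintype S] (pos : S → ℝ × ℝ) (c : S → ℤ × ℤ)
    (h_intr : ∀ s, pos s ∈ Qo (c s))
    (hsep : ∀ s s' p, p ∈ Q 1 (c s) → p ∈ Q 1 (c s') → s = s')
    (src tgt : J → S) (hst : ∀ j, src j ≠ tgt j) (β : J → ℝ → ℝ × ℝ) (lo hi : J → ℝ)
    (hlh : ∀ j, lo j < hi j) (hβ : ∀ j, ContinuousOn (β j) (Set.Icc (lo j) (hi j)))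
    (hlo : ∀ j, β j (lo j) = pos (src j)) (hhi : ∀ j, β j (hi j) = pos (tgt j))
    (hbox : ∀ j, ∀ t ∈ Set.Icc (lo j) (hi j), ∀ s, β j t ∈ Q 1 (c s) → s = src j ∨ s = tgt j)
    (hdis : ∀ j j', j ≠ j' → ∀ t ∈ Set.Icc (lo j) (hi j), ∀ t' ∈ Set.Icc (lo j') (hi j'),
      β j t = β j' t' → ∃ s, β j t = pos s)
    (dart : J → V × V)
    (Φ : S → Multiset (V × List V) → Multiset (Sym2 (Sym2 V)) → Prop)
    (hΦ : ∀ s w, w.Perm (incid src tgt dart s) → ∃ B C, Φ s B C ∧ Der B C w []) :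
    ∃ (B : S → Multiset (V × List V)) (C : S → Multiset (Sym2 (Sym2 V))),
      (∀ s, Φ s (B s) (C s)) ∧ Der (∑ s, B s) (∑ s, C s) [] [] := by
  have hc : Function.Injective c := by
    intro s s' h
    exact hsep s s' (pos s) (Qo_sub _ (h_intr s)) (h ▸ Qo_sub _ (h_intr s))
  -- middle times
  have hτ : ∀ j, ∃ τ τ', lo j ≤ τ ∧ τ < τ' ∧ τ' ≤ hi j ∧ β j τ ∈ Q 1 (c (src j)) ∧
      β j τ' ∈ Q 1 (c (tgt j)) ∧ ∀ t ∈ Set.Ioo τ τ', ∀ s, β j t ∉ Q 1 (c s) := by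
    intro j
    have hcl1 : IsCompact (Set.Icc (lo j) (hi j) ∩ β j ⁻¹' Q 1 (c (src j))) :=
      isCompact_Icc.of_isClosed_subset
        ((hβ j).preimage_isClosed_of_isClosed isClosed_Icc (isClosed_Q 1 _)) Set.inter_subset_left
    obtain ⟨τ, ⟨⟨hτ1, hτ2⟩, hτ3⟩, hτ4⟩ := hcl1.exists_isGreatest
      ⟨lo j, ⟨le_rfl, (hlh j).le⟩, by
        rw [Set.mem_preimage, hlo]; exact Qo_sub _ (h_intr _)⟩
    have hcl2 : IsCompact (Set.Icc τ (hi j) ∩ β j ⁻¹' Q 1 (c (tgt j))) :=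
      isCompact_Icc.of_isClosed_subset
        (((hβ j).mono (Set.Icc_subset_Icc_left hτ1)).preimage_isClosed_of_isClosed isClosed_Icc
          (isClosed_Q 1 _)) Set.inter_subset_left
    obtain ⟨τ', ⟨⟨hτ1', hτ2'⟩, hτ3'⟩, hτ4'⟩ := hcl2.exists_isLeast
      ⟨hi j, ⟨hτ2, le_rfl⟩, by
        rw [Set.mem_preimage, hhi]; exact Qo_sub _ (h_intr _)⟩
    refine ⟨τ, τ', hτ1, lt_of_le_of_ne hτ1' ?_, hτ2', hτ3, hτ3', ?_⟩
    · rintro rfl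
      exact hst j (hsep _ _ _ hτ3 hτ3')
    · rintro t ⟨ht1, ht2⟩ s hs
      have hti : t ∈ Set.Icc (lo j) (hi j) := ⟨by linarith, by linarith⟩
      rcases hbox j t hti s hs with rfl | rfl
      · exact absurd (hτ4 ⟨hti, hs⟩) (not_le.2 ht1)
      · exact absurd (hτ4' ⟨⟨ht1.le, hti.2⟩, hs⟩) (not_le.2 ht2)
  choose τ τ' h1 h2 h3 h4 h5 h6 using hτ
  have hsub : ∀ j, Set.Icc (τ j) (τ' j) ⊆ Set.Icc (lo j) (hi j) := fun j =>
    Set.Icc_subset_Icc (h1 j) (h3 j)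
  have hcont : ∀ j, ContinuousOn (β j) (Set.Icc (τ j) (τ' j)) := fun j => (hβ j).mono (hsub j)
  have hend : ∀ j, ∀ t ∈ Set.Icc (τ j) (τ' j), ∀ s, β j t = pos s → False := by
    intro j t ht s hs
    have hev : ∀ᶠ u in nhdsWithin t (Set.Ioo (τ j) (τ' j)), β j u ∈ Qo (c s) :=
      ((hcont j t ht).mono Set.Ioo_subset_Icc_self).eventually
        ((isOpen_Qo (c s)).mem_nhds (hs ▸ h_intr s))
    have hne : (nhdsWithin t (Set.Ioo (τ j) (τ' j))).NeBot := by
      rw [← mem_closure_iff_nhdsWithin_neBot, closure_Ioo (h2 j).ne]; exact ht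
    obtain ⟨u, hu1, hu2⟩ := (hev.and self_mem_nhdsWithin).exists
    exact h6 j u hu2 s (Qo_sub _ hu1)
  obtain ⟨M, hM, hMd⟩ := exists_mesh (fun j => β j '' Set.Icc (τ j) (τ' j))
    (fun j => isCompact_Icc.image_of_continuousOn (hcont j)) (by
      intro j j' hjj
      rw [Set.disjoint_left]
      rintro _ ⟨t, ht, rfl⟩ ⟨t', ht', he⟩
      obtain ⟨s, hs⟩ := hdis j j' hjj t (hsub j ht) t' (hsub j' ht') he.symm
      exact hend j t ht s hs)
  have hpath := fun j => cell_path hM (sp := Set.range c) (by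
      rintro _ ⟨s, rfl⟩ _ ⟨s', rfl⟩ p hp hp'
      rw [hsep s s' p hp hp']) ⟨src j, rfl⟩ ⟨tgt j, rfl⟩ (h2 j) (hcont j) (h4 j) (h5 j) (by
      rintro t ht _ ⟨s, rfl⟩; exact h6 j t ht s)
  choose st en mid p1 p2 p3 p4 p5 p6 using hpath
  refine tiles_main M hM c hc src tgt dart st en mid p1 p2 p3 p4 p5 ?_ ?_ Φ hΦ
  · intro j x hx s hs
    exact (p6 j x hx).1 ⟨s, hs.symm⟩
  · intro j j' hjj x hx hx'
    obtain ⟨t, ht, htx⟩ := (p6 j x hx).2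
    obtain ⟨t', ht', htx'⟩ := (p6 j' x hx').2
    exact hMd j j' hjj x _ ⟨t, ht, rfl⟩ _ ⟨t', ht', rfl⟩ htx htx'

/-- the planarised version: general position -/
theorem plane_gen {J S : Type*} [Fintype J] [Fintype S] (pos : S → ℝ × ℝ)
    (hpos : Function.Injective pos)
    (src tgt : J → S) (hst : ∀ j, src j ≠ tgt j) (β : J → ℝ → ℝ × ℝ) (lo hi : J → ℝ)
    (hlh : ∀ j, lo j < hi j) (hβ : ∀ j, ContinuousOn (β j) (Set.Icc (lo j) (hi j)))
    (hlo : ∀ j, β j (lo j) = pos (src j)) (hhi : ∀ j, β j (hi j) = pos (tgt j))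
    (hbox : ∀ j, ∀ t ∈ Set.Icc (lo j) (hi j), ∀ s, β j t = pos s → s = src j ∨ s = tgt j)
    (hdis : ∀ j j', j ≠ j' → ∀ t ∈ Set.Icc (lo j) (hi j), ∀ t' ∈ Set.Icc (lo j') (hi j'),
      β j t = β j' t' → ∃ s, β j t = pos s)
    (dart : J → V × V)
    (Φ : S → Multiset (V × List V) → Multiset (Sym2 (Sym2 V)) → Prop)
    (hΦ : ∀ s w, w.Perm (incid src tgt dart s) → ∃ B C, Φ s B C ∧ Der B C w []) :
    ∃ (B : S → Multiset (V × List V)) (C : S → Multiset (Sym2 (Sym2 V))),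
      (∀ s, Φ s (B s) (C s)) ∧ Der (∑ s, B s) (∑ s, C s) [] [] := by
  classical
  -- a radius
  obtain ⟨δ, hδ, hδ1, hδ2⟩ : ∃ δ : ℝ, 0 < δ ∧ (∀ s s', s ≠ s' → 2 * δ < Dist.dist (pos s) (pos s')) ∧
      ∀ j s, s ≠ src j → s ≠ tgt j → ∀ t ∈ Set.Icc (lo j) (hi j), δ < Dist.dist (β j t) (pos s) := by
    have e1 : ∀ s s', ∀ᶠ δ in nhdsWithin (0 : ℝ) (Set.Ioi 0),
        s ≠ s' → 2 * δ < Dist.dist (pos s) (pos s') := by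
      intro s s'
      by_cases h : s = s'
      · exact Filter.Eventually.of_forall fun _ h' => absurd h h'
      have hd : 0 < Dist.dist (pos s) (pos s') := dist_pos.2 (hpos.ne h)
      filter_upwards [Ioo_mem_nhdsGT (half_pos hd)] with δ hδ _
      linarith [hδ.2]
    have e2 : ∀ j s, ∀ᶠ δ in nhdsWithin (0 : ℝ) (Set.Ioi 0),
        s ≠ src j → s ≠ tgt j → ∀ t ∈ Set.Icc (lo j) (hi j), δ < Dist.dist (β j t) (pos s) := by
      intro j s
      by_cases h : s ≠ src j ∧ s ≠ tgt j
      · obtain ⟨t0, ht0, hmin⟩ := isCompact_Icc.exists_isMinOn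
          (Set.nonempty_Icc.2 (hlh j).le) (f := fun t => Dist.dist (β j t) (pos s))
          (continuous_dist.comp_continuousOn ((hβ j).prodMk continuousOn_const))
        have hd : 0 < Dist.dist (β j t0) (pos s) := by
          rw [dist_pos]; intro e
          rcases hbox j t0 ht0 s e with e | e
          · exact h.1 e
          · exact h.2 e
        filter_upwards [Ioo_mem_nhdsGT hd] with δ hδ _ _ t ht
        exact lt_of_lt_of_le hδ.2 (hmin ht)
      · exact Filter.Eventually.of_forall fun _ h1 h2 => absurd ⟨h1, h2⟩ h
    have e3 := (Filter.eventually_all.2 fun s => Filter.eventually_all.2 (e1 s)).and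
      (Filter.eventually_all.2 fun j => Filter.eventually_all.2 (e2 j))
    obtain ⟨δ, ⟨h1, h2⟩, h3⟩ := (e3.and self_mem_nhdsWithin).exists
    exact ⟨δ, h3, h1, h2⟩
  -- offsets
  have hoff : ∀ f : S → ℝ, ∃ θ : ℝ, ∀ s, ∀ k : ℤ, (f s - θ) / δ ≠ k := by
    intro f
    have hcount : (⋃ s, ⋃ k : ℤ, {f s - k * δ}).Countable :=
      Set.countable_iUnion fun s => Set.countable_iUnion fun k => Set.countable_singleton _
    obtain ⟨θ, hθ⟩ : (⋃ s, ⋃ k : ℤ, {f s - k * δ})ᶜ.Nonempty :=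
      (hcount.dense_compl ℝ).nonempty
    refine ⟨θ, fun s k h => hθ ?_⟩
    simp only [Set.mem_iUnion, Set.mem_singleton_iff]
    refine ⟨s, k, ?_⟩
    rw [div_eq_iff hδ.ne'] at h
    linarith
  obtain ⟨θ1, hθ1⟩ := hoff fun s => (pos s).1
  obtain ⟨θ2, hθ2⟩ := hoff fun s => (pos s).2
  set T : ℝ × ℝ → ℝ × ℝ := fun p => ((p.1 - θ1) / δ, (p.2 - θ2) / δ) with hT
  have hTinj : Function.Injective T := by
    intro p q h
    simp only [hT, Prod.mk.injEq, div_left_inj' hδ.ne', sub_left_inj] at h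
    exact Prod.ext h.1 h.2
  have hTc : Continuous T := by
    simp only [hT]; fun_prop
  have hTd : ∀ p q, Dist.dist p q = δ * Dist.dist (T p) (T q) := by
    intro p q
    simp only [hT, Prod.dist_eq, Real.dist_eq, ← sub_div, sub_sub_sub_cancel_right, abs_div,
      abs_of_pos hδ, mul_max_of_nonneg _ _ hδ.le]
    rw [mul_div_cancel₀ _ hδ.ne', mul_div_cancel₀ _ hδ.ne']
  set c : S → ℤ × ℤ := fun s => (⌊(T (pos s)).1⌋, ⌊(T (pos s)).2⌋) with hc
  have h_intr : ∀ s, T (pos s) ∈ Qo (c s) := by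
    intro s
    refine ⟨lt_of_le_of_ne (Int.floor_le _) (hθ1 s _).symm, Int.lt_floor_add_one _,
      lt_of_le_of_ne (Int.floor_le _) (hθ2 s _).symm, Int.lt_floor_add_one _⟩
  have hdd : ∀ s p, T p ∈ Q 1 (c s) → Dist.dist p (pos s) ≤ δ := by
    intro s p hp
    have := Q_dist one_pos hp (Qo_sub _ (h_intr s))
    rw [hTd]
    simp only [Nat.cast_one, div_one] at this
    nlinarith
  have hTs : ∀ p, ∃ q, T q = p := fun p => ⟨(p.1 * δ + θ1, p.2 * δ + θ2), by
    simp only [hT, add_sub_cancel_right]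
    rw [mul_div_cancel_right₀ _ hδ.ne', mul_div_cancel_right₀ _ hδ.ne']⟩
  refine plane_unit (fun s => T (pos s)) c h_intr ?_ src tgt hst (fun j t => T (β j t)) lo hi hlh
    (fun j => hTc.comp_continuousOn (hβ j)) (fun j => by simp only [hlo])
    (fun j => by simp only [hhi]) ?_ ?_ dart Φ hΦ
  · intro s s' p hp hp'
    by_contra hne
    obtain ⟨q, rfl⟩ := hTs p
    have h1 := hdd s q hp
    have h2 := hdd s' q hp'
    have h3 := hδ1 s s' hne
    have h4 := dist_triangle_left (pos s) (pos s') q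
    linarith
  · intro j t ht s hs
    by_contra hne
    push Not at hne
    have h1 := hδ2 j s hne.1 hne.2 t ht
    have h2 := hdd s _ hs
    linarith
  · intro j j' hjj t ht t' ht' he
    obtain ⟨s, hs⟩ := hdis j j' hjj t ht t' ht' (hTinj he)
    exact ⟨s, by simp only [hs]⟩

end CN

namespace CN

lemma der_vertex (v : V) (L : List V) :
    Der {(v, L.reverse)} 0 (L.map fun u => (u, v)) [] := by
  have h := Der.single (Step.birth (L.map fun u => (u, v)) [] v L.reverse)
  refine (h.cast rfl rfl (by simp) rfl).trans0 ?_
  refine (caps (L.map fun u => (u, v))).cast rfl rfl ?_ rfl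
  simp [rb, Function.comp_def]

lemma der_c1 (d d' : V × V) : Der 0 0 [d, d.swap, d', d'.swap] [] := by
  have h := (caps [d]).ctx [] [d', d'.swap]
  simpa [rb] using (h.cast rfl rfl rfl rfl).trans0 (by simpa [rb] using caps [d'])

lemma der_c2 (d d' : V × V) : Der 0 0 [d, d', d'.swap, d.swap] [] := by
  have h := (caps [d']).ctx [d] [d.swap]
  simpa [rb] using (h.cast rfl rfl rfl rfl).trans0 (by simpa [rb] using caps [d])

lemma der_c3 (d d' : V × V) : Der 0 {s(edg d, edg d')} [d, d', d.swap, d'.swap] [] := by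
  have h := Der.single (Step.swap [d] [d'.swap] d' d.swap)
  have h2 := h.trans0 (by simpa using der_c1 d d')
  rw [edg_swap, Sym2.eq_swap] at h2
  simpa using h2

lemma der_c3' (d d' : V × V) : Der 0 {s(edg d, edg d')} [d', d, d'.swap, d.swap] [] := by
  rw [Sym2.eq_swap]; exact der_c3 d' d

lemma der_cross {d d' : V × V} {w : List (V × V)} (h : w.Perm [d, d.swap, d', d'.swap]) :
    ∃ C ≤ ({s(edg d, edg d')} : Multiset _), Der 0 C w [] := by
  have key : Der 0 0 w [] ∨ Der 0 {s(edg d, edg d')} w [] := by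
    have hs := fun x y : V × V => der_c3 x y
    have h' := List.mem_permutations.2 h
    have e1 : edg d.swap = edg d := edg_swap d
    have e2 : edg d'.swap = edg d' := edg_swap d'
    have a1 := der_c1 d d'
    have a2 := der_c1 d d'.swap
    have a3 := der_c1 d.swap d'
    have a4 := der_c1 d.swap d'.swap
    have a5 := der_c1 d' d
    have a6 := der_c1 d' d.swap
    have a7 := der_c1 d'.swap d
    have a8 := der_c1 d'.swap d.swap
    have b1 := der_c2 d d'
    have b2 := der_c2 d d'.swap
    have b3 := der_c2 d.swap d'
    have b4 := der_c2 d.swap d'.swap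
    have b5 := der_c2 d' d
    have b6 := der_c2 d' d.swap
    have b7 := der_c2 d'.swap d
    have b8 := der_c2 d'.swap d.swap
    have c1 := der_c3 d d'
    have c2 := der_c3 d d'.swap
    have c3 := der_c3 d.swap d'
    have c4 := der_c3 d.swap d'.swap
    have c5 := der_c3' d d'
    have c6 := der_c3' d d'.swap
    have c7 := der_c3' d.swap d'
    have c8 := der_c3' d.swap d'.swap
    simp only [Prod.swap_swap, e1, e2] at a1 a2 a3 a4 a5 a6 a7 a8 b1 b2 b3 b4 b5 b6 b7 b8 c1 c2 c3 c4 c5 c6 c7 c8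
    simp [List.permutations, List.permutationsAux, List.permutationsAux.rec, List.permutationsAux2] at h'
    rcases h' with h | h | h | h | h | h | h | h | h | h | h | h | h | h | h | h | h | h | h | h | h | h | h | h <;> rw [h] <;>
      first | exact Or.inl ‹_› | exact Or.inr ‹_›
  rcases key with h | h
  · exact ⟨0, Multiset.zero_le _, h⟩
  · exact ⟨_, le_rfl, h⟩

end CN

namespace CN

theorem plane_arcs {E S : Type*} [Fintype E] [Fintype S] (pos : S → ℝ × ℝ)
    (hpos : Function.Injective pos) (γ : E → ℝ → ℝ × ℝ)
    (hγ : ∀ e, ContinuousOn (γ e) (Set.Icc 0 1)) (hinj : ∀ e, Set.InjOn (γ e) (Set.Icc 0 1))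
    (h0 : ∀ e, ∃ s, γ e 0 = pos s) (h1 : ∀ e, ∃ s, γ e 1 = pos s)
    (hdis : ∀ e e', e ≠ e' → ∀ t ∈ Set.Icc (0 : ℝ) 1, ∀ t' ∈ Set.Icc (0 : ℝ) 1,
      γ e t = γ e' t' → ∃ s, γ e t = pos s)
    (dart : E → V × V) (hd : ∀ e e', edg (dart e) = edg (dart e') → e = e')
    (hd' : ∀ e, (dart e).1 ≠ (dart e).2)
    (Φ : S → Multiset (V × List V) → Multiset (Sym2 (Sym2 V)) → Prop)
    (hΦ : ∀ s w, w.Nodup → (∀ x, x ∈ w ↔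
        (∃ e, ∃ t ∈ Set.Icc (0 : ℝ) 1, t ≠ 1 ∧ γ e t = pos s ∧ x = (dart e).swap) ∨
        (∃ e, ∃ t ∈ Set.Icc (0 : ℝ) 1, t ≠ 0 ∧ γ e t = pos s ∧ x = dart e)) →
        ∃ B C, Φ s B C ∧ Der B C w []) :
    ∃ (B : S → Multiset (V × List V)) (C : S → Multiset (Sym2 (Sym2 V))),
      (∀ s, Φ s (B s) (C s)) ∧ Der (∑ s, B s) (∑ s, C s) [] [] := by
  classical
  let T : E → Set ℝ := fun e => {t | t ∈ Set.Icc (0 : ℝ) 1 ∧ ∃ s, γ e t = pos s}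
  have hT : ∀ e, (T e).Finite := fun e => Set.Finite.of_injOn (f := γ e) (t := Set.range pos)
    (fun t ht => by obtain ⟨s, hs⟩ := ht.2; exact ⟨s, hs.symm⟩)
    (fun t ht t' ht' h => hinj e ht.1 ht'.1 h) (Set.finite_range _)
  have hnext : ∀ e, ∀ t ∈ T e, t ≠ 1 → ∃ t' ∈ T e, t < t' ∧ ∀ u ∈ T e, t < u → t' ≤ u := by
    intro e t ht h
    obtain ⟨u, hu, hu'⟩ := Set.exists_min_image {u | u ∈ T e ∧ t < u} id
      ((hT e).subset fun u hu => hu.1)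
      ⟨1, ⟨⟨by norm_num, by norm_num⟩, h1 e⟩, lt_of_le_of_ne ht.1.2 h⟩
    exact ⟨u, hu.1, hu.2, fun v hv hv' => hu' v ⟨hv, hv'⟩⟩
  have hprev : ∀ e, ∀ t ∈ T e, t ≠ 0 → ∃ t' ∈ T e, t' < t ∧ ∀ u ∈ T e, u < t → u ≤ t' := by
    intro e t ht h
    obtain ⟨u, hu, hu'⟩ := Set.exists_max_image {u | u ∈ T e ∧ u < t} id
      ((hT e).subset fun u hu => hu.1)
      ⟨0, ⟨⟨by norm_num, by norm_num⟩, h0 e⟩, lt_of_le_of_ne ht.1.1 h.symm⟩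
    exact ⟨u, hu.1, hu.2, fun v hv hv' => hu' v ⟨hv, hv'⟩⟩
  let J := Σ e, {t // t ∈ T e ∧ t ≠ 1}
  haveI : ∀ e, Finite {t // t ∈ T e ∧ t ≠ 1} := fun e =>
    Set.Finite.to_subtype ((hT e).subset fun t ht => ht.1)
  letI : Fintype J := Fintype.ofFinite J
  have hnx : ∀ j : J, ∃ t' ∈ T j.1, j.2.1 < t' ∧ ∀ u ∈ T j.1, j.2.1 < u → t' ≤ u :=
    fun j => hnext j.1 j.2.1 j.2.2.1 j.2.2.2
  choose hi hiT hilt himin using hnx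
  let lo : J → ℝ := fun j => j.2.1
  have loT : ∀ j : J, lo j ∈ T j.1 := fun j => j.2.2.1
  choose src hsrc using fun j : J => (loT j).2
  choose tgt htgt using fun j : J => (hiT j).2
  have hsub : ∀ j : J, Set.Icc (lo j) (hi j) ⊆ Set.Icc 0 1 := fun j =>
    Set.Icc_subset_Icc (loT j).1.1 (hiT j).1.2
  have hbt : ∀ j : J, ∀ t ∈ Set.Icc (lo j) (hi j), t ∈ T j.1 → t = lo j ∨ t = hi j := by
    intro j t ht hT
    rcases eq_or_lt_of_le ht.1 with h | h
    · exact Or.inl h.symm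
    · exact Or.inr (le_antisymm ht.2 (himin j t hT h))
  have hlh : ∀ j, lo j < hi j := hilt
  have hjeq : ∀ j j' : J, j.1 = j'.1 → lo j = lo j' → j = j' := by
    rintro ⟨e, t, ht⟩ ⟨e', t', ht'⟩ h h'
    dsimp only at h
    subst h
    have : t = t' := h'
    subst this
    rfl
  have hjeq' : ∀ j j' : J, j.1 = j'.1 → hi j = hi j' → j = j' := by
    intro j j' h h'
    apply hjeq j j' h
    apply le_antisymm
    · by_contra hc
      push Not at hc
      have := himin j' (lo j) (h ▸ loT j) hc
      linarith [hlh j]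
    · by_contra hc
      push Not at hc
      have := himin j (lo j') (h.symm ▸ loT j') hc
      linarith [hlh j']
  refine plane_gen pos hpos src tgt ?_ (fun j => γ j.1) lo hi hlh
    (fun j => (hγ j.1).mono (hsub j)) hsrc htgt ?_ ?_ (fun j => dart j.1) Φ ?_
  · intro j h
    have := hinj j.1 (loT j).1 (hiT j).1 (by rw [htgt j, ← h]; exact hsrc j)
    exact (hlh j).ne this
  · intro j t ht s hs
    rcases hbt j t ht ⟨hsub j ht, s, hs⟩ with h | h
    · left; apply hpos; rw [← hs, h]; exact hsrc j
    · right; apply hpos; rw [← hs, h]; exact htgt j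
  · intro j j' hne t ht t' ht' heq
    by_cases he : j.1 = j'.1
    · rw [← he] at heq
      have htt := hinj j.1 (hsub j ht) (hsub j' ht') heq
      subst htt
      rcases lt_trichotomy (lo j) (lo j') with h | h | h
      · have := himin j (lo j') (he.symm ▸ loT j') h
        have e : t = hi j := le_antisymm ht.2 (this.trans ht'.1)
        rw [e]; exact (hiT j).2
      · exact absurd (hjeq j j' he h) hne
      · have := himin j' (lo j) (he ▸ loT j) h
        have e : t = lo j := le_antisymm (ht'.2.trans this) ht.1
        rw [e]; exact (loT j).2
    · exact hdis _ _ he t (hsub j ht) t' (hsub j' ht') heq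
  · intro s w hw
    have hsw : ∀ e e', (dart e).swap ≠ dart e' := by
      intro e e' h
      have : e = e' := hd _ _ (by rw [← h, edg_swap])
      subst this
      exact hd' e (congrArg Prod.snd h)
    apply hΦ s w
    · rw [hw.nodup_iff, incid, List.nodup_flatMap]
      refine ⟨?_, ?_⟩
      · intro j _
        split_ifs with a b <;> simp [hsw]
      · refine (Finset.nodup_toList _).imp_of_mem ?_
        intro j j' _ _ hne
        rw [Function.onFun, List.disjoint_left]
        intro x hx hx'
        simp only [List.mem_append] at hx hx'
        rcases hx with hx | hx <;> rcases hx' with hx' | hx' <;> split_ifs at hx hx' with a b <;>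
          simp only [List.mem_singleton, List.not_mem_nil] at hx hx'
        · have he := hd j.1 j'.1 (by rw [← edg_swap, ← hx, hx', edg_swap])
          apply hne
          apply hjeq _ _ he
          apply hinj j.1 (loT j).1 (loT j').1
          rw [hsrc j, a, ← b, ← hsrc j', he]
        · exact hsw _ _ (hx.symm.trans hx')
        · exact hsw _ _ (hx'.symm.trans hx)
        · have he := hd j.1 j'.1 (by rw [← hx, hx'])
          apply hne
          apply hjeq' _ _ he
          apply hinj j.1 (hiT j).1 (hiT j').1
          rw [htgt j, a, ← b, ← htgt j', he]
    · intro x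
      rw [hw.mem_iff, incid, List.mem_flatMap]
      constructor
      · rintro ⟨j, -, hx⟩
        rcases List.mem_append.1 hx with hx | hx <;> split_ifs at hx with a <;>
          simp only [List.mem_singleton, List.not_mem_nil] at hx
        · exact Or.inl ⟨j.1, lo j, (loT j).1, j.2.2.2, by rw [hsrc j, a], hx⟩
        · exact Or.inr ⟨j.1, hi j, (hiT j).1, ((loT j).1.1.trans_lt (hlh j)).ne', by rw [htgt j, a], hx⟩
      · rintro (⟨e, t, ht, h1, hs, hx⟩ | ⟨e, t, ht, h0, hs, hx⟩)
        · let j : J := ⟨e, t, ⟨ht, s, hs⟩, h1⟩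
          refine ⟨j, by simp, List.mem_append_left _ ?_⟩
          rw [if_pos]
          · simpa using hx
          · apply hpos; rw [← hs]; exact (hsrc j).symm
        · obtain ⟨u, hu, hut, humax⟩ := hprev e t ⟨ht, s, hs⟩ h0
          let j : J := ⟨e, u, hu, (hut.trans_le ht.2).ne⟩
          have hj : hi j = t := by
            apply le_antisymm (himin j t ⟨ht, s, hs⟩ hut)
            by_contra hc
            push Not at hc
            exact absurd (humax _ (hiT j) hc) (not_le.2 (hlh j))
          refine ⟨j, by simp, List.mem_append_right _ ?_⟩
          rw [if_pos]
          · simpa using hx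
          · apply hpos; rw [← hs, ← hj]; exact (htgt j).symm

end CN

namespace CN

/-- combinatorial drawings -/
structure Valid [Fintype V] (G : SimpleGraph V) (N : V → List V)
    (C : Multiset (Sym2 (Sym2 V))) : Prop where
  der : Der (∑ v, {(v, N v)}) C [] []
  nodup : ∀ v, (N v).Nodup
  mem : ∀ v w, w ∈ N v ↔ G.Adj v w
  cnodup : C.Nodup
  cind : ∀ z ∈ C, ∃ e f, z = s(e, f) ∧ e ∈ G.edgeSet ∧ f ∈ G.edgeSet ∧ ∀ a ∈ e, a ∉ f

section
variable {G : SimpleGraph V} (D : Drawing G)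

lemma mem_edgePoints_iff {a b : V} (h : G.Adj a b) (p : ℝ × ℝ) :
    p ∈ D.edgePoints s(a, b) ↔ ∃ t ∈ Set.Icc (0 : ℝ) 1, D.arc a b t = p := by
  constructor
  · rintro ⟨a', b', he, h', t, ht, rfl⟩
    rcases Sym2.eq_iff.1 he with ⟨rfl, rfl⟩ | ⟨rfl, rfl⟩
    · exact ⟨t, ht, rfl⟩
    · exact ⟨1 - t, ⟨by linarith [ht.2], by linarith [ht.1]⟩, (D.arc_symm h t).symm⟩
  · rintro ⟨t, ht, rfl⟩
    exact ⟨a, b, rfl, h, t, ht, rfl⟩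

lemma cross_symm {e f : Sym2 V} {p : ℝ × ℝ} (h : D.IsCrossing e f p) : D.IsCrossing f e p :=
  ⟨h.2.1, h.1, h.2.2.1.symm, h.2.2.2.2.1, h.2.2.2.1, h.2.2.2.2.2.2, h.2.2.2.2.2.1⟩

lemma crossings_finite [Fintype V] (hD : D.IsGood) (A B : Set (Sym2 V)) :
    (D.crossings A B).Finite := by
  classical
  refine Set.Finite.of_injOn (f := Prod.snd) (t := Set.univ) (fun _ _ => trivial) ?_ Set.finite_univ
  rintro ⟨p, z⟩ ⟨e, f, hz, -, -, h⟩ ⟨p', z'⟩ ⟨e', f', hz', -, -, h'⟩ hzz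
  dsimp only at hz hz' hzz h h'
  subst hzz
  have : D.IsCrossing e f p' := by
    rw [hz] at hz'
    rcases Sym2.eq_iff.1 hz' with ⟨rfl, rfl⟩ | ⟨rfl, rfl⟩
    · exact h'
    · exact cross_symm D h'
  rw [hD.cross_once e f h this]

theorem claimA [Fintype V] (hD : D.IsGood) : ∃ N C, Valid G N C ∧ C.card ≤ D.crNum := by
  classical
  let E := {e : Sym2 V // e ∈ G.edgeSet}
  have hout : ∀ e : E, ∃ d : V × V, edg d = e.1 := by
    rintro ⟨e, he⟩
    induction e using Sym2.ind with | _ a b => exact ⟨(a, b), rfl⟩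
  choose dart hdart using hout
  have hadj : ∀ e : E, G.Adj (dart e).1 (dart e).2 := fun e => by
    have := e.2; rw [← hdart e] at this; exact this
  let γ : E → ℝ → ℝ × ℝ := fun e => D.arc (dart e).1 (dart e).2
  have hep : ∀ (e : E) p, p ∈ D.edgePoints e.1 ↔ ∃ t ∈ Set.Icc (0 : ℝ) 1, γ e t = p := by
    intro e p
    rw [← hdart e]; exact mem_edgePoints_iff D (hadj e) p
  have hmem : ∀ (e : E) v, v ∈ e.1 ↔ v = (dart e).1 ∨ v = (dart e).2 := by
    intro e v; rw [← hdart e]; exact Sym2.mem_iff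
  have hγ0 : ∀ e, γ e 0 = D.pos (dart e).1 := fun e => D.arc_zero (hadj e)
  have hγ1 : ∀ e, γ e 1 = D.pos (dart e).2 := fun e => D.arc_one (hadj e)
  have hinj : ∀ e, Set.InjOn (γ e) (Set.Icc 0 1) := fun e => hD.arc_inj (hadj e)
  have i0 : (0 : ℝ) ∈ Set.Icc (0 : ℝ) 1 := ⟨le_rfl, zero_le_one⟩
  have i1 : (1 : ℝ) ∈ Set.Icc (0 : ℝ) 1 := ⟨zero_le_one, le_rfl⟩
  -- an edge meets a vertex only at its ends
  have hav : ∀ (e : E) v, ∀ t ∈ Set.Icc (0 : ℝ) 1, γ e t = D.pos v → v ∈ e.1 := by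
    intro e v t ht h
    by_contra hc
    rw [hmem, not_or] at hc
    exact D.arc_avoid (hadj e) v hc.1 hc.2 ⟨t, ht, h⟩
  have hends : ∀ (e : E) p, p ∈ D.ends e.1 ↔ p = D.pos (dart e).1 ∨ p = D.pos (dart e).2 := by
    intro e p
    constructor
    · rintro ⟨a, ha, rfl⟩
      rcases (hmem e a).1 ha with rfl | rfl
      · exact Or.inl rfl
      · exact Or.inr rfl
    · rintro (rfl | rfl)
      · exact ⟨_, (hmem e _).2 (Or.inl rfl), rfl⟩
      · exact ⟨_, (hmem e _).2 (Or.inr rfl), rfl⟩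
  let Xs : Set (ℝ × ℝ) := {p | ∃ e f, D.IsCrossing e f p}
  have hXf : Xs.Finite := by
    refine ((crossings_finite D hD G.edgeSet G.edgeSet).image Prod.fst).subset ?_
    rintro p ⟨e, f, h⟩
    exact ⟨(p, s(e, f)), ⟨e, f, rfl, h.1, h.2.1, h⟩, rfl⟩
  have hXv : ∀ p ∈ Xs, ∀ v, p ≠ D.pos v := by
    rintro p ⟨e, f, h⟩ v rfl
    obtain ⟨t, ht, ht'⟩ := (hep ⟨e, h.1⟩ _).1 h.2.2.2.1
    exact h.2.2.2.2.2.1 ⟨v, hav ⟨e, h.1⟩ v t ht ht', rfl⟩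
  have hXfin : Finite Xs := hXf.to_subtype
  let _ : Fintype Xs := Fintype.ofFinite _
  let pos : V ⊕ Xs → ℝ × ℝ := Sum.elim D.pos Subtype.val
  have hpos : Function.Injective pos := by
    rintro (v | p) (w | q) h
    · exact congrArg _ (D.pos_inj h)
    · exact absurd h.symm (hXv q.1 q.2 v)
    · exact absurd h (hXv p.1 p.2 w)
    · exact congrArg _ (Subtype.ext h)
  have hdinj : ∀ e e' : E, edg (dart e) = edg (dart e') → e = e' := by
    intro e e' h; rw [hdart, hdart] at h; exact Subtype.ext h
  let Φ : V ⊕ Xs → Multiset (V × List V) → Multiset (Sym2 (Sym2 V)) → Prop := fun s B C =>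
    match s with
    | .inl v => C = 0 ∧ ∃ N : List V, B = {(v, N)} ∧ N.Nodup ∧ ∀ w, w ∈ N ↔ G.Adj v w
    | .inr p => B = 0 ∧ ∃ e f, D.IsCrossing e f p.1 ∧ C ≤ {s(e, f)}
  have hmain : ∃ (B : V ⊕ Xs → Multiset (V × List V)) (C : V ⊕ Xs → Multiset (Sym2 (Sym2 V))),
      (∀ s, Φ s (B s) (C s)) ∧ Der (∑ s, B s) (∑ s, C s) [] [] := by
   refine plane_arcs pos hpos γ (fun e => D.arc_cont (hadj e)) hinj
    (fun e => ⟨.inl _, hγ0 e⟩) (fun e => ⟨.inl _, hγ1 e⟩) ?_ dart hdinj (fun e => (hadj e).ne) Φ ?_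
   · intro e e' hne t ht t' ht' heq
     by_cases hv : ∃ v, γ e t = D.pos v
     · obtain ⟨v, hv⟩ := hv; exact ⟨.inl v, hv⟩
     push Not at hv
     refine ⟨.inr ⟨γ e t, e.1, e'.1, e.2, e'.2, fun h => hne (Subtype.ext h), (hep e _).2 ⟨t, ht, rfl⟩,
       (hep e' _).2 ⟨t', ht', heq.symm⟩, ?_, ?_⟩, rfl⟩
     · rintro ⟨a, -, h⟩; exact hv a h
     · rintro ⟨a, -, h⟩; exact hv a h
   · rintro (v | p) w hw hmw
     · have hw2 : ∀ x ∈ w, x.2 = v ∧ G.Adj v x.1 := by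
         intro x hx
         rcases (hmw x).1 hx with ⟨e, t, ht, ht1, hs, rfl⟩ | ⟨e, t, ht, ht1, hs, rfl⟩
         · have := hav e v t ht hs
           rcases (hmem e v).1 this with h | h
           · exact ⟨h.symm, h ▸ hadj e⟩
           · exact absurd (hinj e ht i1 (by rw [hγ1, ← h]; exact hs)) ht1
         · have := hav e v t ht hs
           rcases (hmem e v).1 this with h | h
           · exact absurd (hinj e ht i0 (by rw [hγ0, ← h]; exact hs)) ht1
           · exact ⟨h.symm, h ▸ (hadj e).symm⟩
       have hw3 : ∀ u, G.Adj v u → (u, v) ∈ w := by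
         intro u hu
         let e : E := ⟨s(v, u), hu⟩
         have he : edg (dart e) = s(v, u) := hdart e
         rw [hmw]
         rcases Sym2.eq_iff.1 he with ⟨h1, h2⟩ | ⟨h1, h2⟩
         · refine Or.inl ⟨e, 0, i0, zero_ne_one, ?_, ?_⟩
           · rw [hγ0, h1]; rfl
           · ext1 <;> simp [h1, h2]
         · refine Or.inr ⟨e, 1, i1, one_ne_zero, ?_, ?_⟩
           · rw [hγ1, h2]; rfl
           · ext1 <;> simp [h1, h2]
       have hwe : w = (w.map Prod.fst).map fun u => (u, v) := by
         rw [List.map_map]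
         conv_lhs => rw [← List.map_id w]
         apply List.map_congr_left
         intro x hx
         ext1
         · rfl
         · exact (hw2 x hx).1
       refine ⟨_, 0, ⟨rfl, (w.map Prod.fst).reverse, rfl, ?_, ?_⟩, ?_⟩
       · rw [List.nodup_reverse]
         refine hw.map_on fun x hx y hy h => ?_
         ext1
         · exact h
         · rw [(hw2 x hx).1, (hw2 y hy).1]
       · intro u
         rw [List.mem_reverse, List.mem_map]
         constructor
         · rintro ⟨x, hx, rfl⟩; exact (hw2 x hx).2
         · intro hu; exact ⟨_, hw3 u hu, rfl⟩
       · have := der_vertex v (w.map Prod.fst)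
         rwa [← hwe] at this
     · obtain ⟨p, e, f, h⟩ := p
       let e' : E := ⟨e, h.1⟩
       let f' : E := ⟨f, h.2.1⟩
       have hp : ∀ g : E, p ∈ D.edgePoints g.1 → g = e' ∨ g = f' := by
         intro g hg
         by_contra hc
         rw [not_or] at hc
         have n1 : g.1 ≠ e := fun h => hc.1 (Subtype.ext h)
         have n2 : g.1 ≠ f := fun h => hc.2 (Subtype.ext h)
         have hg' : p ∉ D.ends g.1 := by
           rintro ⟨a, -, rfl⟩
           exact hXv _ ⟨e, f, h⟩ a rfl
         exact hD.no_triple p e f g.1 h.2.2.1 n1.symm n2.symm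
           ⟨h, ⟨h.2.1, g.2, n2.symm, h.2.2.2.2.1, hg, h.2.2.2.2.2.2, hg'⟩,
             ⟨h.1, g.2, n1.symm, h.2.2.2.1, hg, h.2.2.2.2.2.1, hg'⟩⟩
       have hpt : ∀ g : E, g = e' ∨ g = f' → ∃ t ∈ Set.Icc (0 : ℝ) 1, t ≠ 0 ∧ t ≠ 1 ∧ γ g t = p := by
         intro g hg
         have : p ∈ D.edgePoints g.1 := by
           rcases hg with rfl | rfl
           · exact h.2.2.2.1
           · exact h.2.2.2.2.1
         obtain ⟨t, ht, rfl⟩ := (hep g p).1 this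
         refine ⟨t, ht, ?_, ?_, rfl⟩
         · rintro rfl; exact hXv _ ⟨e, f, h⟩ _ (hγ0 g)
         · rintro rfl; exact hXv _ ⟨e, f, h⟩ _ (hγ1 g)
       have hsw : ∀ e e', (dart e).swap ≠ dart e' := by
         intro e e' h
         have : e = e' := hdinj _ _ (by rw [← h, edg_swap])
         subst this
         exact (hadj e).ne (congrArg Prod.snd h)
       have hef : dart e' ≠ dart f' := fun h' =>
         h.2.2.1 (congrArg Subtype.val (hdinj e' f' (congrArg edg h')))
       have hperm : w.Perm [dart e', (dart e').swap, dart f', (dart f').swap] := by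
         rw [List.perm_ext_iff_of_nodup hw]
         · intro x
           rw [hmw]
           constructor
           · rintro (⟨g, t, ht, -, hs, rfl⟩ | ⟨g, t, ht, -, hs, rfl⟩) <;>
               rcases hp g ((hep g p).2 ⟨t, ht, hs⟩) with rfl | rfl <;> simp
           · intro hx
             simp only [List.mem_cons, List.not_mem_nil, or_false] at hx
             obtain ⟨t, ht, t0, t1, hs⟩ := hpt e' (Or.inl rfl)
             obtain ⟨t', ht', t0', t1', hs'⟩ := hpt f' (Or.inr rfl)
             rcases hx with rfl | rfl | rfl | rfl
             · exact Or.inr ⟨e', t, ht, t0, hs, rfl⟩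
             · exact Or.inl ⟨e', t, ht, t1, hs, rfl⟩
             · exact Or.inr ⟨f', t', ht', t0', hs', rfl⟩
             · exact Or.inl ⟨f', t', ht', t1', hs', rfl⟩
         · have hs2 : (dart e').swap ≠ (dart f').swap := fun h' => hef (Prod.swap_injective h')
           simp [hsw, hef, hs2, (hsw _ _).symm]
       obtain ⟨C, hC, hd⟩ := der_cross hperm
       refine ⟨0, C, ⟨rfl, e, f, h, ?_⟩, hd⟩
       rwa [hdart, hdart] at hC
  · obtain ⟨B, C, hBC, hder⟩ := hmain
    have hN : ∀ v, ∃ N : List V, B (.inl v) = {(v, N)} ∧ N.Nodup ∧ ∀ w, w ∈ N ↔ G.Adj v w :=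
      fun v => (hBC (.inl v)).2
    choose N hN1 hN2 hN3 using hN
    have hX : ∀ p : Xs, ∃ e f, D.IsCrossing e f p.1 ∧ C (.inr p) ≤ {s(e, f)} :=
      fun p => (hBC (.inr p)).2
    choose ex fx hX1 hX2 using hX
    rw [Fintype.sum_sum_type, Fintype.sum_sum_type] at hder
    have hB2 : ∑ p : Xs, B (.inr p) = 0 := Finset.sum_eq_zero fun p _ => (hBC (.inr p)).1
    have hC2 : ∑ v : V, C (.inl v) = 0 := Finset.sum_eq_zero fun p _ => (hBC (.inl p)).1
    rw [hB2, hC2, add_zero, zero_add, Finset.sum_congr rfl fun v _ => hN1 v] at hder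
    have hinjz : Function.Injective fun p : Xs => s(ex p, fx p) := by
      intro p q hpq
      apply Subtype.ext
      have hq := hX1 q
      rcases Sym2.eq_iff.1 hpq with ⟨h1, h2⟩ | ⟨h1, h2⟩
      · rw [← h1, ← h2] at hq; exact hD.cross_once _ _ (hX1 p) hq
      · rw [← h1, ← h2] at hq; exact hD.cross_once _ _ (hX1 p) (cross_symm D hq)
    have hle : ∑ p : Xs, C (.inr p) ≤ (Finset.univ.image fun p : Xs => s(ex p, fx p)).val := by
      rw [Finset.image_val_of_injOn hinjz.injOn]
      have : (Finset.univ : Finset Xs).val.map (fun p : Xs => s(ex p, fx p)) =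
          ∑ p : Xs, {s(ex p, fx p)} := by
        conv_lhs => rw [← Multiset.sum_map_singleton (Multiset.map _ _)]
        rw [Multiset.map_map]; rfl
      rw [this]
      exact Finset.sum_le_sum fun p _ => hX2 p
    refine ⟨N, _, ⟨hder, hN2, hN3, Multiset.nodup_of_le hle (Finset.nodup _), ?_⟩, ?_⟩
    · intro z hz
      have := Multiset.mem_of_le hle hz
      simp only [Finset.mem_val, Finset.mem_image, Finset.mem_univ, true_and] at this
      obtain ⟨p, rfl⟩ := this
      refine ⟨_, _, rfl, (hX1 p).1, (hX1 p).2.1, fun a ha ha' => ?_⟩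
      exact hD.adj_no_cross _ _ ⟨a, ha, ha'⟩ _ (hX1 p)
    · refine (Multiset.card_le_card hle).trans ?_
      rw [Finset.card_val, Finset.card_image_of_injective _ hinjz, Finset.card_univ,
        ← Nat.card_eq_fintype_card]
      have hf := (crossings_finite D hD G.edgeSet G.edgeSet).to_subtype
      refine Nat.card_le_card_of_injective
        (fun p : Xs => (⟨(p.1, s(ex p, fx p)), ex p, fx p, rfl, (hX1 p).1, (hX1 p).2.1, hX1 p⟩ :
          D.crossings G.edgeSet G.edgeSet)) ?_
      intro p q h
      exact Subtype.ext (congrArg (fun x => x.1.1) h)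

end

end CN

namespace CN

/-- a labelled piece of curve: the graph of `f` over `[a, b]` -/
structure Pd (V : Type*) where
  a : ℝ
  b : ℝ
  f : ℝ → ℝ
  d : V × V

/-- starting point of an oriented piece -/
def sg {K : Type} (P : K → Pd V) (o : K × Bool) : ℝ × ℝ :=
  if o.2 then ((P o.1).a, (P o.1).f (P o.1).a) else ((P o.1).b, (P o.1).f (P o.1).b)

/-- label of an oriented piece -/
def lb {K : Type} (P : K → Pd V) (o : K × Bool) : V × V :=
  if o.2 then (P o.1).d else (P o.1).d.swap

/-- one strip of a picture -/
structure St {S : Type} (P : S → Pd V) (w w' O : List (V × V)) (X : ℝ) (c : ℝ × ℝ) : Prop where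
  fin : Finite S
  hab : ∀ k, (P k).a < (P k).b
  hX : ∀ k, X ≤ (P k).a
  hX' : ∀ k, (P k).b ≤ X + 1
  hc : X < c.1
  hc' : c.1 < X + 1
  cont : ∀ k, Continuous (P k).f
  left : ∀ k, ((P k).a = X ∧ ∃ i, ∃ h : i < w.length, (P k).f X = i ∧ (P k).d = w[i]) ∨
    ((P k).a, (P k).f (P k).a) = c
  right : ∀ k, ((P k).b = X + 1 ∧ ∃ i, ∃ h : i < w'.length, (P k).f (X + 1) = i ∧ (P k).d = w'[i]) ∨
    ((P k).b, (P k).f (P k).b) = c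
  lex : ∀ i, ∀ h : i < w.length, ∃ k, (P k).a = X ∧ (P k).f X = i ∧ (P k).d = w[i]
  rex : ∀ i, ∀ h : i < w'.length, ∃ k, (P k).b = X + 1 ∧ (P k).f (X + 1) = i ∧ (P k).d = w'[i]
  dis : ∀ k k' x, k ≠ k' → x ∈ Set.Icc (P k).a (P k).b → x ∈ Set.Icc (P k').a (P k').b →
    (P k).f x = (P k').f x → (x, (P k).f x) = c
  onc : ∀ k, ∀ x ∈ Set.Icc (P k).a (P k).b, (x, (P k).f x) = c → x = (P k).a ∨ x = (P k).b
  out : ∀ o, sg P o = c → lb P o ∈ O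
  outu : ∀ o o', sg P o = c → sg P o' = c → lb P o = lb P o' → (lb P o).1 ≠ (lb P o).2 → o = o'
  outex : ∀ x ∈ O, ∃ o, sg P o = c ∧ lb P o = x

theorem strip_exists (p u v q : List (V × V)) (X : ℝ)
    (hO : ∀ i j, ∀ hi : i < (u.map Prod.swap ++ v).length, ∀ hj : j < (u.map Prod.swap ++ v).length,
      (u.map Prod.swap ++ v)[i] = (u.map Prod.swap ++ v)[j] →
      ((u.map Prod.swap ++ v)[i]).1 ≠ ((u.map Prod.swap ++ v)[i]).2 → i = j) :
    ∃ (S : Type) (P : S → Pd V) (c : ℝ × ℝ),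
      St P (p ++ u ++ q) (p ++ v ++ q) (u.map Prod.swap ++ v) X c := by
  let S := Fin p.length ⊕ Fin q.length ⊕ Fin u.length ⊕ Fin v.length
  let cy : ℝ := p.length - 1 / 2
  let P : S → Pd V := fun k => match k with
    | .inl i => ⟨X, X + 1, fun _ => i, p[i]⟩
    | .inr (.inl i) => ⟨X, X + 1, fun x => p.length + u.length + i +
        (x - X) * ((v.length : ℝ) - u.length), q[i]⟩
    | .inr (.inr (.inl i)) => ⟨X, X + 1 / 2, fun x => cy + (1 - 2 * (x - X)) * (i + 1 / 2), u[i]⟩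
    | .inr (.inr (.inr i)) => ⟨X + 1 / 2, X + 1, fun x => cy + (2 * (x - X) - 1) * (i + 1 / 2), v[i]⟩
  have hfin : ∀ {n : ℕ} (i : Fin n), (i : ℝ) + 1 ≤ n := fun i => by exact_mod_cast i.2
  have hfin0 : ∀ {n : ℕ} (i : Fin n), (0 : ℝ) ≤ (i : ℝ) := fun i => by positivity
  have hu0 : (0 : ℝ) ≤ u.length := by positivity
  have hv0 : (0 : ℝ) ≤ v.length := by positivity
  -- order facts
  have o1 : ∀ (i : Fin p.length) (j : Fin q.length) (x : ℝ), X ≤ x → x ≤ X + 1 →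
      (i : ℝ) < p.length + u.length + j + (x - X) * ((v.length : ℝ) - u.length) := by
    intro i j x h1 h2
    have := hfin i; have := hfin0 j
    nlinarith [mul_nonneg (sub_nonneg.2 h1) hv0, mul_nonneg (sub_nonneg.2 h2) hu0]
  have o2 : ∀ (i : Fin p.length) (j : Fin u.length) (x : ℝ), X ≤ x → x ≤ X + 1 / 2 →
      (i : ℝ) < cy + (1 - 2 * (x - X)) * (j + 1 / 2) := by
    intro i j x h1 h2
    have := hfin i; have := hfin0 j
    have : 0 ≤ (1 - 2 * (x - X)) * ((j : ℝ) + 1 / 2) := mul_nonneg (by linarith) (by linarith)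
    simp only [cy]; linarith
  have o3 : ∀ (i : Fin p.length) (j : Fin v.length) (x : ℝ), X + 1 / 2 ≤ x → x ≤ X + 1 →
      (i : ℝ) < cy + (2 * (x - X) - 1) * (j + 1 / 2) := by
    intro i j x h1 h2
    have := hfin i; have := hfin0 j
    have : 0 ≤ (2 * (x - X) - 1) * ((j : ℝ) + 1 / 2) := mul_nonneg (by linarith) (by linarith)
    simp only [cy]; linarith
  have o4 : ∀ (i : Fin q.length) (j : Fin u.length) (x : ℝ), X ≤ x → x ≤ X + 1 / 2 →
      cy + (1 - 2 * (x - X)) * (j + 1 / 2) <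
        p.length + u.length + i + (x - X) * ((v.length : ℝ) - u.length) := by
    intro i j x h1 h2
    have := hfin0 i; have h3 := hfin j
    have e1 : (1 - 2 * (x - X)) * ((j : ℝ) + 1 / 2) ≤ (1 - 2 * (x - X)) * u.length :=
      mul_le_mul_of_nonneg_left (by linarith) (by linarith)
    simp only [cy]
    nlinarith [mul_nonneg (sub_nonneg.2 h1) hv0, mul_nonneg (sub_nonneg.2 h1) hu0]
  have o5 : ∀ (i : Fin q.length) (j : Fin v.length) (x : ℝ), X + 1 / 2 ≤ x → x ≤ X + 1 →
      cy + (2 * (x - X) - 1) * (j + 1 / 2) <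
        p.length + u.length + i + (x - X) * ((v.length : ℝ) - u.length) := by
    intro i j x h1 h2
    have := hfin0 i; have h3 := hfin j
    have e1 : (2 * (x - X) - 1) * ((j : ℝ) + 1 / 2) ≤ (2 * (x - X) - 1) * v.length :=
      mul_le_mul_of_nonneg_left (by linarith) (by linarith)
    simp only [cy]
    nlinarith [mul_nonneg (sub_nonneg.2 h2) hv0, mul_nonneg (sub_nonneg.2 h2) hu0]
  have hxx : X ≤ X + 1 / 2 := by linarith
  have hxx' : X + 1 / 2 ≤ X + 1 := by linarith
  have hcp : ∀ i : Fin p.length, (i : ℝ) ≠ cy := by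
    intro i h
    have := hfin i
    simp only [cy] at h; linarith
  have hcq : ∀ i : Fin q.length,
      (p.length + u.length + i + (X + 1 / 2 - X) * ((v.length : ℝ) - u.length) : ℝ) ≠ cy := by
    intro i h
    have := hfin0 i
    simp only [cy] at h; nlinarith
  have inj : ∀ {n : ℕ} (i j : Fin n), (i : ℝ) = j → i = j := by
    intro n i j h; apply Fin.ext; exact_mod_cast h
  refine ⟨S, P, (X + 1 / 2, cy), ?_⟩
  have hsgc : ∀ o, sg P o = (X + 1 / 2, cy) → (∃ i, o = (.inr (.inr (.inl i)), false)) ∨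
      (∃ i, o = (.inr (.inr (.inr i)), true)) := by
    rintro ⟨i | i | i | i, _ | _⟩ h
    · have := congrArg Prod.fst h; simp [sg, P] at this
    · have := congrArg Prod.fst h; simp [sg, P] at this
    · have := congrArg Prod.fst h; simp [sg, P] at this
    · have := congrArg Prod.fst h; simp [sg, P] at this
    · exact Or.inl ⟨i, rfl⟩
    · have := congrArg Prod.fst h; simp [sg, P] at this
    · have := congrArg Prod.fst h; simp [sg, P] at this
    · exact Or.inr ⟨i, rfl⟩
  have hsg1 : ∀ i, sg P (.inr (.inr (.inl i)), false) = (X + 1 / 2, cy) := by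
    intro i; ext1
    · simp [sg, P]
    · simp [sg, P]
  have hsg2 : ∀ i, sg P (.inr (.inr (.inr i)), true) = (X + 1 / 2, cy) := by
    intro i; ext1
    · simp [sg, P]
    · simp [sg, P]
  have hlb1 : ∀ i : Fin u.length, lb P (.inr (.inr (.inl i)), false) =
      (u.map Prod.swap ++ v)[(i : ℕ)]'(by simp; omega) := by
    intro i; rw [List.getElem_append_left (by simp)]; simp [lb, P]
  have hlb2 : ∀ i : Fin v.length, lb P (.inr (.inr (.inr i)), true) =
      (u.map Prod.swap ++ v)[(u.length + i : ℕ)]'(by simp) := by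
    intro i; rw [List.getElem_append_right (by simp)]; simp [lb, P]
  constructor
  · infer_instance
  · rintro (i | i | i | i) <;> simp [P]; norm_num
  · rintro (i | i | i | i) <;> simp [P]
  · rintro (i | i | i | i) <;> simp [P]; norm_num
  · simp
  · simp; norm_num
  · rintro (i | i | i | i) <;> simp only [P] <;> fun_prop
  · -- left
    rintro (i | i | i | i)
    · exact Or.inl ⟨rfl, i, by simp; omega, rfl, by simp [P]⟩
    · refine Or.inl ⟨rfl, p.length + u.length + i, by simp; omega, by simp [P], ?_⟩
      rw [List.getElem_append_right (by simp)]; simp [P]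
    · refine Or.inl ⟨rfl, p.length + i, by simp; omega, by simp [P, cy], ?_⟩
      rw [List.getElem_append_left (by simp), List.getElem_append_right (by simp)]; simp [P]
    · exact Or.inr (hsg2 i)
  · rintro (i | i | i | i)
    · exact Or.inl ⟨rfl, i, by simp; omega, rfl, by simp [P]⟩
    · refine Or.inl ⟨rfl, p.length + v.length + i, by simp; omega, by simp [P]; ring, ?_⟩
      rw [List.getElem_append_right (by simp)]; simp [P]
    · exact Or.inr (hsg1 i)
    · refine Or.inl ⟨rfl, p.length + i, by simp; omega, by simp [P, cy]; ring, ?_⟩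
      rw [List.getElem_append_left (by simp), List.getElem_append_right (by simp)]; simp [P]
  · intro i h
    simp only [List.length_append] at h
    by_cases h1 : i < p.length
    · exact ⟨.inl ⟨i, h1⟩, rfl, rfl, by simp [P, h1]⟩
    by_cases h2 : i < p.length + u.length
    · refine ⟨.inr (.inr (.inl ⟨i - p.length, by omega⟩)), rfl, ?_, ?_⟩
      · simp only [P, cy]; push_cast [Nat.cast_sub (not_lt.1 h1)]; ring
      · rw [List.getElem_append_left (by simp; omega), List.getElem_append_right (by omega)]; simp [P]
    · refine ⟨.inr (.inl ⟨i - (p.length + u.length), by omega⟩), rfl, ?_, ?_⟩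
      · simp only [P]; push_cast [Nat.cast_sub (not_lt.1 h2)]; ring
      · rw [List.getElem_append_right (by simp; omega)]; simp [P]
  · intro i h
    simp only [List.length_append] at h
    by_cases h1 : i < p.length
    · exact ⟨.inl ⟨i, h1⟩, rfl, rfl, by simp [P, h1]⟩
    by_cases h2 : i < p.length + v.length
    · refine ⟨.inr (.inr (.inr ⟨i - p.length, by omega⟩)), rfl, ?_, ?_⟩
      · simp only [P, cy]; push_cast [Nat.cast_sub (not_lt.1 h1)]; ring
      · rw [List.getElem_append_left (by simp; omega), List.getElem_append_right (by omega)]; simp [P]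
    · refine ⟨.inr (.inl ⟨i - (p.length + v.length), by omega⟩), rfl, ?_, ?_⟩
      · simp only [P]; push_cast [Nat.cast_sub (not_lt.1 h2)]; ring
      · rw [List.getElem_append_right (by simp; omega)]; simp [P]
  · -- disjointness
    have hmk : ∀ y x : ℝ, x = X + 1 / 2 → y = cy → (x, y) = (X + 1 / 2, cy) := by
      rintro y x rfl rfl; rfl
    rintro (i | i | i | i) (j | j | j | j) x hne ⟨h1, h2⟩ ⟨h3, h4⟩ hf <;>
      simp only [P] at h1 h2 h3 h4 hf ⊢
    · exact absurd (by rw [inj i j hf]) hne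
    · exact absurd hf (o1 i j x h1 h2).ne
    · exact absurd hf (o2 i j x h3 h4).ne
    · exact absurd hf (o3 i j x h3 h4).ne
    · exact absurd hf.symm (o1 j i x h1 h2).ne
    · exact absurd (by rw [inj i j (by linarith)]) hne
    · exact absurd hf.symm (o4 i j x h3 h4).ne
    · exact absurd hf.symm (o5 i j x h3 h4).ne
    · exact absurd hf.symm (o2 j i x h1 h2).ne
    · exact absurd hf (o4 j i x h1 h2).ne
    · have : (1 - 2 * (x - X)) * ((i : ℝ) - j) = 0 := by linarith
      rcases mul_eq_zero.1 this with h | h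
      · rw [h]; exact hmk _ _ (by linarith) (by ring)
      · exact absurd (by rw [inj i j (by linarith)]) hne
    · have : x = X + 1 / 2 := by linarith
      subst this
      exact hmk _ _ rfl (by ring)
    · exact absurd hf.symm (o3 j i x h1 h2).ne
    · exact absurd hf (o5 j i x h1 h2).ne
    · have : x = X + 1 / 2 := by linarith
      subst this
      exact hmk _ _ rfl (by ring)
    · have : (2 * (x - X) - 1) * ((i : ℝ) - j) = 0 := by linarith
      rcases mul_eq_zero.1 this with h | h
      · rw [h]; exact hmk _ _ (by linarith) (by ring)
      · exact absurd (by rw [inj i j (by linarith)]) hne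
  · rintro (i | i | i | i) x hx h
    · exact absurd (congrArg Prod.snd h) (hcp i)
    · have h1 := congrArg Prod.fst h
      dsimp only at h1
      subst h1
      exact absurd (congrArg Prod.snd h) (hcq i)
    · exact Or.inr (congrArg Prod.fst h)
    · exact Or.inl (congrArg Prod.fst h)
  · intro o ho
    rcases hsgc o ho with ⟨i, rfl⟩ | ⟨i, rfl⟩
    · rw [hlb1]; exact List.getElem_mem _
    · rw [hlb2]; exact List.getElem_mem _
  · intro o o' ho ho'
    rcases hsgc o ho with ⟨i, rfl⟩ | ⟨i, rfl⟩ <;> rcases hsgc o' ho' with ⟨j, rfl⟩ | ⟨j, rfl⟩ <;>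
      simp only [hlb1, hlb2] <;> intro h h' <;> have := hO _ _ _ _ h h'
    · rw [Fin.ext this]
    · omega
    · omega
    · rw [Fin.ext (Nat.add_left_cancel this)]
  · intro x hx
    rcases List.mem_append.1 hx with h | h
    · obtain ⟨i, hi, rfl⟩ := List.getElem_of_mem h
      exact ⟨_, hsg1 ⟨i, by simpa using hi⟩, by simp [lb, P]⟩
    · obtain ⟨i, hi, rfl⟩ := List.getElem_of_mem h
      exact ⟨_, hsg2 ⟨i, by simpa using hi⟩, by simp [lb, P]⟩

end CN

namespace CN

/-- a pass-through or crossing node -/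
def Inner {K : Type} (P : K → Pd V) (B : Multiset (V × List V)) (C : Multiset (Sym2 (Sym2 V)))
    (vp : V → ℝ × ℝ) (cp : Sym2 (Sym2 V) → ℝ × ℝ) (o : K × Bool) : Prop :=
  (∃ o', sg P o' = sg P o ∧ lb P o' = (lb P o).swap) ∧
  (∀ o' o'', sg P o' = sg P o → sg P o'' = sg P o → edg (lb P o') ≠ edg (lb P o) →
    edg (lb P o'') ≠ edg (lb P o) → edg (lb P o') = edg (lb P o'')) ∧
  (∀ o', sg P o' = sg P o → edg (lb P o') ≠ edg (lb P o) →
    s(edg (lb P o), edg (lb P o')) ∈ C ∧ sg P o = cp s(edg (lb P o), edg (lb P o'))) ∧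
  ∀ v N, (v, N) ∈ B → sg P o ≠ vp v

/-- a partial picture in a half plane, with word `w` on the boundary line -/
structure Pic {K : Type} (P : K → Pd V) (B : Multiset (V × List V))
    (C : Multiset (Sym2 (Sym2 V))) (w : List (V × V)) (X : ℝ)
    (vp : V → ℝ × ℝ) (cp : Sym2 (Sym2 V) → ℝ × ℝ) : Prop where
  fin : Finite K
  hab : ∀ k, (P k).a < (P k).b
  hbX : ∀ k, (P k).b ≤ X
  cont : ∀ k, Continuous (P k).f
  uniq : ∀ o o', sg P o = sg P o' → lb P o = lb P o' → (lb P o).1 ≠ (lb P o).2 → o = o'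
  dis : ∀ k k' x, k ≠ k' → x ∈ Set.Icc (P k).a (P k).b → x ∈ Set.Icc (P k').a (P k').b →
    (P k).f x = (P k').f x → (x = (P k).a ∨ x = (P k).b) ∧ (x = (P k').a ∨ x = (P k').b)
  bd : ∀ i, ∀ h : i < w.length, ∃ k, (P k).b = X ∧ (P k).f X = i ∧ (P k).d = w[i]
  bdu : ∀ k, (P k).b = X → ∃ i, ∃ h : i < w.length, (P k).f X = i ∧ (P k).d = w[i]
  bdq : ∀ k k', (P k).b = X → (P k').b = X → (P k).f X = (P k').f X → k = k'
  node : ∀ o, (∃ v N, (v, N) ∈ B ∧ sg P o = vp v ∧ (lb P o).1 = v) ∨ (sg P o).1 = X ∨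
    Inner P B C vp cp o
  vout : ∀ v N, (v, N) ∈ B → ∀ u ∈ N, ∃ o, sg P o = vp v ∧ lb P o = (v, u)
  vX : ∀ v N, (v, N) ∈ B → (vp v).1 < X
  vinj : ∀ v N v' N', (v, N) ∈ B → (v', N') ∈ B → vp v = vp v' → v = v'
  von : ∀ v N, (v, N) ∈ B → ∀ k, (vp v).1 ∈ Set.Icc (P k).a (P k).b →
    (P k).f (vp v).1 = (vp v).2 → (vp v).1 = (P k).a ∨ (vp v).1 = (P k).b

/-- gluing a strip -/
theorem pic_strip {K S : Type} {P : K → Pd V} {Q : S → Pd V} {B B' C C' w w' O X vp vp' cp cp' c}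
    (hP : Pic P B C w X vp cp) (hQ : St Q w w' O X c)
    (hvp : ∀ v N, (v, N) ∈ B → vp' v = vp v) (hcp : ∀ z ∈ C, cp' z = cp z)
    (hBB : ∀ x ∈ B, x ∈ B') (hCC : ∀ x ∈ C, x ∈ C')
    (hnode : ∀ x ∈ O, (∃ v N, (v, N) ∈ B' ∧ c = vp' v ∧ x.1 = v) ∨
      (x.swap ∈ O ∧ (∀ y ∈ O, ∀ z ∈ O, edg y ≠ edg x → edg z ≠ edg x → edg y = edg z) ∧
        (∀ y ∈ O, edg y ≠ edg x → s(edg x, edg y) ∈ C' ∧ c = cp' s(edg x, edg y)) ∧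
        ∀ v N, (v, N) ∈ B' → (v, N) ∈ B))
    (v0 : V → Prop) (hv0 : ∀ v v', v0 v → v0 v' → v = v')
    (hB' : ∀ v N, (v, N) ∈ B' → (v, N) ∈ B ∨ (c = vp' v ∧ v0 v ∧ ∀ u ∈ N, (v, u) ∈ O)) :
    Pic (Sum.elim P Q) B' C' w' (X + 1) vp' cp' := by
  set R : K ⊕ S → Pd V := Sum.elim P Q with hR
  have sl : ∀ k β, sg R (.inl k, β) = sg P (k, β) := fun k β => rfl
  have sr : ∀ k β, sg R (.inr k, β) = sg Q (k, β) := fun k β => rfl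
  have ll : ∀ k β, lb R (.inl k, β) = lb P (k, β) := fun k β => rfl
  have lr : ∀ k β, lb R (.inr k, β) = lb Q (k, β) := fun k β => rfl
  have hc1 := hQ.hc
  have hc2 := hQ.hc'
  have old : ∀ o : K × Bool, (sg P o).1 < X ∨
      ((sg P o).1 = X ∧ o.2 = false ∧ ∃ i, ∃ h : i < w.length, sg P o = (X, (i : ℝ)) ∧ lb P o = (w[i]).swap) := by
    rintro ⟨k, _ | _⟩
    · rcases lt_or_eq_of_le (hP.hbX k) with h | h
      · left; simpa [sg] using h
      · right
        obtain ⟨i, hi, h1, h2⟩ := hP.bdu k h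
        exact ⟨by simpa [sg] using h, rfl, i, hi, by simp [sg, h, h1], by simp [lb, h2]⟩
    · left; simpa [sg] using (hP.hab k).trans_le (hP.hbX k)
  have new : ∀ o : S × Bool,
      (o.2 = true ∧ (Q o.1).a = X ∧ ∃ i, ∃ h : i < w.length, sg Q o = (X, (i : ℝ)) ∧ lb Q o = w[i]) ∨
      sg Q o = c ∨
      (o.2 = false ∧ (Q o.1).b = X + 1 ∧ ∃ i, ∃ h : i < w'.length, sg Q o = (X + 1, (i : ℝ)) ∧
        lb Q o = (w'[i]).swap) := by
    rintro ⟨k, _ | _⟩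
    · rcases hQ.right k with ⟨h, i, hi, h1, h2⟩ | h
      · exact Or.inr (Or.inr ⟨rfl, h, i, hi, by simp [sg, h, h1], by simp [lb, h2]⟩)
      · exact Or.inr (Or.inl (by simpa [sg] using h))
    · rcases hQ.left k with ⟨h, i, hi, h1, h2⟩ | h
      · exact Or.inl ⟨rfl, h, i, hi, by simp [sg, h, h1], by simp [lb, h2]⟩
      · exact Or.inr (Or.inl (by simpa [sg] using h))
  have newX : ∀ o : S × Bool, X ≤ (sg Q o).1 := by
    intro o
    rcases new o with ⟨-, -, i, hi, h, -⟩ | h | ⟨-, -, i, hi, h, -⟩ <;> rw [h]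
    · exact hc1.le
    · simp
  -- labels at an old boundary node
  have atX : ∀ i, ∀ h : i < w.length, ∀ o, sg R o = (X, (i : ℝ)) → lb R o = w[i] ∨ lb R o = (w[i]).swap := by
    rintro i hi ⟨k | k, β⟩ ho
    · rw [sl] at ho; rw [ll]
      rcases old (k, β) with h | ⟨-, -, j, hj, h1, h2⟩
      · rw [ho] at h; exact absurd h (lt_irrefl _)
      · rw [ho] at h1
        have : i = j := Nat.cast_injective (R := ℝ) (congrArg Prod.snd h1)
        subst this
        exact Or.inr h2
    · rw [sr] at ho; rw [lr]
      rcases new (k, β) with ⟨-, -, j, hj, h1, h2⟩ | h | ⟨-, -, j, hj, h1, h2⟩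
      · rw [ho] at h1
        have : i = j := Nat.cast_injective (R := ℝ) (congrArg Prod.snd h1)
        subst this
        exact Or.inl h2
      · rw [ho] at h; rw [← h] at hc1; exact absurd hc1 (lt_irrefl _)
      · rw [ho] at h1
        have := congrArg Prod.fst h1
        simp at this
  have vpX : ∀ v N, (v, N) ∈ B' → (vp' v).1 ≠ X := by
    intro v N h
    rcases hB' v N h with h | ⟨h, -⟩
    · rw [hvp v N h]; exact (hP.vX v N h).ne
    · rw [← h]; exact hc1.ne'
  have inX : ∀ i, ∀ h : i < w.length, ∀ o, sg R o = (X, (i : ℝ)) → Inner R B' C' vp' cp' o := by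
    intro i hi o ho
    have hedge : ∀ o', sg R o' = sg R o → edg (lb R o') = edg (lb R o) := by
      intro o' ho'
      rw [ho] at ho'
      rcases atX i hi o ho with h | h <;> rcases atX i hi o' ho' with h' | h' <;>
        rw [h, h'] <;> simp [edg_swap]
    refine ⟨?_, fun o' o'' ho' _ h => absurd (hedge o' ho') h,
      fun o' ho' h => absurd (hedge o' ho') h, ?_⟩
    · obtain ⟨k, k1, k2, k3⟩ := hP.bd i hi
      obtain ⟨l, l1, l2, l3⟩ := hQ.lex i hi
      rcases atX i hi o ho with h | h
      · exact ⟨(.inl k, false), by rw [ho]; simp [sg, hR, k1, k2], by rw [h]; simp [lb, hR, k3]⟩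
      · exact ⟨(.inr l, true), by rw [ho]; simp [sg, hR, l1, l2], by rw [h]; simp [lb, hR, l3]⟩
    · intro v N h h'
      apply vpX v N h
      rw [← h', ho]
  have atc : ∀ o, sg R o = c → ∃ o', o = (.inr o'.1, o'.2) ∧ sg Q o' = c := by
    rintro ⟨k | k, β⟩ ho
    · rw [sl] at ho
      rcases old (k, β) with h | ⟨h, -⟩
      · rw [ho] at h; linarith
      · rw [ho] at h; linarith
    · exact ⟨(k, β), rfl, ho⟩
  have hcv : ∀ v N, (v, N) ∈ B → c ≠ vp' v := by
    intro v N h h'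
    have := hP.vX v N h
    rw [← hvp v N h, ← h'] at this
    linarith
  constructor
  · have := hP.fin; have := hQ.fin; infer_instance
  · rintro (k | k)
    · exact hP.hab k
    · exact hQ.hab k
  · rintro (k | k)
    · exact (hP.hbX k).trans (by linarith)
    · exact hQ.hX' k
  · rintro (k | k)
    · exact hP.cont k
    · exact hQ.cont k
  · -- uniqueness
    have mixed : ∀ (k : K) (l : S) β β', sg P (k, β) = sg Q (l, β') → lb P (k, β) = lb Q (l, β') →
        (lb P (k, β)).1 = (lb P (k, β)).2 := by
      intro k l β β' h h'
      rcases old (k, β) with h1 | ⟨h1, -, i, hi, h2, h3⟩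
      · have := newX (l, β'); rw [← h] at this; linarith
      · rcases new (l, β') with ⟨-, -, j, hj, h4, h5⟩ | h4 | ⟨-, -, j, hj, h4, h5⟩
        · have : i = j := by rw [h2, h4] at h; exact Nat.cast_injective (R := ℝ) (congrArg Prod.snd h)
          subst this
          rw [h3, h5] at h'
          rw [h3, ← Prod.snd_swap, h', Prod.snd_swap]
          exact congrArg Prod.snd h'.symm ▸ rfl
        · rw [h, h4] at h1; linarith
        · rw [h, h4] at h1; simp at h1
    rintro ⟨k | k, β⟩ ⟨k' | k', β'⟩ h h' hl
    · have := hP.uniq (k, β) (k', β') h h' hl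
      simp only [Prod.mk.injEq] at this
      rw [this.1, this.2]
    · exact absurd (mixed _ _ _ _ h h') hl
    · exact absurd (mixed _ _ _ _ h.symm h'.symm) (by rw [h'] at hl; exact hl)
    · rw [sr, sr] at h
      rw [lr, lr] at h'
      rw [lr] at hl
      have fin : k = k' → β = β' → ((Sum.inr k, β) : (K ⊕ S) × Bool) = (Sum.inr k', β') := by
        rintro rfl rfl; rfl
      rcases new (k, β) with ⟨b1, a1, i, hi, h1, -⟩ | h1 | ⟨b1, a1, i, hi, h1, -⟩
      · rcases new (k', β') with ⟨b2, a2, j, hj, h2, -⟩ | h2 | ⟨b2, a2, j, hj, h2, -⟩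
        · refine fin ?_ (b1.trans b2.symm)
          by_contra hk
          dsimp only at a1 a2 b1 b2
          have e1 := congrArg Prod.snd h
          rw [b1, b2] at e1
          simp only [sg, if_true, a1, a2] at e1
          have := hQ.dis k k' X hk ⟨a1.le, a1 ▸ (hQ.hab k).le⟩ ⟨a2.le, a2 ▸ (hQ.hab k').le⟩ e1
          rw [← this] at hc1
          exact absurd hc1 (lt_irrefl _)
        · rw [h1, h2] at h; rw [← h] at hc1; exact absurd hc1 (lt_irrefl _)
        · rw [h1, h2] at h; have := congrArg Prod.fst h; simp at this
      · have := hQ.outu (k, β) (k', β') h1 (h ▸ h1) h' hl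
        simp only [Prod.mk.injEq] at this
        exact fin this.1 this.2
      · rcases new (k', β') with ⟨b2, a2, j, hj, h2, -⟩ | h2 | ⟨b2, a2, j, hj, h2, -⟩
        · rw [h1, h2] at h; have := congrArg Prod.fst h; simp at this
        · rw [h1, h2] at h; rw [← h] at hc2; exact absurd hc2 (lt_irrefl _)
        · refine fin ?_ (b1.trans b2.symm)
          by_contra hk
          dsimp only at a1 a2 b1 b2
          have e1 := congrArg Prod.snd h
          rw [b1, b2] at e1
          simp only [sg, a1, a2] at e1
          have := hQ.dis k k' (X + 1) hk ⟨a1 ▸ (hQ.hab k).le, a1.ge⟩ ⟨a2 ▸ (hQ.hab k').le, a2.ge⟩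
            (by simpa using e1)
          rw [← this] at hc2
          exact absurd hc2 (lt_irrefl _)
  · rintro (k | k) (k' | k') x hne hx hx' hf
    · exact hP.dis k k' x (fun h => hne (by rw [h])) hx hx' hf
    · have h1 := hx.2.trans (hP.hbX k)
      have h2 := (hQ.hX k').trans hx'.1
      exact ⟨Or.inr (le_antisymm hx.2 ((hP.hbX k).trans h2)), Or.inl (le_antisymm (h1.trans (hQ.hX k')) hx'.1)⟩
    · have h1 := hx'.2.trans (hP.hbX k')
      have h2 := (hQ.hX k).trans hx.1
      exact ⟨Or.inl (le_antisymm (h1.trans (hQ.hX k)) hx.1), Or.inr (le_antisymm hx'.2 ((hP.hbX k').trans h2))⟩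
    · have := hQ.dis k k' x (fun h => hne (by rw [h])) hx hx' hf
      exact ⟨hQ.onc k x hx this, hQ.onc k' x hx' (by rw [← this]; exact congrArg _ hf.symm)⟩
  · intro i hi
    obtain ⟨k, h⟩ := hQ.rex i hi
    exact ⟨.inr k, h⟩
  · rintro (k | k) hk
    · have h : (P k).b = X + 1 := hk
      have := hP.hbX k; linarith
    · rcases hQ.right k with ⟨-, h⟩ | h
      · exact h
      · rw [← h] at hc2; have : (Q k).b = X + 1 := hk; simp [this] at hc2
  · rintro (k | k) (k' | k') hk hk' hf
    · have h : (P k).b = X + 1 := hk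
      have := hP.hbX k; linarith
    · have h : (P k).b = X + 1 := hk
      have := hP.hbX k; linarith
    · have h : (P k').b = X + 1 := hk'
      have := hP.hbX k'; linarith
    · by_contra hne
      have a1 : (Q k).b = X + 1 := hk
      have a2 : (Q k').b = X + 1 := hk'
      have := hQ.dis k k' (X + 1) (fun h => hne (by rw [h])) ⟨a1 ▸ (hQ.hab k).le, a1.ge⟩
        ⟨a2 ▸ (hQ.hab k').le, a2.ge⟩ hf
      rw [← this] at hc2
      exact absurd hc2 (lt_irrefl _)
  · -- nodes
    rintro ⟨k | k, β⟩
    · rcases old (k, β) with hlt | ⟨-, -, i, hi, h, -⟩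
      · rcases hP.node (k, β) with ⟨v, N, h, h1, h2⟩ | h | h
        · exact Or.inl ⟨v, N, hBB _ h, by rw [hvp v N h]; exact h1, h2⟩
        · exact absurd h hlt.ne
        · right; right
          have lft : ∀ o, sg R o = sg R (.inl k, β) → ∃ o', o = (.inl o'.1, o'.2) ∧ sg P o' = sg P (k, β) := by
            rintro ⟨l | l, β'⟩ ho
            · exact ⟨(l, β'), rfl, ho⟩
            · have := newX (l, β')
              rw [← sr, ho, sl] at this; linarith
          obtain ⟨⟨o', e1, e2⟩, g2, g3, g4⟩ := h
          refine ⟨⟨(.inl o'.1, o'.2), e1, e2⟩, ?_, ?_, ?_⟩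
          · intro o1 o2 h1 h2
            obtain ⟨o1, rfl, h1⟩ := lft o1 h1
            obtain ⟨o2, rfl, h2⟩ := lft o2 h2
            exact g2 o1 o2 h1 h2
          · intro o1 h1 h2
            obtain ⟨o1, rfl, h1⟩ := lft o1 h1
            have := g3 o1 h1 h2
            refine ⟨hCC _ this.1, ?_⟩
            rw [sl, this.2]; exact (hcp _ this.1).symm
          · intro v N h
            rcases hB' v N h with h | ⟨h, -⟩
            · rw [hvp v N h]; exact g4 v N h
            · rw [← h, sl]; intro h; rw [h] at hlt; linarith
      · exact Or.inr (Or.inr (inX i hi _ h))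
    · rcases new (k, β) with ⟨-, -, i, hi, h, -⟩ | h | ⟨-, -, i, hi, h, -⟩
      · exact Or.inr (Or.inr (inX i hi _ h))
      · rcases hnode _ (hQ.out _ h) with ⟨v, N, h1, h2, h3⟩ | ⟨h1, h2, h3, h4⟩
        · exact Or.inl ⟨v, N, h1, by rw [sr, h, h2], h3⟩
        · right; right
          refine ⟨?_, ?_, ?_, ?_⟩
          · obtain ⟨o', e1, e2⟩ := hQ.outex _ h1
            exact ⟨(.inr o'.1, o'.2), e1.trans h.symm, e2⟩
          · intro o1 o2 g1 g2
            rw [sr, h] at g1 g2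
            obtain ⟨o1, rfl, g1⟩ := atc o1 g1
            obtain ⟨o2, rfl, g2⟩ := atc o2 g2
            exact h2 _ (hQ.out _ g1) _ (hQ.out _ g2)
          · intro o1 g1
            rw [sr, h] at g1 ⊢
            obtain ⟨o1, rfl, g1⟩ := atc o1 g1
            exact h3 _ (hQ.out _ g1)
          · intro v N hv
            rw [sr, h]
            exact hcv v N (h4 v N hv)
      · refine Or.inr (Or.inl ?_)
        rw [sr, h]
  · intro v N h u hu
    rcases hB' v N h with h | ⟨h, -, h1⟩
    · obtain ⟨o, e1, e2⟩ := hP.vout v N h u hu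
      exact ⟨(.inl o.1, o.2), by rw [hvp v N h]; exact e1, e2⟩
    · obtain ⟨o, e1, e2⟩ := hQ.outex _ (h1 u hu)
      exact ⟨(.inr o.1, o.2), by rw [← h]; exact e1, e2⟩
  · intro v N h
    rcases hB' v N h with h | ⟨h, -⟩
    · rw [hvp v N h]; have := hP.vX v N h; linarith
    · rw [← h]; exact hc2
  · intro v N v' N' h h' e
    rcases hB' v N h with h | ⟨h, g, -⟩ <;> rcases hB' v' N' h' with h' | ⟨h', g', -⟩
    · rw [hvp v N h, hvp v' N' h'] at e
      exact hP.vinj v N v' N' h h' e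
    · exact absurd (h'.trans e.symm) (hcv v N h)
    · exact absurd (h.trans e) (hcv v' N' h')
    · exact hv0 _ _ g g'
  · intro v N h
    rcases hB' v N h with h | ⟨h, -⟩
    · rw [hvp v N h]
      rintro (k | k) hk hf
      · exact hP.von v N h k hk hf
      · have h1 := hP.vX v N h
        have h2 : (Q k).a ≤ (vp v).1 := hk.1
        have := hQ.hX k
        linarith
    · rw [← h]
      rintro (k | k) hk hf
      · have h2 : c.1 ≤ (P k).b := hk.2
        have := hP.hbX k; linarith
      · refine hQ.onc k c.1 hk ?_
        ext1
        · rfl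
        · exact hf

end CN

namespace CN

lemma hO_of {O : List (V × V)} (h : O.Nodup ∨ ∀ x ∈ O, x.1 = x.2) :
    ∀ i j, ∀ hi : i < O.length, ∀ hj : j < O.length, O[i] = O[j] → (O[i]).1 ≠ (O[i]).2 → i = j := by
  intro i j hi hj h1 h2
  rcases h with h | h
  · exact (h.getElem_inj_iff).1 h1
  · exact absurd (h _ (List.getElem_mem _)) h2

theorem der_pic {B C} {u w : List (V × V)} (h : Der B C u w) (hu : u = [])
    (hB : (B.map Prod.fst).Nodup) (hN : ∀ v N, (v, N) ∈ B → N.Nodup) (hC : C.Nodup)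
    (hCi : ∀ z ∈ C, ∀ e f, z = s(e, f) → e ≠ f ∧ ¬ e.IsDiag ∧ ¬ f.IsDiag) :
    ∃ (K : Type) (P : K → Pd V) (X : ℝ) (vp : V → ℝ × ℝ) (cp : Sym2 (Sym2 V) → ℝ × ℝ),
      Pic P B C w X vp cp := by
  classical
  induction h with
  | refl =>
    subst hu
    refine ⟨Empty, fun k => k.elim, 0, fun _ => 0, fun _ => 0, ?_⟩
    constructor <;> first | infer_instance | (intro k; exact k.elim) | (intro k; exact k.1.elim) | simp
  | @tail B C B' C' u v w h s ih =>
    rw [Multiset.map_add] at hB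
    obtain ⟨K, P, X, vp, cp, hP⟩ := ih hu (Multiset.nodup_of_le (Multiset.le_add_right _ _) hB)
      (fun v N h => hN v N (Multiset.mem_add.2 (Or.inl h)))
      (Multiset.nodup_of_le (Multiset.le_add_right _ _) hC)
      (fun z hz => hCi z (Multiset.mem_add.2 (Or.inl hz)))
    cases s with
    | birth p q v N =>
      have hNn : N.Nodup := hN v N (by simp)
      have hO : (([] : List (V × V)).map Prod.swap ++ N.map (Prod.mk v)).Nodup := by
        simpa using hNn.map (Prod.mk_right_injective v)
      obtain ⟨S, Q, c, hQ⟩ := strip_exists p [] (N.map (Prod.mk v)) q X (hO_of (Or.inl hO))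
      rw [List.append_nil] at hQ
      have hv : ∀ v' N', (v', N') ∈ B → v' ≠ v := by
        rintro v' N' h rfl
        rw [Multiset.nodup_add] at hB
        exact Multiset.disjoint_left.1 hB.2.2 (Multiset.mem_map_of_mem Prod.fst h) (by simp)
      refine ⟨_, _, X + 1, Function.update vp v c, cp, pic_strip hP hQ ?_ (fun _ _ => rfl)
        (by simp +contextual) (by simp) ?_ (fun x => x = v) (by rintro _ _ rfl rfl; rfl) ?_⟩
      · intro v' N' h
        rw [Function.update_of_ne (hv v' N' h)]
      · intro x hx
        left
        refine ⟨v, N, by simp, by simp, ?_⟩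
        simp at hx
        obtain ⟨a, -, rfl⟩ := hx
        rfl
      · intro v' N' h
        rcases Multiset.mem_add.1 h with h | h
        · exact Or.inl h
        · simp at h
          obtain ⟨rfl, rfl⟩ := h
          right
          refine ⟨by simp, rfl, ?_⟩
          intro u hu
          simpa using hu
    | cup p q d =>
      have hO : (([] : List (V × V)).map Prod.swap ++ [d, d.swap]).Nodup ∨
          ∀ x ∈ ([] : List (V × V)).map Prod.swap ++ [d, d.swap], x.1 = x.2 := by
        by_cases hd : d.1 = d.2
        · right; simp [hd]
        · left; simp; intro h; exact hd (congrArg Prod.fst h)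
      obtain ⟨S, Q, c, hQ⟩ := strip_exists p [] [d, d.swap] q X (hO_of hO)
      rw [List.append_nil] at hQ
      refine ⟨_, _, X + 1, vp, cp, pic_strip hP hQ (fun _ _ _ => rfl) (fun _ _ => rfl)
        (by simp) (by simp) ?_ (fun x => False) (by simp) (by simp +contextual)⟩
      intro x hx
      right
      simp at hx
      rcases hx with rfl | rfl <;> simp [edg_swap]
    | cap p q d =>
      have hO : ([d, d.swap].map Prod.swap ++ ([] : List (V × V))).Nodup ∨
          ∀ x ∈ [d, d.swap].map Prod.swap ++ ([] : List (V × V)), x.1 = x.2 := by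
        by_cases hd : d.1 = d.2
        · right; simp [hd]
        · left; simp; intro h; exact hd (congrArg Prod.snd h)
      obtain ⟨S, Q, c, hQ⟩ := strip_exists p [d, d.swap] [] q X (hO_of hO)
      rw [List.append_nil p] at hQ
      refine ⟨_, _, X + 1, vp, cp, pic_strip hP hQ (fun _ _ _ => rfl) (fun _ _ => rfl)
        (by simp) (by simp) ?_ (fun x => False) (by simp) (by simp +contextual)⟩
      intro x hx
      right
      simp at hx
      rcases hx with rfl | rfl <;> simp [edg_swap]
    | swap p q d d' =>
      obtain ⟨hne, hd, hd'⟩ := hCi s(edg d, edg d') (by simp) _ _ rfl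
      have hd : d.1 ≠ d.2 := hd
      have hd' : d'.1 ≠ d'.2 := hd'
      have sw : ∀ x : V × V, x.1 ≠ x.2 → x.swap ≠ x := fun x hx h => hx (congrArg Prod.snd h)
      have n1 : d ≠ d' := fun h => hne (by rw [h])
      have n2 : d.swap ≠ d' := fun h => hne (by rw [← h, edg_swap])
      have n3 : d'.swap ≠ d := fun h => hne (by rw [← h, edg_swap])
      have hO : ([d, d'].map Prod.swap ++ [d', d]).Nodup := by
        simp [sw d hd, sw d' hd', n1, n1.symm, n2, n3]
      obtain ⟨S, Q, c, hQ⟩ := strip_exists p [d, d'] [d', d] q X (hO_of (Or.inl hO))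
      have hz : s(edg d, edg d') ∉ C := by
        intro h
        rw [Multiset.nodup_add] at hC
        exact Multiset.disjoint_left.1 hC.2.2 h (by simp)
      refine ⟨_, _, X + 1, vp, Function.update cp s(edg d, edg d') c,
        pic_strip hP hQ (fun _ _ _ => rfl) ?_
        (by simp) (by simp +contextual) ?_ (fun x => False) (by simp) (by simp +contextual)⟩
      · intro z hzC
        rw [Function.update_of_ne]
        rintro rfl; exact hz hzC
      · intro x hx
        right
        have e2 : s(edg d', edg d) = s(edg d, edg d') := Sym2.eq_swap
        simp at hx
        rcases hx with rfl | rfl | rfl | rfl <;> simp [edg_swap, hne, hne.symm, e2]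

end CN

namespace CN

/-- simple arcs -/
def IsArc (p q : ℝ × ℝ) (S : Set (ℝ × ℝ)) : Prop :=
  ∃ g : ℝ → ℝ × ℝ, ContinuousOn g (Set.Icc 0 1) ∧ Set.InjOn g (Set.Icc 0 1) ∧ g 0 = p ∧ g 1 = q ∧
    g '' Set.Icc 0 1 = S

lemma IsArc.symm {p q S} (h : IsArc p q S) : IsArc q p S := by
  obtain ⟨g, h1, h2, h3, h4, h5⟩ := h
  have hm : ∀ t ∈ Set.Icc (0 : ℝ) 1, 1 - t ∈ Set.Icc (0 : ℝ) 1 := fun t ht =>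
    ⟨by linarith [ht.2], by linarith [ht.1]⟩
  refine ⟨fun t => g (1 - t), h1.comp (by fun_prop) hm, ?_, by simp [h4], by simp [h3], ?_⟩
  · intro t ht t' ht' h
    have := h2 (hm t ht) (hm t' ht') h
    linarith
  · rw [← h5]
    ext z
    constructor
    · rintro ⟨t, ht, rfl⟩; exact ⟨1 - t, hm t ht, rfl⟩
    · rintro ⟨t, ht, rfl⟩; exact ⟨1 - t, hm t ht, by simp⟩

lemma IsArc.join {p q r S T} (h : IsArc p q S) (h' : IsArc q r T) (hST : ∀ z ∈ S, z ∈ T → z = q) :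
    IsArc p r (S ∪ T) := by
  obtain ⟨g, g1, g2, g3, g4, g5⟩ := h
  obtain ⟨k, k1, k2, k3, k4, k5⟩ := h'
  have m1 : ∀ t ∈ Set.Icc (0 : ℝ) (1 / 2), 2 * t ∈ Set.Icc (0 : ℝ) 1 := fun t ht =>
    ⟨by linarith [ht.1], by linarith [ht.2]⟩
  have m2 : ∀ t ∈ Set.Icc (1 / 2 : ℝ) 1, 2 * t - 1 ∈ Set.Icc (0 : ℝ) 1 := fun t ht =>
    ⟨by linarith [ht.1], by linarith [ht.2]⟩
  let l : ℝ → ℝ × ℝ := fun t => if t ≤ 1 / 2 then g (2 * t) else k (2 * t - 1)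
  have l1 : ∀ t ∈ Set.Icc (0 : ℝ) (1 / 2), l t = g (2 * t) := fun t ht => if_pos ht.2
  have l2 : ∀ t ∈ Set.Icc (1 / 2 : ℝ) 1, l t = k (2 * t - 1) := by
    intro t ht
    by_cases h : t ≤ 1 / 2
    · have : t = 1 / 2 := le_antisymm h ht.1
      subst this
      simp only [l, if_pos h]; norm_num [g4, k3]
    · exact if_neg h
  have hun : Set.Icc (0 : ℝ) 1 = Set.Icc 0 (1 / 2) ∪ Set.Icc (1 / 2) 1 :=
    (Set.Icc_union_Icc_eq_Icc (by norm_num) (by norm_num)).symm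
  have mS : ∀ t ∈ Set.Icc (0 : ℝ) 1, g t ∈ S := fun t ht => g5 ▸ ⟨t, ht, rfl⟩
  have mT : ∀ t ∈ Set.Icc (0 : ℝ) 1, k t ∈ T := fun t ht => k5 ▸ ⟨t, ht, rfl⟩
  have i0 : (0 : ℝ) ∈ Set.Icc (0 : ℝ) 1 := ⟨le_rfl, zero_le_one⟩
  have i1 : (1 : ℝ) ∈ Set.Icc (0 : ℝ) 1 := ⟨zero_le_one, le_rfl⟩
  have mix : ∀ t ∈ Set.Icc (0 : ℝ) (1 / 2), ∀ t' ∈ Set.Icc (1 / 2 : ℝ) 1, l t = l t' → t = t' := by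
    intro t ht t' ht' h
    rw [l1 t ht, l2 t' ht'] at h
    have e := hST _ (mS _ (m1 t ht)) (h ▸ mT _ (m2 t' ht'))
    have e1 := g2 (m1 t ht) i1 (e.trans g4.symm)
    have e2 := k2 (m2 t' ht') i0 ((h ▸ e).trans k3.symm)
    linarith
  refine ⟨l, ?_, ?_, ?_, ?_, ?_⟩
  · rw [hun]
    refine ContinuousOn.union_of_isClosed ?_ ?_ isClosed_Icc isClosed_Icc
    · exact (g1.comp (by fun_prop) m1).congr l1
    · exact (k1.comp (by fun_prop) m2).congr l2
  · rw [hun]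
    rintro t (ht | ht) t' (ht' | ht') h
    · rw [l1 t ht, l1 t' ht'] at h
      have := g2 (m1 t ht) (m1 t' ht') h; linarith
    · exact mix t ht t' ht' h
    · exact (mix t' ht' t ht h.symm).symm
    · rw [l2 t ht, l2 t' ht'] at h
      have := k2 (m2 t ht) (m2 t' ht') h; linarith
  · rw [l1 0 ⟨le_rfl, by norm_num⟩]; simpa using g3
  · rw [l2 1 ⟨by norm_num, le_rfl⟩]; norm_num [k4]
  · rw [hun, Set.image_union]
    congr 1
    · rw [← g5]
      ext z
      constructor
      · rintro ⟨t, ht, rfl⟩; rw [l1 t ht]; exact ⟨_, m1 t ht, rfl⟩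
      · rintro ⟨t, ht, rfl⟩
        have ht' : t / 2 ∈ Set.Icc (0 : ℝ) (1 / 2) := ⟨by linarith [ht.1], by linarith [ht.2]⟩
        refine ⟨t / 2, ht', ?_⟩
        rw [l1 _ ht']; congr 1; ring
    · rw [← k5]
      ext z
      constructor
      · rintro ⟨t, ht, rfl⟩; rw [l2 t ht]; exact ⟨_, m2 t ht, rfl⟩
      · rintro ⟨t, ht, rfl⟩
        have ht' : (t + 1) / 2 ∈ Set.Icc (1 / 2 : ℝ) 1 := ⟨by linarith [ht.1], by linarith [ht.2]⟩
        refine ⟨(t + 1) / 2, ht', ?_⟩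
        rw [l2 _ ht']; congr 1; ring

/-- points of a piece -/
def ps (k : Pd V) : Set (ℝ × ℝ) := {z | z.1 ∈ Set.Icc k.a k.b ∧ z.2 = k.f z.1}

/-- end point of an oriented piece -/
def tg {K : Type} (P : K → Pd V) (o : K × Bool) : ℝ × ℝ := sg P (o.1, !o.2)

lemma isArc_piece {K : Type} (P : K → Pd V) (o : K × Bool) (h : (P o.1).a < (P o.1).b)
    (hc : Continuous (P o.1).f) : IsArc (sg P o) (tg P o) (ps (P o.1)) := by
  obtain ⟨k, β⟩ := o
  have main : IsArc (sg P (k, true)) (sg P (k, false)) (ps (P k)) := by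
    dsimp only at h hc
    have hp : 0 < (P k).b - (P k).a := by linarith
    refine ⟨fun t => ((P k).a + t * ((P k).b - (P k).a), (P k).f ((P k).a + t * ((P k).b - (P k).a))),
      Continuous.continuousOn (by fun_prop), ?_, by simp [sg], by simp [sg], ?_⟩
    · intro t _ t' _ h
      have := congrArg Prod.fst h
      simp only [add_right_inj] at this
      exact mul_right_cancel₀ hp.ne' this
    · ext ⟨x, y⟩
      constructor
      · rintro ⟨t, ht, h⟩
        simp only [Prod.mk.injEq] at h
        obtain ⟨rfl, rfl⟩ := h
        refine ⟨⟨?_, ?_⟩, rfl⟩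
        · have := mul_nonneg ht.1 hp.le; simpa using this
        · have := mul_le_mul_of_nonneg_right ht.2 hp.le
          dsimp only; linarith
      · rintro ⟨⟨h1, h2⟩, h3⟩
        dsimp only at h1 h2 h3
        have e : (P k).a + (x - (P k).a) / ((P k).b - (P k).a) * ((P k).b - (P k).a) = x := by
          field_simp; ring
        refine ⟨(x - (P k).a) / ((P k).b - (P k).a), ⟨div_nonneg (by linarith) hp.le, ?_⟩, ?_⟩
        · rw [div_le_one hp]; linarith
        · dsimp only; rw [e, h3]
  cases β
  · exact main.symm
  · exact main

section
variable {K : Type} {P : K → Pd V} {B : Multiset (V × List V)} {C : Multiset (Sym2 (Sym2 V))}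
  {X : ℝ} {vp : V → ℝ × ℝ} {cp : Sym2 (Sym2 V) → ℝ × ℝ}

lemma lb_not (o : K × Bool) : lb P (o.1, !o.2) = (lb P o).swap := by
  obtain ⟨k, _ | _⟩ := o <;> simp [lb]

lemma edg_lb (o : K × Bool) : edg (lb P o) = edg (P o.1).d := by
  obtain ⟨k, _ | _⟩ := o <;> simp [lb, edg_swap]

lemma Pic.tinj (h : Pic P B C [] X vp cp) {o o' : K × Bool} (ht : tg P o = tg P o')
    (hl : lb P o = lb P o') (hn : (lb P o).1 ≠ (lb P o).2) : o = o' := by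
  have := h.uniq (o.1, !o.2) (o'.1, !o'.2) ht (by rw [lb_not, lb_not, hl])
    (by rw [lb_not]; exact hn.symm)
  simp only [Prod.mk.injEq, Bool.not_eq_not] at this
  exact Prod.ext this.1 (by simpa using this.2)

/-- node alternatives in a complete picture -/
lemma Pic.node' (h : Pic P B C [] X vp cp) (o : K × Bool) :
    (∃ v N, (v, N) ∈ B ∧ sg P o = vp v ∧ (lb P o).1 = v) ∨ Inner P B C vp cp o := by
  rcases h.node o with h1 | h1 | h1
  · exact Or.inl h1
  · exfalso
    have hb : (P o.1).b = X := by
      obtain ⟨k, _ | _⟩ := o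
      · simpa [sg] using h1
      · have e : (P k).a = X := by simpa [sg] using h1
        have := h.hab k; have := h.hbX k
        linarith
    obtain ⟨i, hi, -⟩ := h.bdu _ hb
    simp at hi
  · exact Or.inr h1

lemma Pic.atv (h : Pic P B C [] X vp cp) {o : K × Bool} {v N} (hv : (v, N) ∈ B)
    (ho : sg P o = vp v) : (lb P o).1 = v := by
  rcases h.node' o with ⟨v', N', h1, h2, h3⟩ | h1
  · rw [h3]; exact h.vinj _ _ _ _ h1 hv (h2.symm.trans ho)
  · exact absurd ho (h1.2.2.2 v N hv)

lemma Pic.meet (h : Pic P B C [] X vp cp) {k k' : K} (hk : k ≠ k') {z} (hz : z ∈ ps (P k))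
    (hz' : z ∈ ps (P k')) : (∃ β, z = sg P (k, β)) ∧ (∃ β, z = sg P (k', β)) := by
  obtain ⟨h1, h2⟩ := h.dis k k' z.1 hk hz.1 hz'.1 (hz.2.symm.trans hz'.2)
  have aux : ∀ k, z ∈ ps (P k) → (z.1 = (P k).a ∨ z.1 = (P k).b) → ∃ β, z = sg P (k, β) := by
    rintro k hz (e | e)
    · exact ⟨true, by ext1 <;> simp [sg, ← e, hz.2]⟩
    · exact ⟨false, by ext1 <;> simp [sg, ← e, hz.2]⟩
  exact ⟨aux k hz h1, aux k' hz' h2⟩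

/-- tracing an edge -/
theorem Pic.trace (h : Pic P B C [] X vp cp) {a b : V} (hab : a ≠ b) {Na}
    (ha : (a, Na) ∈ B) (hb : b ∈ Na) :
    ∃ F : Finset (K × Bool), (∀ o ∈ F, lb P o = (a, b)) ∧
      IsArc (vp a) (vp b) (⋃ o ∈ F, ps (P o.1)) := by
  classical
  have := h.fin
  let _ : Fintype K := Fintype.ofFinite K
  by_contra hcon
  -- partial traces
  have key : ∀ n : ℕ, ∃ (F : Finset (K × Bool)) (o : K × Bool), n < F.card ∧ o ∈ F ∧
      (∀ o ∈ F, lb P o = (a, b)) ∧ IsArc (vp a) (tg P o) (⋃ o ∈ F, ps (P o.1)) ∧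
      ∀ o' ∈ F, sg P o' = vp a ∨ ∃ o'' ∈ F, o'' ≠ o ∧ tg P o'' = sg P o' := by
    intro n
    induction n with
    | zero =>
      obtain ⟨o, ho, hl⟩ := h.vout a Na ha b hb
      refine ⟨{o}, o, by simp, by simp, by simp [hl], ?_, ?_⟩
      · have := isArc_piece P o (h.hab _) (h.cont _)
        rw [ho] at this
        simpa using this
      · intro o' ho'
        simp at ho'
        subst ho'
        exact Or.inl ho
    | succ n ih =>
      obtain ⟨F, o, hc, ho, hl, hA, hp⟩ := ih
      have hnl : ∀ o ∈ F, (lb P o).1 ≠ (lb P o).2 := by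
        intro o ho; rw [hl o ho]; exact hab
      have hrev : lb P (o.1, !o.2) = (b, a) := by rw [lb_not, hl o ho]; rfl
      -- the next piece
      obtain ⟨o', ho', hl'⟩ : ∃ o', sg P o' = tg P o ∧ lb P o' = (a, b) := by
        rcases h.node' (o.1, !o.2) with ⟨v, N, h1, h2, h3⟩ | h1
        · rw [hrev] at h3
          dsimp only at h3
          subst h3
          refine absurd ⟨F, hl, ?_⟩ hcon
          rw [← h2]; exact hA
        · obtain ⟨o', e1, e2⟩ := h1.1
          exact ⟨o', e1, by rw [e2, hrev]; rfl⟩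
      have hta : ∀ o, lb P o = (a, b) → tg P o ≠ vp a := by
        intro o ho h'
        have := h.atv ha (o := (o.1, !o.2)) h'
        rw [lb_not, ho] at this
        exact hab this.symm
      have hnF : o' ∉ F := by
        intro hF
        rcases hp o' hF with h1 | ⟨o'', h1, h2, h3⟩
        · exact hta o (hl o ho) (ho'.symm.trans h1)
        · exact h2 (h.tinj (h3.trans ho') ((hl _ h1).trans (hl _ ho).symm) (hnl _ h1))
      refine ⟨insert o' F, o', by rw [Finset.card_insert_of_notMem hnF]; omega, by simp, ?_, ?_, ?_⟩
      · intro x hx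
        rcases Finset.mem_insert.1 hx with rfl | hx
        · exact hl'
        · exact hl x hx
      · have hpc := isArc_piece P o' (h.hab _) (h.cont _)
        rw [ho'] at hpc
        have hj := hA.join hpc ?_
        · rw [Finset.set_biUnion_insert, Set.union_comm]; exact hj
        · intro z hz hz'
          simp only [Set.mem_iUnion] at hz
          obtain ⟨x, hx, hz⟩ := hz
          have hkk : x.1 ≠ o'.1 := by
            intro hk
            have e1 : o' = x ∨ o' = (x.1, !x.2) := by
              obtain ⟨k, β⟩ := x
              obtain ⟨k', β'⟩ := o'
              dsimp only at hk
              subst hk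
              cases β <;> cases β' <;> simp
            rcases e1 with rfl | e1
            · exact hnF hx
            · have := lb_not (P := P) x
              rw [← e1, hl', hl x hx] at this
              exact hab (congrArg Prod.fst this)
          obtain ⟨⟨β, hβ⟩, ⟨β', hβ'⟩⟩ := h.meet hkk hz hz'
          have c1 : z = sg P x ∨ z = tg P x := by
            obtain ⟨k, γ⟩ := x
            cases β <;> cases γ <;> simp [tg, hβ]
          have c2 : z = sg P o' ∨ z = tg P o' := by
            clear hβ
            obtain ⟨k, γ⟩ := o'
            cases β' <;> cases γ <;> simp [tg, hβ']
          rcases c2 with c2 | c2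
          · exact c2.trans ho'
          · exfalso
            rcases c1 with c1 | c1
            · rcases hp x hx with h1 | ⟨x', h1, -, h3⟩
              · exact hta o' hl' (by rw [← c2, c1, h1])
              · have := h.tinj (o := x') (o' := o') (by rw [h3, ← c1, c2]) ((hl _ h1).trans hl'.symm) (hnl _ h1)
                exact hnF (this ▸ h1)
            · have := h.tinj (o := x) (o' := o') (by rw [← c1, c2]) ((hl _ hx).trans hl'.symm) (hnl _ hx)
              exact hnF (this ▸ hx)
      · intro x hx
        rcases Finset.mem_insert.1 hx with rfl | hx
        · exact Or.inr ⟨o, Finset.mem_insert_of_mem ho, fun e => hnF (e ▸ ho), ho'.symm⟩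
        · rcases hp x hx with h1 | ⟨x', h1, -, h3⟩
          · exact Or.inl h1
          · exact Or.inr ⟨x', Finset.mem_insert_of_mem h1, fun e => hnF (e ▸ h1), h3⟩
  obtain ⟨F, _, hF, _⟩ := key (Fintype.card (K × Bool))
  exact absurd (Finset.card_le_univ F) (not_le.2 hF)

end

end CN

namespace CN

theorem claimB [Fintype V] {G : SimpleGraph V} {N C} (hV : Valid G N C) :
    ∃ D : Drawing G, D.IsGood ∧ D.crNum ≤ C.card := by
  classical
  have hBm : ∀ v L, (v, L) ∈ (∑ v, {(v, N v)} : Multiset (V × List V)) ↔ L = N v := by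
    intro v L
    rw [Multiset.mem_sum]
    simp only [Finset.mem_univ, true_and, Multiset.mem_singleton, Prod.mk.injEq]
    constructor
    · rintro ⟨w, rfl, h⟩; exact h
    · rintro h; exact ⟨v, rfl, h⟩
  have hBn : (((∑ v, {(v, N v)} : Multiset (V × List V))).map Prod.fst).Nodup := by
    have : ((∑ v, {(v, N v)} : Multiset (V × List V))).map Prod.fst = (Finset.univ : Finset V).val := by
      have h := map_sum (Multiset.mapAddMonoidHom (Prod.fst : V × List V → V)) (fun v => {(v, N v)}) Finset.univ
      simp only [Multiset.coe_mapAddMonoidHom, Multiset.map_singleton] at h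
      rw [h]
      exact Finset.sum_multiset_singleton _
    rw [this]; exact Finset.univ.nodup
  have hind : ∀ z ∈ C, ∀ e f, z = s(e, f) → e ∈ G.edgeSet ∧ f ∈ G.edgeSet ∧ ∀ a ∈ e, a ∉ f := by
    intro z hz e f h
    obtain ⟨e', f', h1, h2, h3, h4⟩ := hV.cind z hz
    rw [h1, Sym2.eq_iff] at h
    rcases h with ⟨rfl, rfl⟩ | ⟨rfl, rfl⟩
    · exact ⟨h2, h3, h4⟩
    · exact ⟨h3, h2, fun a h5 h6 => h4 a h6 h5⟩
  obtain ⟨K, P, X, vp, cp, hP⟩ := der_pic hV.der rfl hBn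
    (by intro v L h; rw [hBm] at h; rw [h]; exact hV.nodup v) hV.cnodup (by
      intro z hz e f h
      obtain ⟨h2, h3, h4⟩ := hind z hz e f h
      refine ⟨?_, G.not_isDiag_of_mem_edgeSet h2, G.not_isDiag_of_mem_edgeSet h3⟩
      rintro rfl
      induction e using Sym2.ind with | _ a b => exact h4 a (by simp) (by simp))
  set B := (∑ v, {(v, N v)} : Multiset (V × List V)) with hB
  have hvB : ∀ v, (v, N v) ∈ B := fun v => (hBm v _).2 rfl
  have htr : ∀ d : V × V, G.Adj d.1 d.2 → ∃ g : ℝ → ℝ × ℝ, ContinuousOn g (Set.Icc 0 1) ∧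
      Set.InjOn g (Set.Icc 0 1) ∧ g 0 = vp d.1 ∧ g 1 = vp d.2 ∧
      ∀ t ∈ Set.Icc (0 : ℝ) 1, ∃ k, edg (P k).d = s(d.1, d.2) ∧ g t ∈ ps (P k) := by
    rintro ⟨a, b⟩ hd
    obtain ⟨F, hF, g, h1, h2, h3, h4, h5⟩ := hP.trace hd.ne (hvB a) ((hV.mem a b).2 hd)
    refine ⟨g, h1, h2, h3, h4, fun t ht => ?_⟩
    have : g t ∈ ⋃ o ∈ F, ps (P o.1) := h5 ▸ ⟨t, ht, rfl⟩
    simp only [Set.mem_iUnion] at this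
    obtain ⟨o, ho, hz⟩ := this
    exact ⟨o.1, by rw [← edg_lb, hF o ho]; rfl, hz⟩
  choose! g g1 g2 g3 g4 g5 using htr
  have hout : ∀ e : Sym2 V, ∃ d : V × V, s(d.1, d.2) = e := by
    intro e
    induction e using Sym2.ind with | _ a b => exact ⟨(a, b), rfl⟩
  choose out hout using hout
  let arc : V → V → ℝ → ℝ × ℝ := fun a b t =>
    if (a, b) = out s(a, b) then g (a, b) t else g (b, a) (1 - t)
  have hm : ∀ t ∈ Set.Icc (0 : ℝ) 1, 1 - t ∈ Set.Icc (0 : ℝ) 1 := fun t ht =>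
    ⟨by linarith [ht.2], by linarith [ht.1]⟩
  have harc : ∀ a b, G.Adj a b → ContinuousOn (arc a b) (Set.Icc 0 1) ∧
      Set.InjOn (arc a b) (Set.Icc 0 1) ∧ arc a b 0 = vp a ∧ arc a b 1 = vp b ∧
      (∀ t ∈ Set.Icc (0 : ℝ) 1, ∃ k, edg (P k).d = s(a, b) ∧ arc a b t ∈ ps (P k)) := by
    intro a b hab
    by_cases h : (a, b) = out s(a, b)
    · have e : arc a b = g (a, b) := by funext t; simp only [arc, if_pos h]
      rw [e]
      exact ⟨g1 _ hab, g2 _ hab, g3 _ hab, g4 _ hab, g5 (a, b) hab⟩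
    · have e : arc a b = fun t => g (b, a) (1 - t) := by funext t; simp only [arc, if_neg h]
      rw [e]
      have hba := hab.symm
      refine ⟨(g1 (b, a) hba).comp (by fun_prop) hm, ?_, by simp [g4 (b, a) hba],
        by simp [g3 (b, a) hba], fun t ht => ?_⟩
      · intro t ht t' ht' h
        have := g2 (b, a) hba (hm t ht) (hm t' ht') h
        linarith
      · obtain ⟨k, h1, h2⟩ := g5 (b, a) hba _ (hm t ht)
        exact ⟨k, by rw [h1, Sym2.eq_swap], h2⟩
  have hsymm : ∀ a b, G.Adj a b → ∀ t, arc b a t = arc a b (1 - t) := by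
    intro a b hab t
    have hs : (s(b, a) : Sym2 V) = s(a, b) := Sym2.eq_swap
    have ho := hout s(a, b)
    rw [Sym2.eq_iff] at ho
    rcases ho with ⟨h1, h2⟩ | ⟨h1, h2⟩
    · have e : (a, b) = out s(a, b) := Prod.ext h1.symm h2.symm
      have e' : (b, a) ≠ out s(a, b) := by rw [← e]; intro h; exact hab.ne (congrArg Prod.snd h)
      simp only [arc, hs, if_pos e, if_neg e']
    · have e : (b, a) = out s(a, b) := Prod.ext h1.symm h2.symm
      have e' : (a, b) ≠ out s(a, b) := by rw [← e]; intro h; exact hab.ne (congrArg Prod.fst h)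
      simp only [arc, hs, if_pos e, if_neg e']
      congr 1; ring
  -- vertices on pieces
  have hvk : ∀ c k, vp c ∈ ps (P k) → c ∈ edg (P k).d := by
    intro c k hz
    have : ∃ β, vp c = sg P (k, β) := by
      rcases hP.von c _ (hvB c) k hz.1 hz.2.symm with e | e
      · exact ⟨true, by ext1 <;> simp [sg, ← e, hz.2]⟩
      · exact ⟨false, by ext1 <;> simp [sg, ← e, hz.2]⟩
    obtain ⟨β, hβ⟩ := this
    have h1 := hP.atv (hvB c) hβ.symm
    have := edg_lb (P := P) (k, β)
    dsimp only at this
    rw [← this, ← h1]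
    simp [edg]
  let D : Drawing G :=
    { pos := vp
      pos_inj := fun a b h => hP.vinj a _ b _ (hvB a) (hvB b) h
      arc := arc
      arc_cont := fun a b h => (harc a b h).1
      arc_zero := fun a b h => (harc a b h).2.2.1
      arc_one := fun a b h => (harc a b h).2.2.2.1
      arc_symm := fun a b h t => hsymm a b h t
      arc_avoid := by
        rintro a b h c ha hb ⟨t, ht, e⟩
        obtain ⟨k, h1, h2⟩ := (harc a b h).2.2.2.2 t ht
        rw [e] at h2
        have := hvk c k h2
        rw [h1, Sym2.mem_iff] at this
        tauto }
  have hep : ∀ e p, p ∈ D.edgePoints e → ∃ k, edg (P k).d = e ∧ p ∈ ps (P k) := by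
    rintro e p ⟨a, b, rfl, h, t, ht, rfl⟩
    exact (harc a b h).2.2.2.2 t ht
  have hkey : ∀ e f p, D.IsCrossing e f p → ∃ o : K × Bool, edg (lb P o) = e ∧ sg P o = p ∧
      (∃ o', edg (lb P o') = f ∧ sg P o' = p) ∧ Inner P B C vp cp o := by
    rintro e f p ⟨he, hf, hef, h1, h2, h3, h4⟩
    obtain ⟨k, hk, hkp⟩ := hep e p h1
    obtain ⟨k', hk', hkp'⟩ := hep f p h2
    have hkk : k ≠ k' := by rintro rfl; exact hef (hk.symm.trans hk')
    obtain ⟨⟨β, hβ⟩, ⟨β', hβ'⟩⟩ := hP.meet hkk hkp hkp'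
    refine ⟨(k, β), by rw [edg_lb, hk], hβ.symm, ⟨(k', β'), by rw [edg_lb, hk'], hβ'.symm⟩, ?_⟩
    rcases hP.node' (k, β) with ⟨v, L, h5, h6, h7⟩ | h5
    · exfalso
      refine h3 ⟨v, ?_, hβ.trans h6⟩
      rw [← hk, ← h7]
      have := edg_lb (P := P) (k, β)
      dsimp only at this
      rw [← this]; simp [edg]
    · exact h5
  have hC : ∀ e f p, D.IsCrossing e f p → s(e, f) ∈ C ∧ p = cp s(e, f) := by
    intro e f p h
    obtain ⟨o, h1, h2, ⟨o', h3, h4⟩, h5⟩ := hkey e f p h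
    have := h5.2.2.1 o' (h4.trans h2.symm) (by rw [h1, h3]; exact h.2.2.1.symm)
    rw [h1, h3, h2] at this
    exact this
  refine ⟨D, ⟨fun a b h => (harc a b h).2.1, ?_, ?_, ?_⟩, ?_⟩
  · rintro e f ⟨a, ha, hb⟩ p h
    exact (hind _ (hC e f p h).1 e f rfl).2.2 a ha hb
  · intro e f p hp q hq
    exact (hC e f p hp).2.trans (hC e f q hq).2.symm
  · rintro p e f k hef hek hfk ⟨h1, h2, h3⟩
    obtain ⟨o, a1, a2, ⟨o', a3, a4⟩, a5⟩ := hkey e f p h1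
    obtain ⟨_, b1, b2, ⟨o'', b3, b4⟩, b5⟩ := hkey e k p h3
    have := a5.2.1 o' o'' (a4.trans a2.symm) (b4.trans a2.symm) (by rw [a1, a3]; exact hef.symm)
      (by rw [a1, b3]; exact hek.symm)
    exact hfk (by rw [← a3, ← b3, this])
  · have : Nat.card (D.crossings G.edgeSet G.edgeSet) ≤ Nat.card (C.toFinset : Set (Sym2 (Sym2 V))) := by
      refine Nat.card_le_card_of_injective (fun q => ⟨q.1.2, ?_⟩) ?_
      · obtain ⟨q, e, f, h1, -, -, h2⟩ := q
        dsimp only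
        rw [h1]
        simpa using (hC e f _ h2).1
      · intro q q' h
        replace h : q.1.2 = q'.1.2 := congrArg Subtype.val h
        obtain ⟨q, e, f, h1, _, _, h2⟩ := q
        obtain ⟨q', e', f', h1', _, _, h2'⟩ := q'
        have e1 := (hC e f _ h2).2
        have e2 := (hC e' f' _ h2').2
        rw [← h1] at e1
        rw [← h1'] at e2
        exact Subtype.ext (Prod.ext (by rw [e1, e2, h]) h)
    refine this.trans ?_
    rw [Nat.card_eq_card_toFinset]
    simpa using Multiset.toFinset_card_le C

end CN

namespace CN

lemma X_rb_left (u v : List (V × V)) : X (rb u) v = X u v := by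
  induction u with
  | nil => rfl
  | cons d u ih =>
    rw [rb_cons, X_append_left, ih, X_cons_left d u, add_comm]
    congr 1
    simp [X, edg_swap]

lemma edg_eq {d d' : V × V} (h : edg d = edg d') : d = d' ∨ d = d'.swap := by
  obtain ⟨a, b⟩ := d
  obtain ⟨c, e⟩ := d'
  simp only [edg, Sym2.eq_iff] at h
  rcases h with ⟨rfl, rfl⟩ | ⟨rfl, rfl⟩ <;> simp

/-- the crossings of a cable -/
lemma exists_omega {V' : Type*} (φ : V × V → List (V' × V')) (hφ : ∀ d, φ d.swap = rb (φ d)) :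
    ∃ ω : Sym2 (Sym2 V) → Multiset (Sym2 (Sym2 V')),
      ∀ d d', ω s(edg d, edg d') = X (φ d) (φ d') := by
  have key : ∀ d1 d2, edg d1 = edg d2 → ∀ v, X (φ d1) v = X (φ d2) v := by
    intro d1 d2 h v
    rcases edg_eq h with rfl | rfl
    · rfl
    · rw [hφ, X_rb_left]
  have key2 : ∀ d1 d2 d1' d2', edg d1 = edg d2 → edg d1' = edg d2' →
      X (φ d1) (φ d1') = X (φ d2) (φ d2') := by
    intro d1 d2 d1' d2' h h'
    rw [key d1 d2 h, X_comm, key d1' d2' h', X_comm]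
  have hex : ∀ z : Sym2 (Sym2 V), ∃ d d' : V × V, z = s(edg d, edg d') := by
    intro z
    induction z using Sym2.ind with | _ e f =>
    induction e using Sym2.ind with | _ a b =>
    induction f using Sym2.ind with | _ c d => exact ⟨(a, b), (c, d), rfl⟩
  choose o o' ho using hex
  refine ⟨fun z => X (φ (o z)) (φ (o' z)), fun d d' => ?_⟩
  have := ho s(edg d, edg d')
  rw [Sym2.eq_iff] at this
  dsimp only
  rcases this with ⟨h1, h2⟩ | ⟨h1, h2⟩
  · exact key2 _ _ _ _ h1.symm h2.symm
  · rw [X_comm]; exact key2 _ _ _ _ h1.symm h2.symm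

section merge
variable {U : Type*} (p : U → Bool) (f g k : U → V × V)

/-- the crossings used in a merge -/
def mc : List U → Multiset (Sym2 (Sym2 V))
  | [] => 0
  | w :: L => (if p w then
      X ((L.filter p).map f ++ (L.filter fun u => !p u).map g) [k w]
      else X ((L.filter p).map f) [g w]) + mc L

lemma merge (L : List U) : Der 0 (mc p f g k L)
    ((L.filter p).map f ++ (L.filter fun u => !p u).map g ++ (L.filter p).map k)
    (L.flatMap fun w => if p w then [f w, k w] else [g w]) := by
  induction L with
  | nil => exact Der.refl _
  | cons w L ih =>
    by_cases hw : p w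
    · have h1 := (move ((L.filter p).map f ++ (L.filter fun u => !p u).map g) [k w]).ctx
        [f w] ((L.filter p).map k)
      have h2 := ih.ctx [f w, k w] []
      refine (h1.trans (h2.cast rfl rfl ?_ rfl)).cast ?_ ?_ ?_ ?_
      · simp
      · simp
      · simp [mc, hw]
      · simp [hw]
      · simp [hw]
    · have h1 := (move ((L.filter p).map f) [g w]).ctx
        [] ((L.filter fun u => !p u).map g ++ (L.filter p).map k)
      have h2 := ih.ctx [g w] []
      refine (h1.trans (h2.cast rfl rfl ?_ rfl)).cast ?_ ?_ ?_ ?_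
      · simp
      · simp
      · simp [mc, hw]
      · simp [hw]
      · simp [hw]

lemma card_mc (L : List U) : 2 * (mc p f g k L).card + L.countP p = 
    L.countP p * L.countP p + 2 * (L.countP p * L.countP (fun u => !p u)) := by
  induction L with
  | nil => rfl
  | cons w L ih =>
    by_cases hw : p w
    · simp only [mc, hw, List.countP_cons, Multiset.card_add, card_X, List.length_append,
        List.length_map, ← List.countP_eq_length_filter, if_true, List.length_singleton]
      simp only [Bool.not_true, Bool.false_eq_true, if_false]
      nlinarith
    · simp only [mc, hw, List.countP_cons, Multiset.card_add]
      simp only [Bool.not_eq_true] at hw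
      simp only [Bool.not_false, Bool.false_eq_true, if_false, if_true, card_X, List.length_map,
        ← List.countP_eq_length_filter, List.length_singleton]
      nlinarith

lemma mem_mc {L : List U} (hL : L.Nodup) {z} (hz : z ∈ mc p f g k L) : ∃ w ∈ L, ∃ w' ∈ L, w ≠ w' ∧
    ((p w ∧ p w' ∧ z = s(edg (f w'), edg (k w))) ∨ (p w ∧ ¬ p w' ∧ z = s(edg (g w'), edg (k w))) ∨
      (¬ p w ∧ p w' ∧ z = s(edg (f w'), edg (g w)))) := by
  induction L with
  | nil => simp [mc] at hz
  | cons w L ih =>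
    rw [List.nodup_cons] at hL
    rw [mc, Multiset.mem_add] at hz
    rcases hz with hz | hz
    · by_cases hw : p w
      · rw [if_pos hw, mem_X] at hz
        obtain ⟨d, hd, d', hd', rfl⟩ := hz
        simp only [List.mem_singleton] at hd'
        subst hd'
        simp only [List.mem_append, List.mem_map, List.mem_filter] at hd
        rcases hd with ⟨w', ⟨h1, h2⟩, rfl⟩ | ⟨w', ⟨h1, h2⟩, rfl⟩
        · exact ⟨w, by simp, w', by simp [h1], fun h => hL.1 (h ▸ h1), Or.inl ⟨hw, h2, rfl⟩⟩
        · exact ⟨w, by simp, w', by simp [h1], fun h => hL.1 (h ▸ h1),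
            Or.inr (Or.inl ⟨hw, by simpa using h2, rfl⟩)⟩
      · rw [if_neg hw, mem_X] at hz
        obtain ⟨d, hd, d', hd', rfl⟩ := hz
        simp only [List.mem_singleton] at hd'
        subst hd'
        simp only [List.mem_map, List.mem_filter] at hd
        obtain ⟨w', ⟨h1, h2⟩, rfl⟩ := hd
        exact ⟨w, by simp, w', by simp [h1], fun h => hL.1 (h ▸ h1), Or.inr (Or.inr ⟨hw, h2, rfl⟩)⟩
    · obtain ⟨a, ha, b, hb, h⟩ := ih hL.2 hz
      exact ⟨a, by simp [ha], b, by simp [hb], h⟩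

/-- nodup criterion for `X` -/
lemma X_nodup {u v : List (V × V)} (hu : (u.map edg).Nodup) (hv : (v.map edg).Nodup)
    (huv : ∀ d ∈ u, ∀ d' ∈ v, edg d ≠ edg d') : (X u v).Nodup := by
  rw [X, Multiset.coe_nodup, List.nodup_flatMap]
  constructor
  · intro d hd
    have : (v.map fun d' => s(edg d, edg d')) = (v.map edg).map fun e => s(edg d, e) := by simp
    rw [this]
    refine hv.map ?_
    intro e e' h
    simp at h
    rcases h with h | ⟨h, h'⟩
    · exact h
    · exact h'.trans h
  · rw [List.Nodup, List.pairwise_map] at hu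
    refine hu.imp_of_mem ?_
    intro d d' hd hd' h z hz hz'
    simp only [List.mem_map] at hz hz'
    obtain ⟨e, he, rfl⟩ := hz
    obtain ⟨e', he', h2⟩ := hz'
    rw [Sym2.eq_iff] at h2
    rcases h2 with ⟨h2, -⟩ | ⟨h2, h3⟩
    · exact h h2.symm
    · exact huv _ hd' _ he h2

lemma mc_nodup {L : List U} (hL : L.Nodup)
    (hinj : ∀ w ∈ L, ∀ w' ∈ L, ∀ d ∈ [f w, g w, k w], ∀ d' ∈ [f w', g w', k w'], edg d = edg d' → w = w') :
    (mc p f g k L).Nodup := by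
  induction L with
  | nil => simp [mc]
  | cons w L ih =>
    have hL' := List.nodup_cons.1 hL
    rw [mc, Multiset.nodup_add]
    have hfn : ∀ (r : U → V × V), (∀ w, r w ∈ [f w, g w, k w]) → ∀ L' : List U, L'.Sublist L →
        ((L'.map r).map edg).Nodup := by
      intro r hr L' hs
      rw [List.map_map]
      refine List.Nodup.map_on ?_ (hL'.2.sublist hs)
      intro a ha b hb hab
      exact hinj a (by simp [hs.subset ha]) b (by simp [hs.subset hb]) _ (hr a) _ (hr b) hab
    refine ⟨?_, ih hL'.2 fun a ha b hb => hinj a (by simp [ha]) b (by simp [hb]), ?_⟩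
    · split_ifs with hw
      · refine X_nodup ?_ (by simp) ?_
        · rw [List.map_append, List.nodup_append']
          refine ⟨hfn f (by simp) _ List.filter_sublist, hfn g (by simp) _ List.filter_sublist, ?_⟩
          intro e he he'
          simp only [List.mem_map, List.mem_filter] at he he'
          obtain ⟨_, ⟨a, ⟨ha, ha'⟩, rfl⟩, rfl⟩ := he
          obtain ⟨_, ⟨b, ⟨hb, hb'⟩, rfl⟩, h⟩ := he'
          have := hinj b (by simp [hb]) a (by simp [ha]) (g b) (by simp) (f a) (by simp) h
          subst this
          simp [ha'] at hb'
        · intro d hd d' hd' h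
          simp only [List.mem_append, List.mem_map, List.mem_filter, List.mem_singleton] at hd hd'
          subst hd'
          rcases hd with ⟨a, ⟨ha, -⟩, rfl⟩ | ⟨a, ⟨ha, -⟩, rfl⟩
          · have := hinj a (by simp [ha]) w (by simp) _ (by simp) _ (by simp) h
            exact hL'.1 (this ▸ ha)
          · have := hinj a (by simp [ha]) w (by simp) _ (by simp) _ (by simp) h
            exact hL'.1 (this ▸ ha)
      · refine X_nodup (hfn f (by simp) _ List.filter_sublist) (by simp) ?_
        intro d hd d' hd' h
        simp only [List.mem_map, List.mem_filter, List.mem_singleton] at hd hd'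
        subst hd'
        obtain ⟨a, ⟨ha, -⟩, rfl⟩ := hd
        have := hinj a (by simp [ha]) w (by simp) _ (by simp) _ (by simp) h
        exact hL'.1 (this ▸ ha)
    · rw [Multiset.disjoint_left]
      intro z hz hz'
      have h1 : ∃ d ∈ [f w, g w, k w], edg d ∈ z := by
        split_ifs at hz with hw
        · rw [mem_X] at hz
          obtain ⟨d, -, d', hd', rfl⟩ := hz
          simp only [List.mem_singleton] at hd'
          subst hd'
          exact ⟨k w, by simp, by simp⟩
        · rw [mem_X] at hz
          obtain ⟨d, -, d', hd', rfl⟩ := hz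
          simp only [List.mem_singleton] at hd'
          subst hd'
          exact ⟨g w, by simp, by simp⟩
      obtain ⟨d, hd, hdz⟩ := h1
      obtain ⟨a, ha, b, hb, -, h⟩ := mem_mc p f g k hL'.2 hz'
      have ca : ∀ d' ∈ [f a, g a, k a], edg d ≠ edg d' := by
        intro d' hd' h
        have := hinj w (by simp) a (by simp [ha]) d hd d' hd' h
        exact hL'.1 (this ▸ ha)
      have cb : ∀ d' ∈ [f b, g b, k b], edg d ≠ edg d' := by
        intro d' hd' h
        have := hinj w (by simp) b (by simp [hb]) d hd d' hd' h
        exact hL'.1 (this ▸ hb)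
      simp only [List.mem_cons, List.not_mem_nil, or_false, forall_eq_or_imp, forall_eq] at ca cb
      rcases h with ⟨-, -, rfl⟩ | ⟨-, -, rfl⟩ | ⟨-, -, rfl⟩ <;>
        · rw [Sym2.mem_iff] at hdz
          tauto

end merge

lemma exists_split {U : Type*} (p : U → Bool) (L : List U) (t : ℕ) (h : t ≤ L.countP p) :
    ∃ L1 L2, L = L1 ++ L2 ∧ L1.countP p = t := by
  induction L generalizing t with
  | nil => exact ⟨[], [], rfl, by simp at h; simp [h]⟩
  | cons w L ih =>
    rcases t with _ | t
    · exact ⟨[], w :: L, rfl, rfl⟩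
    · by_cases hw : p w
      · rw [List.countP_cons_of_pos hw] at h
        obtain ⟨L1, L2, h1, h2⟩ := ih t (by omega)
        exact ⟨w :: L1, L2, by simp [h1], by rw [List.countP_cons_of_pos hw, h2]⟩
      · rw [List.countP_cons_of_neg hw] at h
        obtain ⟨L1, L2, h1, h2⟩ := ih (t + 1) (by omega)
        exact ⟨w :: L1, L2, by simp [h1], by rw [List.countP_cons_of_neg hw, h2]⟩

/-- relabelling -/
lemma Der.map {W : Type*} (e : V → W) {B C} {u v : List (V × V)} (h : Der B C u v) :
    Der (B.map fun b => (e b.1, b.2.map e)) (C.map (Sym2.map (Sym2.map e)))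
      (u.map (Prod.map e e)) (v.map (Prod.map e e)) := by
  induction h with
  | refl => exact Der.refl _
  | tail h hs ih =>
    rw [Multiset.map_add, Multiset.map_add]
    refine Der.tail ih ?_
    cases hs with
    | birth p q x N =>
      have := Step.birth (p.map (Prod.map e e)) (q.map (Prod.map e e)) (e x) (N.map e)
      simpa [Function.comp_def] using this
    | cup p q d =>
      have := Step.cup (p.map (Prod.map e e)) (q.map (Prod.map e e)) (Prod.map e e d)
      obtain ⟨a, b⟩ := d
      simpa using this
    | cap p q d =>
      have := Step.cap (p.map (Prod.map e e)) (q.map (Prod.map e e)) (Prod.map e e d)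
      obtain ⟨a, b⟩ := d
      simpa using this
    | swap p q d d' =>
      have := Step.swap (p.map (Prod.map e e)) (q.map (Prod.map e e)) (Prod.map e e d) (Prod.map e e d')
      simpa [edg] using this

lemma Valid.map {W : Type*} [Fintype V] [Fintype W] {G : SimpleGraph V} {H : SimpleGraph W} (e : G ≃g H)
    {N C} (h : Valid G N C) :
    Valid H (fun w => (N (e.symm w)).map e) (C.map (Sym2.map (Sym2.map e))) := by
  refine ⟨?_, fun w => (h.nodup _).map e.injective, fun w w' => ?_, ?_, ?_⟩
  · refine (h.der.map e).cast ?_ rfl rfl rfl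
    have h1 := map_sum (Multiset.mapAddMonoidHom (fun b : V × List V => (e b.1, b.2.map e)))
      (fun v => {(v, N v)}) Finset.univ
    simp only [Multiset.coe_mapAddMonoidHom, Multiset.map_singleton] at h1
    rw [h1]
    refine Fintype.sum_equiv e.toEquiv _ _ ?_
    intro v
    simp
  · simp only [List.mem_map, h.mem]
    constructor
    · rintro ⟨a, h1, rfl⟩
      have := e.map_adj_iff.2 h1
      simpa using this
    · intro h1
      exact ⟨e.symm w', e.symm.map_adj_iff.2 h1, by simp⟩
  · refine h.cnodup.map ?_
    exact Sym2.map.injective (Sym2.map.injective e.injective)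
  · intro z hz
    rw [Multiset.mem_map] at hz
    obtain ⟨z, hz, rfl⟩ := hz
    obtain ⟨a, b, rfl, h1, h2, h3⟩ := h.cind z hz
    refine ⟨a.map e, b.map e, by simp, ?_, ?_, ?_⟩
    · induction a using Sym2.ind with | _ a b => exact e.map_adj_iff.2 h1
    · induction b using Sym2.ind with | _ a b => exact e.map_adj_iff.2 h2
    · intro w hw hw'
      rw [Sym2.mem_map] at hw hw'
      obtain ⟨v, hv, rfl⟩ := hw
      obtain ⟨v', hv', h4⟩ := hw'
      rw [e.injective h4] at hv'
      exact h3 v hv hv'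

end CN

namespace CN

/-- the complete bipartite graph given by a side function -/
def sideG {U : Type*} (σ : U → Bool) : SimpleGraph U where
  Adj a b := σ a ≠ σ b
  symm := ⟨fun _ _ h => Ne.symm h⟩
  loopless := ⟨fun _ h => h rfl⟩

/-- sides of the cabled graph -/
def side (κ : V → Fin 4) : V ⊕ Fin 2 → Bool :=
  Sum.elim (fun v => decide (κ v = 0 ∨ κ v = 3)) (fun _ => false)

/-- widths of cables -/
def Wd (i j : Fin 4) : ℕ :=
  if (i = 0 ∧ j = 3) ∨ (i = 3 ∧ j = 0) then 2
  else if (i = 1 ∧ j = 2) ∨ (i = 2 ∧ j = 1) ∨ i = j then 0 else 1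

lemma Wd_comm (i j : Fin 4) : Wd i j = Wd j i := by revert i j; decide

/-- width of an edge -/
def wE (κ : V → Fin 4) : Sym2 V → ℕ :=
  Sym2.lift ⟨fun u v => Wd (κ u) (κ v), fun _ _ => Wd_comm _ _⟩

/-- weight of a crossing -/
def wt (κ : V → Fin 4) : Sym2 (Sym2 V) → ℕ :=
  Sym2.lift ⟨fun e f => wE κ e * wE κ f, fun _ _ => mul_comm _ _⟩

/-- new neighbours -/
def hh (κ : V → Fin 4) (S : V → Bool) (u v : V) : List (V ⊕ Fin 2) :=
  if κ v = 0 then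
    (if κ u = 3 then (if S u then [.inr 1, .inr 0] else [.inr 0, .inr 1])
      else if κ u = 0 then [] else [.inl v])
  else if (κ u = 3 ∧ κ v ≠ 3) ∨ (κ v = 3 ∧ κ u ≠ 3) then [.inl v] else []

/-- the cable pattern -/
def ph (κ : V → Fin 4) (S : V → Bool) (d : V × V) : List ((V ⊕ Fin 2) × (V ⊕ Fin 2)) :=
  if κ d.1 = 0 then rb ((hh κ S d.2 d.1).map (Prod.mk (.inl d.2)))
  else (hh κ S d.1 d.2).map (Prod.mk (.inl d.1))

section
variable (κ : V → Fin 4) (S : V → Bool)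

lemma ph_swap (d : V × V) : ph κ S d.swap = rb (ph κ S d) := by
  obtain ⟨u, v⟩ := d
  simp only [ph, Prod.swap]
  by_cases hu : κ u = 0 <;> by_cases hv : κ v = 0
  · simp [hh, hu, hv]
  · simp [hu, hv]
  · simp [hu, hv]
  · simp only [hu, hv, if_false, hh]
    by_cases h : (κ u = 3 ∧ κ v ≠ 3) ∨ (κ v = 3 ∧ κ u ≠ 3)
    · rw [if_pos h, if_pos h.symm]; simp [rb]
    · rw [if_neg h, if_neg (fun h' => h h'.symm)]; simp [rb]

lemma length_hh {u v : V} (hu : κ u ≠ 0) : (hh κ S u v).length = Wd (κ u) (κ v) := by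
  have : ∀ i j : Fin 4, ∀ b : Bool, i ≠ 0 → (if j = 0 then
    (if i = 3 then (if b then 2 else 2)
      else if i = 0 then 0 else 1)
    else if (i = 3 ∧ j ≠ 3) ∨ (j = 3 ∧ i ≠ 3) then 1 else 0) = Wd i j := by decide
  rw [← this (κ u) (κ v) (S u) hu, hh]
  split_ifs <;> rfl

lemma length_ph (d : V × V) : (ph κ S d).length = Wd (κ d.1) (κ d.2) := by
  by_cases hu : κ d.1 = 0
  · by_cases hv : κ d.2 = 0
    · simp [ph, hh, hu, hv, Wd, rb]
    · simp only [ph, hu, if_true, rb, List.length_reverse, List.length_map, length_hh κ S hv]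
      exact Wd_comm _ _
  · simp only [ph, hu, if_false, List.length_map, length_hh κ S hu]

lemma nodup_hh (u v : V) : (hh κ S u v).Nodup := by
  rw [hh]; split_ifs <;> simp

lemma nodup_ph (d : V × V) : ((ph κ S d).map edg).Nodup := by
  have key : ∀ u v, (((hh κ S u v).map (Prod.mk (Sum.inl u : V ⊕ Fin 2))).map edg).Nodup := by
    intro u v
    rw [List.map_map]
    refine (nodup_hh κ S u v).map ?_
    intro a b h
    simp only [Function.comp, edg, Sym2.eq_iff] at h
    rcases h with h | h
    · exact h.2
    · exact h.2.trans h.1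
  rw [ph]
  split_ifs
  · have : ∀ w : List ((V ⊕ Fin 2) × (V ⊕ Fin 2)), (rb w).map edg = (w.map edg).reverse := by
      intro w; simp [rb, Function.comp_def, edg_swap]
    rw [this, List.nodup_reverse]
    exact key _ _
  · exact key _ _

/-- projection -/
def pr (x : V) : V ⊕ Fin 2 → V := Sum.elim id (fun _ => x)

lemma mem_hh {x : V} (hx : ∀ v, κ v = 0 ↔ v = x) {u v : V} (hu : κ u ≠ 0) {w} (hw : w ∈ hh κ S u v) :
    pr x w = v ∧ side κ (.inl u) ≠ side κ w := by
  rw [hh] at hw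
  by_cases hv : κ v = 0
  · rw [if_pos hv] at hw
    by_cases h3 : κ u = 3
    · rw [if_pos h3] at hw
      have : w = .inr 1 ∨ w = .inr 0 := by
        split_ifs at hw <;> simp at hw <;> tauto
      rw [hx] at hv
      rcases this with rfl | rfl <;> simp [pr, side, h3, hv]
    · rw [if_neg h3, if_neg hu, List.mem_singleton] at hw
      subst hw
      simp [pr, side, h3, hu, hv]
  · rw [if_neg hv] at hw
    split_ifs at hw with h
    · rw [List.mem_singleton] at hw
      subst hw
      simp only [pr, side, Sum.elim_inl, id, hu, hv, false_or, true_and]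
      rcases h with ⟨h1, h2⟩ | ⟨h1, h2⟩ <;> simp [h1, h2]
    · simp at hw

lemma mem_ph {x : V} (hx : ∀ v, κ v = 0 ↔ v = x) {d : V × V} {d'} (hw : d' ∈ ph κ S d) :
    pr x d'.1 = d.1 ∧ pr x d'.2 = d.2 ∧ side κ d'.1 ≠ side κ d'.2 := by
  obtain ⟨u, v⟩ := d
  simp only [ph] at hw
  split_ifs at hw with hu
  · have hv : κ v ≠ 0 := by
      intro hv; simp [hh, hu, hv] at hw
    simp only [rb, List.mem_reverse, List.mem_map] at hw
    obtain ⟨_, ⟨w, hw, rfl⟩, rfl⟩ := hw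
    have := mem_hh κ S hx hv hw
    exact ⟨this.1, rfl, this.2.symm⟩
  · simp only [List.mem_map] at hw
    obtain ⟨w, hw, rfl⟩ := hw
    have := mem_hh κ S hx hu hw
    exact ⟨rfl, this.1, this.2⟩

lemma mem_hh_iff {x : V} (hx : ∀ v, κ v = 0 ↔ v = x) {u : V} (hu : κ u ≠ 0) {w : V ⊕ Fin 2} :
    (∃ v, κ u ≠ κ v ∧ w ∈ hh κ S u v) ↔ side κ (.inl u) ≠ side κ w := by
  constructor
  · rintro ⟨v, -, h⟩; exact (mem_hh κ S hx hu h).2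
  · intro h
    have hx0 : κ x = 0 := (hx x).2 rfl
    by_cases h3 : κ u = 3
    · rcases w with v | i
      · simp only [side, Sum.elim_inl, h3, ne_eq, decide_eq_decide] at h
        refine ⟨v, ?_, ?_⟩
        · rw [h3]; intro h'; simp [← h'] at h
        · simp at h
          simp [hh, h3, h]
      · refine ⟨x, by rw [h3, hx0]; decide, ?_⟩
        simp only [hh, hx0, h3, if_true]
        split_ifs <;> fin_cases i <;> simp
    · rcases w with v | i
      · simp [side, h3, hu] at h
        replace h : κ v = 0 ∨ κ v = 3 := by tauto
        refine ⟨v, ?_, ?_⟩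
        · rcases h with h | h <;> rw [h]
          · exact hu
          · exact h3
        · rcases h with h | h
          · simp [hh, h, h3, hu]
          · simp [hh, h, h3]
      · simp [side, h3, hu] at h

end

/-- the local picture at `x` -/
lemma gadget {U : Type*} (p : V → Bool) (f : V → U) (P0 P1 Q : U) (L1 L2 : List V) :
    Der ({(P0, (L1.filter p).map f ++ [Q] ++ (L2.filter p).map f)} +
        {(Q, [P0] ++ (L1.filter fun u => !p u).map f ++ [P1] ++ (L2.filter fun u => !p u).map f)} +
        {(P1, [Q] ++ (L1.filter p).map f ++ (L2.filter p).map f)})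
      (mc p (fun w => (P0, f w)) (fun w => (Q, f w)) (fun w => (P1, f w)) L1 +
        mc p (fun w => (P1, f w)) (fun w => (Q, f w)) (fun w => (P0, f w)) L2) []
      ((L1.flatMap fun w => if p w then [(P0, f w), (P1, f w)] else [(Q, f w)]) ++
        (L2.flatMap fun w => if p w then [(P1, f w), (P0, f w)] else [(Q, f w)])) := by
  have b1 := Der.single (Step.birth [] [] P0 ((L1.filter p).map f ++ [Q] ++ (L2.filter p).map f))
  have b2 := Der.single (Step.birth ((L1.filter p).map (fun w => (P0, f w)) ++ [(P0, Q)])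
    ((L2.filter p).map (fun w => (P0, f w))) Q
    ([P0] ++ (L1.filter fun u => !p u).map f ++ [P1] ++ (L2.filter fun u => !p u).map f))
  have c2 := Der.single (Step.cap ((L1.filter p).map (fun w => (P0, f w)))
    ((L1.filter fun u => !p u).map (fun w => (Q, f w)) ++ [(Q, P1)] ++
      (L2.filter fun u => !p u).map (fun w => (Q, f w)) ++ (L2.filter p).map (fun w => (P0, f w))) (P0, Q))
  have b3 := Der.single (Step.birth ((L1.filter p).map (fun w => (P0, f w)) ++
    (L1.filter fun u => !p u).map (fun w => (Q, f w)) ++ [(Q, P1)])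
      ((L2.filter fun u => !p u).map (fun w => (Q, f w)) ++ (L2.filter p).map (fun w => (P0, f w)))
      P1 ([Q] ++ (L1.filter p).map f ++ (L2.filter p).map f))
  have c3 := Der.single (Step.cap ((L1.filter p).map (fun w => (P0, f w)) ++
    (L1.filter fun u => !p u).map (fun w => (Q, f w)))
      ((L1.filter p).map (fun w => (P1, f w)) ++ (L2.filter p).map (fun w => (P1, f w)) ++
      (L2.filter fun u => !p u).map (fun w => (Q, f w)) ++ (L2.filter p).map (fun w => (P0, f w))) (Q, P1))
  have m1 := (merge p (fun w => (P0, f w)) (fun w => (Q, f w)) (fun w => (P1, f w)) L1).ctx []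
    ((L2.filter p).map (fun w => (P1, f w)) ++
      (L2.filter fun u => !p u).map (fun w => (Q, f w)) ++ (L2.filter p).map (fun w => (P0, f w)))
  have m2 := (merge p (fun w => (P1, f w)) (fun w => (Q, f w)) (fun w => (P0, f w)) L2).ctx
    (L1.flatMap fun w => if p w then [(P0, f w), (P1, f w)] else [(Q, f w)]) []
  have r := ((((b1.trans (b2.cast rfl rfl (by simp [Function.comp_def]) rfl)).trans
    (c2.cast rfl rfl (by simp [Function.comp_def]) rfl)).trans
    (b3.cast rfl rfl (by simp) rfl)).trans (c3.cast rfl rfl (by simp [Function.comp_def]) rfl)).trans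
    (m1.cast rfl rfl (by simp) rfl)
  have r2 := r.trans (m2.cast rfl rfl (by simp) rfl)
  exact r2.cast (by simp) (by simp) rfl (by simp)

end CN

namespace CN

set_option maxHeartbeats 2000000 in
theorem cable_valid [Fintype V] {G : SimpleGraph V} (κ : V → Fin 4)
    (hG : ∀ u v, G.Adj u v ↔ κ u ≠ κ v) (x : V) (hx : ∀ v, κ v = 0 ↔ v = x) (α t : ℕ)
    (hα : (Finset.univ.filter fun v => κ v = 1 ∨ κ v = 2).card = α)
    (ht : (Finset.univ.filter fun v => κ v = 3).card = 2 * t) {N C} (hV : Valid G N C) :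
    ∃ N' C', Valid (sideG (side κ)) N' C' ∧ C'.card + t = (C.map (wt κ)).sum + t * t + t * α := by
  classical
  have hx0 : κ x = 0 := (hx x).2 rfl
  set p : V → Bool := fun v => decide (κ v = 3) with hp
  have hNx : ∀ w, w ∈ N x ↔ κ w ≠ 0 := by
    intro w; rw [hV.mem, hG, hx0]; exact ne_comm
  have hcB : (N x).countP p = 2 * t := by
    rw [List.countP_eq_length_filter, ← List.toFinset_card_of_nodup ((hV.nodup x).filter _), ← ht]
    congr 1
    ext v
    simp only [List.mem_toFinset, List.mem_filter, hNx, hp, decide_eq_true_eq, Finset.mem_filter,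
      Finset.mem_univ, true_and]
    constructor
    · exact fun h => h.2
    · exact fun h => ⟨by rw [h]; decide, h⟩
  have hcA : (N x).countP (fun u => !p u) = α := by
    rw [List.countP_eq_length_filter, ← List.toFinset_card_of_nodup ((hV.nodup x).filter _), ← hα]
    congr 1
    ext v
    simp only [List.mem_toFinset, List.mem_filter, hNx, hp, Finset.mem_filter,
      Finset.mem_univ, true_and, Bool.not_eq_true', decide_eq_false_iff_not]
    have : ∀ i : Fin 4, (i ≠ 0 ∧ ¬ i = 3) ↔ (i = 1 ∨ i = 2) := by decide
    exact this _
  obtain ⟨L1, L2, hL, hL1⟩ := exists_split p (N x) t (by omega)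
  have hLn := hV.nodup x
  rw [hL, List.nodup_append'] at hLn
  obtain ⟨n1, n2, hdis⟩ := hLn
  have hLm : ∀ w, (w ∈ L1 ∨ w ∈ L2) ↔ κ w ≠ 0 := by
    intro w; rw [← hNx, hL, List.mem_append]
  set S : V → Bool := fun v => decide (v ∈ L1) with hS
  set φ := ph κ S with hφ
  obtain ⟨ω, hω⟩ := exists_omega φ (ph_swap κ S)
  let iN : V → V ⊕ Fin 2 := Sum.inl
  let M0 : List (V ⊕ Fin 2) := (L1.filter p).map iN ++ [.inl x] ++ (L2.filter p).map iN
  let MQ : List (V ⊕ Fin 2) := [.inr 0] ++ (L1.filter fun u => !p u).map iN ++ [.inr 1] ++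
    (L2.filter fun u => !p u).map iN
  let M1 : List (V ⊕ Fin 2) := [.inl x] ++ (L1.filter p).map iN ++ (L2.filter p).map iN
  let N' : V ⊕ Fin 2 → List (V ⊕ Fin 2) := Sum.elim
    (fun v => if v = x then MQ else (N v).flatMap (hh κ S v)) ![M0, M1]
  let gX : Multiset (Sym2 (Sym2 (V ⊕ Fin 2))) :=
    mc p (fun w => (.inr 0, iN w)) (fun w => (.inl x, iN w)) (fun w => (.inr 1, iN w)) L1 +
      mc p (fun w => (.inr 1, iN w)) (fun w => (.inl x, iN w)) (fun w => (.inr 0, iN w)) L2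
  let gB : V × List V → Multiset ((V ⊕ Fin 2) × List (V ⊕ Fin 2)) := fun b =>
    {(.inl b.1, N' (.inl b.1))} + if b.1 = x then {(.inr 0, M0)} + {(.inr 1, M1)} else 0
  let gC : V × List V → Multiset (Sym2 (Sym2 (V ⊕ Fin 2))) := fun b => if b.1 = x then gX else 0
  have hcab := Der.cable φ (ph_swap κ S) gB gC ω hω hV.der (by
    intro b hb
    rw [Multiset.mem_sum] at hb
    obtain ⟨v, -, hb⟩ := hb
    rw [Multiset.mem_singleton] at hb
    subst hb
    simp only [gB, gC]
    by_cases hvx : v = x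
    · subst hvx
      rw [if_pos rfl, if_pos rfl]
      have hg := gadget p iN (.inr 0) (.inr 1) (.inl v) L1 L2
      refine hg.cast ?_ rfl rfl ?_
      · simp only [N', Sum.elim_inl, if_pos, M0, MQ, M1]; abel
      · rw [hL, List.map_append, List.flatMap_append, List.flatMap_map, List.flatMap_map]
        have hk : ∀ w, κ w = 3 → κ w ≠ 0 := fun w h => by rw [h]; decide
        congr 1
        · refine List.flatMap_congr fun w hw => ?_
          have hw0 : κ w ≠ 0 := (hLm w).1 (Or.inl hw)
          by_cases h3 : κ w = 3
          · simp [hφ, ph, hx0, hh, hp, h3, hS, hw, rb, iN]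
          · simp [hφ, ph, hx0, hh, hp, h3, hw0, rb, iN]
        · refine List.flatMap_congr fun w hw => ?_
          have hw0 : κ w ≠ 0 := (hLm w).1 (Or.inr hw)
          have hw1 : w ∉ L1 := fun h => hdis h hw
          by_cases h3 : κ w = 3
          · simp [hφ, ph, hx0, hh, hp, h3, hS, hw1, rb, iN]
          · simp [hφ, ph, hx0, hh, hp, h3, hw0, rb, iN]
    · rw [if_neg hvx, if_neg hvx]
      have hv0 : κ v ≠ 0 := fun h => hvx ((hx v).1 h)
      have hb := Der.single (Step.birth [] [] (Sum.inl v : V ⊕ Fin 2) (N' (.inl v)))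
      refine hb.cast (by simp) rfl rfl ?_
      simp only [N', Sum.elim_inl, if_neg hvx, List.nil_append, List.append_nil, List.map_flatMap,
        List.flatMap_map]
      refine List.flatMap_congr fun w hw => ?_
      simp only [hφ, ph, if_neg hv0])
  have hsum : ∀ {W : Type _} (F : V × List V → Multiset W),
      ((∑ v, {(v, N v)} : Multiset (V × List V)).map F).sum = ∑ v, F (v, N v) := by
    intro W F
    have h1 := map_sum (Multiset.mapAddMonoidHom F) (fun v => {(v, N v)}) Finset.univ
    simp only [Multiset.coe_mapAddMonoidHom, Multiset.map_singleton] at h1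
    rw [h1]
    have h2 := map_sum (Multiset.sumAddMonoidHom (M := Multiset W)) (fun v => {F (v, N v)}) Finset.univ
    simp only [Multiset.coe_sumAddMonoidHom, Multiset.sum_singleton] at h2
    exact h2
  rw [hsum, hsum] at hcab
  have eB : ∑ v, gB (v, N v) = ∑ v, {(v, N' v)} := by
    simp only [gB]
    rw [Finset.sum_add_distrib, Fintype.sum_sum_type, Fin.sum_univ_two]
    congr 1
    rw [Finset.sum_ite_eq' Finset.univ x]
    simp [N']
  have eC : ∑ v, gC (v, N v) = gX := by
    simp only [gC]
    rw [Finset.sum_ite_eq' Finset.univ x]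
    simp
  rw [eB, eC] at hcab
  -- gadget crossings
  have hgm : ∀ (L : List V) (i j : Fin 2), i ≠ j → L.Nodup → (∀ w ∈ L, κ w ≠ 0) →
      ∀ z ∈ mc p (fun w => ((.inr i : V ⊕ Fin 2), iN w)) (fun w => (.inl x, iN w))
        (fun w => (.inr j, iN w)) L,
      (∃ w ∈ L, ∃ w' ∈ L, Sym2.map (Sym2.map (pr x)) z = s(s(x, w), s(x, w'))) ∧
      ∃ e f, z = s(e, f) ∧ e ∈ (sideG (side κ)).edgeSet ∧ f ∈ (sideG (side κ)).edgeSet ∧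
        ∀ a ∈ e, a ∉ f := by
    intro L i j hij hL hL0 z hz
    obtain ⟨w, hw, w', hw', hne, h⟩ := mem_mc p _ _ _ hL hz
    have a0 : κ w ≠ 0 := hL0 w hw
    have a0' : κ w' ≠ 0 := hL0 w' hw'
    have e0 : w ≠ x := fun h => a0 ((hx w).2 h)
    have e0' : w' ≠ x := fun h => a0' ((hx w').2 h)
    simp only [hp, decide_eq_true_eq] at h
    rcases h with ⟨h1, h2, rfl⟩ | ⟨h1, h2, rfl⟩ | ⟨h1, h2, rfl⟩
    · refine ⟨⟨w', hw', w, hw, by simp [edg, iN, pr]⟩, _, _, rfl, ?_, ?_, ?_⟩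
      · simp [edg, iN, sideG, side, h2]
      · simp [edg, iN, sideG, side, h1]
      · simp [edg, iN, hij, hne.symm]
    · refine ⟨⟨w', hw', w, hw, by simp [edg, iN, pr]⟩, _, _, rfl, ?_, ?_, ?_⟩
      · simp [edg, iN, sideG, side, h2, hx0, a0']
      · simp [edg, iN, sideG, side, h1]
      · simp [edg, iN, hne.symm, e0.symm]
    · refine ⟨⟨w', hw', w, hw, by simp [edg, iN, pr]⟩, _, _, rfl, ?_, ?_, ?_⟩
      · simp [edg, iN, sideG, side, h2]
      · simp [edg, iN, sideG, side, h1, hx0, a0]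
      · simp [edg, iN, hne.symm, e0']
  have hgn : ∀ (L : List V) (i j : Fin 2), L.Nodup → (∀ w ∈ L, κ w ≠ 0) →
      (mc p (fun w => ((.inr i : V ⊕ Fin 2), iN w)) (fun w => (.inl x, iN w))
        (fun w => (.inr j, iN w)) L).Nodup := by
    intro L i j hL hL0
    refine mc_nodup p _ _ _ hL ?_
    intro w hw w' hw' d hd d' hd' h
    have e0 : w ≠ x := fun h => hL0 w hw ((hx w).2 h)
    have e0' : w' ≠ x := fun h => hL0 w' hw' ((hx w').2 h)
    have key : ∀ (w : V) d, d ∈ [((.inr i : V ⊕ Fin 2), iN w), (.inl x, iN w), (.inr j, iN w)] →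
        Sym2.map (pr x) (edg d) = s(x, w) := by
      intro w d hd
      simp only [List.mem_cons, List.not_mem_nil, or_false] at hd
      rcases hd with rfl | rfl | rfl <;> simp [edg, pr, iN]
    have := (key w d hd).symm.trans ((congrArg _ h).trans (key w' d' hd'))
    simp at this
    tauto
  -- cable crossings
  have hin : ∀ z ∈ C, ∃ d d', z = s(edg d, edg d') ∧ G.Adj d.1 d.2 ∧ G.Adj d'.1 d'.2 ∧
      ∀ a ∈ edg d, a ∉ edg d' := by
    intro z hz
    obtain ⟨e, f, rfl, h1, h2, h3⟩ := hV.cind z hz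
    induction e using Sym2.ind with | _ a b =>
    induction f using Sym2.ind with | _ c d => exact ⟨(a, b), (c, d), rfl, h1, h2, h3⟩
  have hpe : ∀ d, ∀ d' ∈ φ d, Sym2.map (pr x) (edg d') = edg d := by
    intro d d' h
    obtain ⟨h1, h2, -⟩ := mem_ph κ S hx h
    simp [edg, h1, h2]
  have hom : ∀ z ∈ C, ∀ z' ∈ ω z, Sym2.map (Sym2.map (pr x)) z' = z ∧
      ∃ e f, z' = s(e, f) ∧ e ∈ (sideG (side κ)).edgeSet ∧ f ∈ (sideG (side κ)).edgeSet ∧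
        ∀ a ∈ e, a ∉ f := by
    intro z hz z' hz'
    obtain ⟨d, d', rfl, h1, h2, h3⟩ := hin z hz
    rw [hω, mem_X] at hz'
    obtain ⟨c, hc, c', hc', rfl⟩ := hz'
    refine ⟨by simp [hpe _ _ hc, hpe _ _ hc'], _, _, rfl, (mem_ph κ S hx hc).2.2,
      (mem_ph κ S hx hc').2.2, ?_⟩
    intro a ha ha'
    refine h3 (pr x a) ?_ ?_
    · rw [← hpe _ _ hc]; exact Sym2.mem_map.2 ⟨a, ha, rfl⟩
    · rw [← hpe _ _ hc']; exact Sym2.mem_map.2 ⟨a, ha', rfl⟩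
  have hL10 : ∀ w ∈ L1, κ w ≠ 0 := fun w h => (hLm w).1 (Or.inl h)
  have hL20 : ∀ w ∈ L2, κ w ≠ 0 := fun w h => (hLm w).1 (Or.inr h)
  have hgXm : ∀ z ∈ gX, (∃ w w', Sym2.map (Sym2.map (pr x)) z = s(s(x, w), s(x, w'))) ∧
      ∃ e f, z = s(e, f) ∧ e ∈ (sideG (side κ)).edgeSet ∧ f ∈ (sideG (side κ)).edgeSet ∧
        ∀ a ∈ e, a ∉ f := by
    intro z hz
    rcases Multiset.mem_add.1 hz with hz | hz
    · obtain ⟨⟨w, -, w', -, h1⟩, h2⟩ := hgm L1 0 1 (by decide) n1 hL10 z hz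
      exact ⟨⟨w, w', h1⟩, h2⟩
    · obtain ⟨⟨w, -, w', -, h1⟩, h2⟩ := hgm L2 1 0 (by decide) n2 hL20 z hz
      exact ⟨⟨w, w', h1⟩, h2⟩
  refine ⟨N', (C.map ω).sum + gX, ⟨hcab, ?_, ?_, ?_, ?_⟩, ?_⟩
  · -- nodup of rotations
    have iNi : Function.Injective iN := Sum.inl_injective
    have hd : ∀ q : V → Bool, ((L1.filter q).map iN).Disjoint ((L2.filter q).map iN) := by
      intro q z h1 h2
      simp only [List.mem_map, List.mem_filter] at h1 h2
      obtain ⟨a, ⟨ha, -⟩, rfl⟩ := h1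
      obtain ⟨b, ⟨hb, -⟩, h⟩ := h2
      rw [iNi h] at hb
      exact hdis ha hb
    have hnn : ∀ q : V → Bool, ((L1.filter q).map iN ++ (L2.filter q).map iN).Nodup := fun q =>
      List.nodup_append'.2 ⟨(n1.filter _).map iNi, (n2.filter _).map iNi, hd q⟩
    have hxm : (Sum.inl x : V ⊕ Fin 2) ∉ (L1.filter p).map iN ++ (L2.filter p).map iN := by
      simp [iN, hp, hx0]
    have hM1 : M1.Nodup := by
      simp only [M1, List.append_assoc, List.singleton_append]
      exact List.nodup_cons.2 ⟨hxm, hnn p⟩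
    rintro (v | i)
    · simp only [N', Sum.elim_inl]
      split_ifs with hvx
      · have : MQ.Perm (.inr 0 :: .inr 1 :: ((L1.filter fun u => !p u).map iN ++
            (L2.filter fun u => !p u).map iN)) := by
          simp only [MQ, List.append_assoc, List.singleton_append]
          exact List.Perm.cons _ List.perm_middle
        rw [this.nodup_iff]
        refine List.nodup_cons.2 ⟨by simp [iN], List.nodup_cons.2 ⟨by simp [iN], hnn _⟩⟩
      · have hv0 : κ v ≠ 0 := fun h => hvx ((hx v).1 h)
        rw [List.nodup_flatMap]
        refine ⟨fun w _ => nodup_hh κ S v w, (hV.nodup v).imp ?_⟩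
        intro a b hab z h1 h2
        exact hab ((mem_hh κ S hx hv0 h1).1.symm.trans (mem_hh κ S hx hv0 h2).1)
    · fin_cases i
      · have : M0.Perm M1 := by
          simp only [M0, M1, List.append_assoc, List.singleton_append]
          exact List.perm_middle
        exact this.nodup_iff.2 hM1
      · exact hM1
  · -- neighbours
    have hpm : ∀ w, ((w ∈ L1 ∧ κ w = 3) ∨ (w ∈ L2 ∧ κ w = 3)) ↔ κ w = 3 := by
      intro w
      rw [← or_and_right, hLm]
      exact ⟨fun h => h.2, fun h => ⟨by rw [h]; decide, h⟩⟩
    have hqm : ∀ w, ((w ∈ L1 ∧ ¬ κ w = 3) ∨ (w ∈ L2 ∧ ¬ κ w = 3)) ↔ ¬ (κ w = 0 ∨ κ w = 3) := by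
      intro w
      rw [← or_and_right, hLm]
      tauto
    rintro (v | i) w
    · simp only [N', Sum.elim_inl]
      split_ifs with hvx
      · subst hvx
        rcases w with w | j
        · have := hqm w
          simp [MQ, iN, sideG, side, hx0, hp]
          tauto
        · fin_cases j <;> simp [MQ, iN, sideG, side, hx0]
      · have hv0 : κ v ≠ 0 := fun h => hvx ((hx v).1 h)
        have := mem_hh_iff κ S hx hv0 (w := w)
        rw [List.mem_flatMap]
        simp only [hV.mem, hG]
        exact this
    · have : w ∈ M1 ↔ (sideG (side κ)).Adj (.inr i) w := by
        rcases w with w | j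
        · have := hpm w
          have := hx w
          simp [M1, iN, sideG, side, hp]
          tauto
        · simp [M1, iN, sideG, side]
      rw [← this]
      fin_cases i
      · change w ∈ M0 ↔ w ∈ M1
        simp only [M0, M1, List.mem_append]
        exact or_assoc.trans (or_left_comm.trans or_assoc.symm)
      · rfl
  · -- nodup of crossings
    rw [Multiset.nodup_add]
    refine ⟨?_, ?_, ?_⟩
    · have : (C.map ω).sum = C.bind ω := rfl
      rw [this, Multiset.nodup_bind]
      constructor
      · intro z hz
        obtain ⟨d, d', rfl, h1, h2, h3⟩ := hin z hz
        rw [hω]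
        refine X_nodup (nodup_ph κ S d) (nodup_ph κ S d') ?_
        intro c hc c' hc' h
        have := congrArg (Sym2.map (pr x)) h
        rw [hpe _ _ hc, hpe _ _ hc'] at this
        exact h3 d.1 (by simp [edg]) (by rw [← this]; simp [edg])
      · refine Multiset.Nodup.pairwise ?_ hV.cnodup
        intro z hz z' hz' hne
        refine Multiset.disjoint_left.2 fun {c} hc hc' => hne ?_
        exact (hom z hz c hc).1.symm.trans (hom z' hz' c hc').1
    · rw [Multiset.nodup_add]
      refine ⟨hgn L1 0 1 n1 hL10, hgn L2 1 0 n2 hL20, ?_⟩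
      rw [Multiset.disjoint_left]
      intro z h1 h2
      obtain ⟨⟨w, hw, w', hw', e1⟩, -⟩ := hgm L1 0 1 (by decide) n1 hL10 z h1
      obtain ⟨⟨u, hu, u', hu', e2⟩, -⟩ := hgm L2 1 0 (by decide) n2 hL20 z h2
      rw [e1] at e2
      have k1 : w ≠ x := fun h => hL10 w hw ((hx w).2 h)
      have k2 : w' ≠ x := fun h => hL10 w' hw' ((hx w').2 h)
      simp at e2
      rcases e2 with ⟨e2, -⟩ | ⟨e2, -⟩
      · rcases e2 with e2 | e2
        · exact hdis hw (e2 ▸ hu)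
        · exact k1 e2.2
      · rcases e2 with e2 | e2
        · exact hdis hw (e2 ▸ hu')
        · exact k1 e2.2
    · rw [Multiset.disjoint_left]
      intro z h1 h2
      obtain ⟨⟨w, w', e1⟩, -⟩ := hgXm z h2
      obtain ⟨c, hc, h3⟩ := Multiset.mem_bind.1 (h1 : z ∈ C.bind ω)
      rw [(hom c hc z h3).1] at e1
      obtain ⟨d, d', e2, -, -, e3⟩ := hin c hc
      rw [e2, Sym2.eq_iff] at e1
      rcases e1 with ⟨e4, e5⟩ | ⟨e4, e5⟩
      · exact e3 x (by rw [e4]; simp) (by rw [e5]; simp)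
      · exact e3 x (by rw [e4]; simp) (by rw [e5]; simp)
  · intro z hz
    rcases Multiset.mem_add.1 hz with hz | hz
    · obtain ⟨c, hc, h3⟩ := Multiset.mem_bind.1 (hz : z ∈ C.bind ω)
      exact (hom c hc z h3).2
    · exact (hgXm z hz).2
  · have c1 := card_mc p (fun w => ((.inr 0 : V ⊕ Fin 2), iN w)) (fun w => (.inl x, iN w))
      (fun w => (.inr 1, iN w)) L1
    have c2 := card_mc p (fun w => ((.inr 1 : V ⊕ Fin 2), iN w)) (fun w => (.inl x, iN w))
      (fun w => (.inr 0, iN w)) L2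
    have hL2 : L2.countP p = t := by
      rw [hL, List.countP_append, hL1] at hcB; omega
    rw [hL, List.countP_append] at hcA
    rw [hL1] at c1
    rw [hL2] at c2
    have hw : ((C.map ω).sum).card = (C.map (wt κ)).sum := by
      have : ((C.map ω).sum).card = (C.map (fun z => (ω z).card)).sum := by
        have h2 := map_multiset_sum (Multiset.cardHom (α := Sym2 (Sym2 (V ⊕ Fin 2)))) (C.map ω)
        rw [Multiset.map_map] at h2
        exact h2
      rw [this]
      congr 1
      refine Multiset.map_congr rfl fun z hz => ?_
      obtain ⟨d, d', rfl, -⟩ := hin z hz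
      rw [hω, card_X, length_ph, length_ph]
      rfl
    rw [Multiset.card_add, hw]
    simp only [gX, Multiset.card_add]
    rw [← hcA]
    nlinarith

end CN

namespace CN

lemma sideIso {U : Type*} [Fintype U] (σ : U → Bool) (a b : ℕ)
    (ha : (Finset.univ.filter fun u => σ u = false).card = a)
    (hb : (Finset.univ.filter fun u => ¬ σ u = false).card = b) : Nonempty (sideG σ ≃g bipK a b) := by
  classical
  have ea : {u // σ u = false} ≃ Fin a :=
    Fintype.equivFinOfCardEq (by rw [Fintype.card_subtype, ha])
  have eb : {u // ¬ σ u = false} ≃ Fin b :=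
    Fintype.equivFinOfCardEq (by rw [Fintype.card_subtype, hb])
  let e : Fin a ⊕ Fin b ≃ U := (Equiv.sumCongr ea.symm eb.symm).trans (Equiv.sumCompl fun u => σ u = false)
  have h1 : ∀ i, σ (e (.inl i)) = false := fun i => (ea.symm i).2
  have h2 : ∀ i, σ (e (.inr i)) = true := fun i => Bool.eq_true_of_not_eq_false (eb.symm i).2
  refine ⟨RelIso.symm ⟨e, ?_⟩⟩
  rintro (i | i) (j | j) <;> simp [sideG, h1, h2]

theorem lower1 [Fintype V] {G : SimpleGraph V} (κ : V → Fin 4)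
    (hG : ∀ u v, G.Adj u v ↔ κ u ≠ κ v) (x y : V) (hx : ∀ v, κ v = 0 ↔ v = x)
    (hy : ∀ v, κ v = 1 ↔ v = y) (s t : ℕ)
    (hs : (Finset.univ.filter fun v => κ v = 2).card = 2 * s)
    (ht : (Finset.univ.filter fun v => κ v = 3).card = 2 * t)
    (hZ : crossingNumber (bipK (2 * s + 3) (2 * t + 1)) = Z (2 * s + 3) (2 * t + 1))
    {N C} (hV : Valid G N C) :
    (s + 1) * (s + 1) * t * t ≤ (C.map (wt κ)).sum + t * t + 2 * s * t := by
  classical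
  have hα : (Finset.univ.filter fun v => κ v = 1 ∨ κ v = 2).card = 2 * s + 1 := by
    have : (Finset.univ.filter fun v => κ v = 1 ∨ κ v = 2) =
        insert y (Finset.univ.filter fun v => κ v = 2) := by
      ext v; simp [hy]
    rw [this, Finset.card_insert_of_notMem, hs]
    have := (hy y).2 rfl
    simp [this]
  obtain ⟨N', C', hV', hc⟩ := cable_valid κ hG x hx (2 * s + 1) t hα ht hV
  have hx0 : κ x = 0 := (hx x).2 rfl
  have e1 : (Finset.univ.filter fun u => side κ u = false).card = 2 * s + 3 := by
    rw [Finset.card_filter, Fintype.sum_sum_type, ← Finset.card_filter, ← Finset.card_filter]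
    have h1 : (Finset.univ.filter fun v => side κ (.inl v) = false) =
        (Finset.univ.filter fun v => κ v = 1 ∨ κ v = 2) := by
      ext v
      have : ∀ i : Fin 4, ¬ (i = 0 ∨ i = 3) ↔ (i = 1 ∨ i = 2) := by decide
      simpa [side] using this (κ v)
    rw [h1, hα]
    simp [side]
  have e2 : (Finset.univ.filter fun u => ¬ side κ u = false).card = 2 * t + 1 := by
    rw [Finset.card_filter, Fintype.sum_sum_type, ← Finset.card_filter, ← Finset.card_filter]
    have h1 : (Finset.univ.filter fun v => ¬ side κ (.inl v) = false) =
        insert x (Finset.univ.filter fun v => κ v = 3) := by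
      ext v
      simp [side, hx]
      tauto
    rw [h1, Finset.card_insert_of_notMem (by simp [hx0]), ht]
    simp [side]
  obtain ⟨e⟩ := sideIso (side κ) _ _ e1 e2
  obtain ⟨D, hD, hD'⟩ := claimB (hV'.map e)
  have h1 : crossingNumber (bipK (2 * s + 3) (2 * t + 1)) ≤ D.crNum := Nat.sInf_le ⟨D, hD, rfl⟩
  rw [hZ] at h1
  rw [Multiset.card_map] at hD'
  have hz : Z (2 * s + 3) (2 * t + 1) = (s + 1) * (s + 1) * t * t := by
    rw [Z]
    congr 1
    · congr 1
      · congr 1 <;> omega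
      · omega
    · omega
  rw [hz] at h1
  nlinarith

lemma wt_sum (i j k l : Fin 4) (h1 : i ≠ j) (h2 : k ≠ l)
    (h : ∀ c : Fin 4, c = 0 ∨ c = 1 → c = i ∨ c = j → c = k ∨ c = l → False) :
    Wd i j * Wd k l + Wd (Equiv.swap 0 1 i) (Equiv.swap 0 1 j) * Wd (Equiv.swap 0 1 k) (Equiv.swap 0 1 l)
    + Wd (Equiv.swap 2 3 i) (Equiv.swap 2 3 j) * Wd (Equiv.swap 2 3 k) (Equiv.swap 2 3 l)
    + Wd (Equiv.swap 2 3 (Equiv.swap 0 1 i)) (Equiv.swap 2 3 (Equiv.swap 0 1 j)) *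
      Wd (Equiv.swap 2 3 (Equiv.swap 0 1 k)) (Equiv.swap 2 3 (Equiv.swap 0 1 l)) ≤ 4 := by
  revert i j k l
  decide

theorem lower [Fintype V] {G : SimpleGraph V} (κ : V → Fin 4)
    (hG : ∀ u v, G.Adj u v ↔ κ u ≠ κ v) (x y : V) (hx : ∀ v, κ v = 0 ↔ v = x)
    (hy : ∀ v, κ v = 1 ↔ v = y) (s t : ℕ)
    (hs : (Finset.univ.filter fun v => κ v = 2).card = 2 * s)
    (ht : (Finset.univ.filter fun v => κ v = 3).card = 2 * t)
    (hZ : ∀ a b, 1 ≤ a → 1 ≤ b → crossingNumber (bipK a b) = Z a b)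
    {N C} (hV : Valid G N C) :
    s * t * (s * t + s + t) ≤ C.card + 2 * s * t := by
  classical
  have v1 := lower1 κ hG x y hx hy s t hs ht (hZ _ _ (by omega) (by omega)) hV
  have s01 : ∀ i : Fin 4, (Equiv.swap 0 1 i = 0 ↔ i = 1) ∧ (Equiv.swap 0 1 i = 1 ↔ i = 0) ∧
    (Equiv.swap 0 1 i = 2 ↔ i = 2) ∧ (Equiv.swap 0 1 i = 3 ↔ i = 3) := by decide
  have s23 : ∀ i : Fin 4, (Equiv.swap 2 3 i = 0 ↔ i = 0) ∧ (Equiv.swap 2 3 i = 1 ↔ i = 1) ∧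
    (Equiv.swap 2 3 i = 2 ↔ i = 3) ∧ (Equiv.swap 2 3 i = 3 ↔ i = 2) := by decide
  have v2 := lower1 (fun v => Equiv.swap 0 1 (κ v)) (by simpa using hG) y x
    (by simpa [s01] using hy) (by simpa [s01] using hx) s t (by simpa [s01] using hs)
    (by simpa [s01] using ht) (hZ _ _ (by omega) (by omega)) hV
  have v3 := lower1 (fun v => Equiv.swap 2 3 (κ v)) (by simpa using hG) x y
    (by simpa [s23] using hx) (by simpa [s23] using hy) t s (by simpa [s23] using ht)
    (by simpa [s23] using hs) (hZ _ _ (by omega) (by omega)) hV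
  have v4 := lower1 (fun v => Equiv.swap 2 3 (Equiv.swap 0 1 (κ v))) (by simpa using hG) y x
    (by simpa [s23, s01] using hy) (by simpa [s23, s01] using hx) t s (by simpa [s23, s01] using ht)
    (by simpa [s23, s01] using hs) (hZ _ _ (by omega) (by omega)) hV
  have key : (C.map fun z => wt κ z + wt (fun v => Equiv.swap 0 1 (κ v)) z +
      wt (fun v => Equiv.swap 2 3 (κ v)) z + wt (fun v => Equiv.swap 2 3 (Equiv.swap 0 1 (κ v))) z).sum
      ≤ C.card • 4 := by
    rw [← Multiset.card_map (fun z => wt κ z + wt (fun v => Equiv.swap 0 1 (κ v)) z +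
      wt (fun v => Equiv.swap 2 3 (κ v)) z + wt (fun v => Equiv.swap 2 3 (Equiv.swap 0 1 (κ v))) z) C]
    refine Multiset.sum_le_card_nsmul _ _ ?_
    intro n hn
    rw [Multiset.mem_map] at hn
    obtain ⟨z, hz, rfl⟩ := hn
    obtain ⟨e, f, rfl, h1, h2, h3⟩ := hV.cind z hz
    induction e using Sym2.ind with | _ a b =>
    induction f using Sym2.ind with | _ c d =>
    have h1' := (hG a b).1 h1
    have h2' := (hG c d).1 h2
    refine wt_sum (κ a) (κ b) (κ c) (κ d) h1' h2' ?_
    have inj : ∀ i : Fin 4, i = 0 ∨ i = 1 → ∃ w, ∀ v, i = κ v → v = w := by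
      rintro i (rfl | rfl)
      · exact ⟨x, fun v hv => (hx v).1 hv.symm⟩
      · exact ⟨y, fun v hv => (hy v).1 hv.symm⟩
    intro i hi hab hcd
    obtain ⟨w, hw⟩ := inj i hi
    have e1 : w ∈ s(a, b) := by
      rw [Sym2.mem_iff]
      exact hab.imp (fun h => (hw _ h).symm) (fun h => (hw _ h).symm)
    have e2 : w ∈ s(c, d) := by
      rw [Sym2.mem_iff]
      exact hcd.imp (fun h => (hw _ h).symm) (fun h => (hw _ h).symm)
    exact h3 w e1 e2
  rw [Multiset.sum_map_add, Multiset.sum_map_add, Multiset.sum_map_add] at key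
  simp only [smul_eq_mul] at key
  nlinarith

end CN

namespace CN

/-- crossings of the first block -/
def cA (x y : V) (Lb Rb : List V) : List V → Multiset (Sym2 (Sym2 V))
  | [] => 0
  | a :: As => X [(x, a)] (As.reverse.flatMap fun a' => Lb.map (Prod.mk a')) +
      X (Rb.map (Prod.mk a)) (As.map fun a' => (a', y)) + cA x y Lb Rb As

lemma blockA (x y : V) (Lb Rb : List V) (N : V → List V) (As : List V)
    (hN : ∀ a ∈ As, N a = x :: Lb ++ y :: Rb) :
    Der ((As.map fun a => (a, N a) : List _) : Multiset _) (cA x y Lb Rb As) (As.map (Prod.mk x))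
      ((As.reverse.flatMap fun a => Lb.map (Prod.mk a)) ++ (As.map fun a => (a, y)) ++
        As.flatMap fun a => Rb.map (Prod.mk a)) := by
  induction As with
  | nil => exact Der.refl _
  | cons a As ih =>
    have ih' := (ih fun a' h => hN a' (by simp [h])).ctx [(x, a)] []
    set Ls := As.reverse.flatMap fun a => Lb.map (Prod.mk a)
    set Ys := As.map fun a => (a, y)
    set Rs := As.flatMap fun a => Rb.map (Prod.mk a)
    have h1 := (move [(x, a)] Ls).ctx [] (Ys ++ Rs)
    have h2 := Der.single (Step.birth (Ls ++ [(x, a)]) (Ys ++ Rs) a (N a))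
    rw [hN a (by simp)] at h2
    have h3 := Der.single (Step.cap Ls (Lb.map (Prod.mk a) ++ [(a, y)] ++ Rb.map (Prod.mk a) ++ Ys ++ Rs) (x, a))
    have h4 := (move (Rb.map (Prod.mk a)) Ys).ctx (Ls ++ Lb.map (Prod.mk a) ++ [(a, y)]) Rs
    have h5 := (((ih'.trans (h1.cast rfl rfl (by simp) rfl)).trans (h2.cast rfl rfl (by simp) rfl)).trans
      (h3.cast rfl rfl (by simp) rfl)).trans (h4.cast rfl rfl (by simp) rfl)
    refine h5.cast ?_ ?_ ?_ ?_
    · simp only [List.map_cons, ← Multiset.cons_coe, ← Multiset.singleton_add, hN a (List.mem_cons_self)]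
      simp only [add_zero]
      rw [add_comm]
    · simp only [cA, add_zero]
      abel
    · simp
    · simp [Ls, Ys, Rs]

/-- crossings of sorting one row -/
def rc (a : V) (As : List V) : List V → Multiset (Sym2 (Sym2 V))
  | [] => 0
  | b :: Bs => X (Bs.map (Prod.mk a)) (As.map fun a' => (a', b)) + rc a As Bs

lemma rowsort (a : V) (As Bs : List V) :
    Der 0 (rc a As Bs) (Bs.map (Prod.mk a) ++ Bs.flatMap fun b => As.map fun a' => (a', b))
      (Bs.flatMap fun b => (a :: As).map fun a' => (a', b)) := by
  induction Bs with
  | nil => exact Der.refl _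
  | cons b Bs ih =>
    have h1 := (move (Bs.map (Prod.mk a)) (As.map fun a' => (a', b))).ctx [(a, b)]
      (Bs.flatMap fun b => As.map fun a' => (a', b))
    have h2 := ih.ctx ([(a, b)] ++ As.map fun a' => (a', b)) []
    refine (h1.trans (h2.cast rfl rfl ?_ rfl)).cast ?_ ?_ ?_ ?_
    · simp
    · simp
    · simp [rc]
    · simp
    · simp

/-- crossings of sorting -/
def sc (Bs : List V) : List V → Multiset (Sym2 (Sym2 V))
  | [] => 0
  | a :: As => rc a As Bs + sc Bs As

lemma sort (As Bs : List V) :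
    Der 0 (sc Bs As) (As.flatMap fun a => Bs.map (Prod.mk a))
      (Bs.flatMap fun b => As.map fun a' => (a', b)) := by
  induction As with
  | nil =>
    have : (Bs.flatMap fun b => ([] : List V).map fun a' => (a', b)) = [] := by simp
    rw [this]
    exact Der.refl _
  | cons a As ih =>
    have h1 := ih.ctx (Bs.map (Prod.mk a)) []
    refine (h1.trans ((rowsort a As Bs).cast rfl rfl ?_ rfl)).cast ?_ ?_ ?_ rfl
    · simp
    · simp
    · simp [sc, add_comm]
    · simp

/-- crossings of the second block -/
def cB (x y : V) (GA HA : List V) : List V → Multiset (Sym2 (Sym2 V))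
  | [] => 0
  | b :: Bs => X (Bs.flatMap fun b' => GA.map fun a => (a, b')) [(x, b)] +
      X (Bs.map fun b' => (b', y)) (HA.map fun a => (a, b)) + cB x y GA HA Bs

lemma absorb (w : List (V × V)) (b y : V) (N : List V)
    (hN : N.map (Prod.mk b) = rb w ++ [(b, y)]) : Der {(b, N)} 0 w [(b, y)] := by
  have h1 := Der.single (Step.birth w [] b N)
  rw [hN] at h1
  have h2 := (caps w).ctx [] [(b, y)]
  refine ((h1.cast rfl rfl (by simp) rfl).trans0 (h2.cast rfl rfl (by simp) (by simp)))

lemma blockB (x y : V) (GA HA : List V) (N : V → List V) (Bs : List V)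
    (hN : ∀ b ∈ Bs, N b = HA.reverse ++ x :: GA.reverse ++ [y]) :
    Der ((Bs.map fun b => (b, N b) : List _) : Multiset _) (cB x y GA HA Bs)
      ((Bs.flatMap fun b => GA.map fun a => (a, b)) ++ Bs.map (Prod.mk x) ++
        (Bs.reverse.flatMap fun b => HA.map fun a => (a, b)))
      (Bs.map fun b => (b, y)) := by
  induction Bs with
  | nil => exact Der.refl _
  | cons b Bs ih =>
    have ih' := (ih fun a' h => hN a' (by simp [h])).ctx ((GA.map fun a => (a, b)) ++ [(x, b)])
      (HA.map fun a => (a, b))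
    set Gs := Bs.flatMap fun b => GA.map fun a => (a, b)
    set Hs := Bs.reverse.flatMap fun b => HA.map fun a => (a, b)
    set Ys := Bs.map fun b => (b, y)
    have h1 := (move Gs [(x, b)]).ctx (GA.map fun a => (a, b)) (Bs.map (Prod.mk x) ++ Hs ++ HA.map fun a => (a, b))
    have h2 := (move Ys (HA.map fun a => (a, b))).ctx ((GA.map fun a => (a, b)) ++ [(x, b)]) []
    have h3 := (absorb ((GA.map fun a => (a, b)) ++ [(x, b)] ++ HA.map fun a => (a, b)) b y (N b)
      (by rw [hN b (by simp)]; simp [rb, Function.comp_def])).ctx [] Ys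
    have h5 := ((h1.trans (ih'.cast rfl rfl (by simp) rfl)).trans (h2.cast rfl rfl (by simp) rfl)).trans
      (h3.cast rfl rfl (by simp) rfl)
    refine h5.cast ?_ ?_ ?_ ?_
    · simp only [List.map_cons, ← Multiset.cons_coe, ← Multiset.singleton_add]
      simp only [add_zero, zero_add]
      rw [add_comm]
    · simp only [cB, add_zero]
      abel
    · simp [Gs, Hs]
    · simp [Ys]

lemma card_cA (x y : V) (Lb Rb As : List V) (t) (hL : Lb.length = t) (hR : Rb.length = t) :
    (cA x y Lb Rb As).card + t * As.length = t * As.length * As.length := by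
  induction As with
  | nil => simp [cA]
  | cons a As ih =>
    simp [cA, List.length_flatMap, hL, hR]
    nlinarith

lemma card_rc (a : V) (As Bs : List V) :
    2 * (rc a As Bs).card + As.length * Bs.length = As.length * (Bs.length * Bs.length) := by
  induction Bs with
  | nil => simp [rc]
  | cons b Bs ih =>
    simp [rc]
    nlinarith

lemma card_sc (As Bs : List V) :
    4 * (sc Bs As).card + As.length * Bs.length * (As.length + Bs.length) =
      As.length * As.length * (Bs.length * Bs.length) + As.length * Bs.length := by
  induction As with
  | nil => simp [sc]
  | cons a As ih =>
    have := card_rc a As Bs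
    simp only [sc, Multiset.card_add, List.length_cons]
    nlinarith

lemma card_cB (x y : V) (GA HA Bs : List V) (t) (hL : GA.length = t) (hR : HA.length = t) :
    (cB x y GA HA Bs).card + t * Bs.length = t * Bs.length * Bs.length := by
  induction Bs with
  | nil => simp [cB]
  | cons a As ih =>
    simp [cB, List.length_flatMap, hL, hR]
    nlinarith

end CN

namespace CN

/-- a vertex occurs in a crossing -/
def Occ (v : V) (z : Sym2 (Sym2 V)) : Prop := ∃ e ∈ z, v ∈ e

lemma mem_cA {x y : V} {Lb Rb As : List V} (hAs : As.Nodup) {z} (hz : z ∈ cA x y Lb Rb As) :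
    ∃ a ∈ As, ∃ a' ∈ As, a ≠ a' ∧ ((∃ b ∈ Lb, z = s(s(x, a), s(a', b))) ∨
      (∃ b ∈ Rb, z = s(s(a, b), s(a', y)))) := by
  induction As with
  | nil => simp [cA] at hz
  | cons a As ih =>
    rw [List.nodup_cons] at hAs
    simp only [cA, Multiset.mem_add, mem_X] at hz
    rcases hz with (⟨d, hd, d', hd', rfl⟩ | ⟨d, hd, d', hd', rfl⟩) | hz
    · simp only [List.mem_singleton, List.mem_flatMap, List.mem_reverse, List.mem_map] at hd hd'
      obtain ⟨a', ha', b, hb, rfl⟩ := hd'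
      subst hd
      exact ⟨a, by simp, a', by simp [ha'], fun h => hAs.1 (h ▸ ha'), Or.inl ⟨b, hb, rfl⟩⟩
    · simp only [List.mem_map] at hd hd'
      obtain ⟨a', ha', rfl⟩ := hd'
      obtain ⟨b, hb, rfl⟩ := hd
      exact ⟨a, by simp, a', by simp [ha'], fun h => hAs.1 (h ▸ ha'), Or.inr ⟨b, hb, rfl⟩⟩
    · obtain ⟨a, ha, b, hb, h⟩ := ih hAs.2 hz
      exact ⟨a, by simp [ha], b, by simp [hb], h⟩

lemma mem_rc {a : V} {As Bs : List V} (hBs : Bs.Nodup) {z} (hz : z ∈ rc a As Bs) :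
    ∃ a' ∈ As, ∃ b ∈ Bs, ∃ b' ∈ Bs, b ≠ b' ∧ z = s(s(a, b), s(a', b')) := by
  induction Bs with
  | nil => simp [rc] at hz
  | cons b Bs ih =>
    rw [List.nodup_cons] at hBs
    simp only [rc, Multiset.mem_add, mem_X] at hz
    rcases hz with ⟨d, hd, d', hd', rfl⟩ | hz
    · simp only [List.mem_map] at hd hd'
      obtain ⟨a', ha', rfl⟩ := hd'
      obtain ⟨b', hb', rfl⟩ := hd
      exact ⟨a', ha', b', by simp [hb'], b, by simp, fun h => hBs.1 (h ▸ hb'), rfl⟩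
    · obtain ⟨a', ha, b, hb, b', hb', h⟩ := ih hBs.2 hz
      exact ⟨a', ha, b, by simp [hb], b', by simp [hb'], h⟩

lemma mem_sc {As Bs : List V} (hAs : As.Nodup) (hBs : Bs.Nodup) {z} (hz : z ∈ sc Bs As) :
    ∃ a ∈ As, ∃ a' ∈ As, a ≠ a' ∧ ∃ b ∈ Bs, ∃ b' ∈ Bs, b ≠ b' ∧ z = s(s(a, b), s(a', b')) := by
  induction As with
  | nil => simp [sc] at hz
  | cons a As ih =>
    rw [List.nodup_cons] at hAs
    rw [sc, Multiset.mem_add] at hz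
    rcases hz with hz | hz
    · obtain ⟨a', ha', h⟩ := mem_rc hBs hz
      exact ⟨a, by simp, a', by simp [ha'], fun h => hAs.1 (h ▸ ha'), h⟩
    · obtain ⟨a, ha, b, hb, h⟩ := ih hAs.2 hz
      exact ⟨a, by simp [ha], b, by simp [hb], h⟩

lemma mem_cB {x y : V} {GA HA Bs : List V} (hBs : Bs.Nodup) {z} (hz : z ∈ cB x y GA HA Bs) :
    ∃ b ∈ Bs, ∃ b' ∈ Bs, b ≠ b' ∧ ((∃ a ∈ GA, z = s(s(a, b'), s(x, b))) ∨
      (∃ a ∈ HA, z = s(s(b', y), s(a, b)))) := by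
  induction Bs with
  | nil => simp [cB] at hz
  | cons b Bs ih =>
    rw [List.nodup_cons] at hBs
    simp only [cB, Multiset.mem_add, mem_X] at hz
    rcases hz with (⟨d, hd, d', hd', rfl⟩ | ⟨d, hd, d', hd', rfl⟩) | hz
    · simp only [List.mem_singleton, List.mem_flatMap, List.mem_map] at hd hd'
      obtain ⟨b', hb', a, ha, rfl⟩ := hd
      subst hd'
      exact ⟨b, by simp, b', by simp [hb'], fun h => hBs.1 (h ▸ hb'), Or.inl ⟨a, ha, rfl⟩⟩
    · simp only [List.mem_map] at hd hd'
      obtain ⟨b', hb', rfl⟩ := hd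
      obtain ⟨a, ha, rfl⟩ := hd'
      exact ⟨b, by simp, b', by simp [hb'], fun h => hBs.1 (h ▸ hb'), Or.inr ⟨a, ha, rfl⟩⟩
    · obtain ⟨a, ha, b, hb, h⟩ := ih hBs.2 hz
      exact ⟨a, by simp [ha], b, by simp [hb], h⟩

lemma X_nodup' {K : Type*} (κ : V → K) (i j k l : K) (hij : i ≠ j) (hkl : k ≠ l) {u v : List (V × V)}
    (hu : u.Nodup) (hv : v.Nodup) (hu' : ∀ d ∈ u, κ d.1 = i ∧ κ d.2 = j)
    (hv' : ∀ d ∈ v, κ d.1 = k ∧ κ d.2 = l)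
    (huv : ∀ d ∈ u, ∀ d' ∈ v, edg d ≠ edg d') : (X u v).Nodup := by
  have key : ∀ (i j : K) (w : List (V × V)), i ≠ j → w.Nodup →
      (∀ d ∈ w, κ d.1 = i ∧ κ d.2 = j) → (w.map edg).Nodup := by
    intro i j w hij hw h
    refine List.Nodup.map_on ?_ hw
    intro d hd d' hd' he
    rcases edg_eq he with h1 | h1
    · exact h1
    · have h2 := h d hd
      rw [h1] at h2
      exact absurd ((h d' hd').1.symm.trans h2.2) hij
  exact X_nodup (key i j u hij hu hu') (key k l v hkl hv hv') huv

lemma nodup_row (a : V) {Bs : List V} (h : Bs.Nodup) : (Bs.map (Prod.mk a)).Nodup :=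
  h.map fun _ _ h => (Prod.mk.inj h).2

lemma nodup_col (b : V) {As : List V} (h : As.Nodup) : (As.map fun a => (a, b)).Nodup :=
  h.map fun _ _ h => (Prod.mk.inj h).1

lemma nodup_rows {As Bs : List V} (ha : As.Nodup) (hb : Bs.Nodup) :
    (As.flatMap fun a => Bs.map (Prod.mk a)).Nodup := ha.product hb

lemma nodup_cols {As Bs : List V} (ha : As.Nodup) (hb : Bs.Nodup) :
    (Bs.flatMap fun b => As.map fun a => (a, b)).Nodup := by
  have := (hb.product ha).map Prod.swap_injective
  simpa [List.product, SProd.sprod, List.map_flatMap, Function.comp_def] using this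

lemma occ_iff (v : V) (a b c d : V) : Occ v s(s(a, b), s(c, d)) ↔ v = a ∨ v = b ∨ v = c ∨ v = d := by
  simp [Occ, or_assoc]

lemma disj_occ (v : V) {C C' : Multiset (Sym2 (Sym2 V))} (h : ∀ z ∈ C, Occ v z)
    (h' : ∀ z ∈ C', ¬ Occ v z) : Disjoint C C' := by
  rw [Multiset.disjoint_left]
  exact fun {z} hz hz' => h' z hz' (h z hz)

lemma disj_tag {K : Type*} (κ : V → K) {C C' : Multiset (Sym2 (Sym2 V))} (T T' : List (Sym2 (Sym2 K)))
    (h : ∀ z ∈ C, Sym2.map (Sym2.map κ) z ∈ T)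
    (h' : ∀ z ∈ C', Sym2.map (Sym2.map κ) z ∈ T') (hT : ∀ t ∈ T, t ∉ T') : Disjoint C C' := by
  rw [Multiset.disjoint_left]
  exact fun {z} hz hz' => hT _ (h z hz) (h' z hz')

lemma cA_nodup (κ : V → Fin 4) {x y : V} (hx : κ x = 0) (hy : κ y = 1) {Lb Rb As : List V}
    (hAs : As.Nodup) (hLb : Lb.Nodup) (hRb : Rb.Nodup) (kA : ∀ a ∈ As, κ a = 2)
    (kL : ∀ b ∈ Lb, κ b = 3) (kR : ∀ b ∈ Rb, κ b = 3) : (cA x y Lb Rb As).Nodup := by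
  induction As with
  | nil => simp [cA]
  | cons a As ih =>
    have hAs' := List.nodup_cons.1 hAs
    have ka := kA a (by simp)
    have kA' : ∀ a ∈ As, κ a = 2 := fun a h => kA a (by simp [h])
    rw [cA, Multiset.nodup_add, Multiset.nodup_add]
    refine ⟨⟨?_, ?_, ?_⟩, ih hAs'.2 kA', ?_⟩
    · refine X_nodup' κ 0 2 2 3 (by decide) (by decide) (by simp)
        (nodup_rows (List.nodup_reverse.2 hAs'.2) hLb) (by simp [hx, ka]) ?_ ?_
      · intro d hd
        simp only [List.mem_flatMap, List.mem_reverse, List.mem_map] at hd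
        obtain ⟨a', ha', b, hb, rfl⟩ := hd
        exact ⟨kA' _ ha', kL _ hb⟩
      · intro d hd d' hd' he
        simp only [List.mem_singleton, List.mem_flatMap, List.mem_reverse, List.mem_map] at hd hd'
        obtain ⟨a', ha', b, hb, rfl⟩ := hd'
        subst hd
        have := kA' _ ha'
        have := kL _ hb
        rcases edg_eq he with h | h <;> simp at h <;> grind
    · refine X_nodup' κ 2 3 2 1 (by decide) (by decide) (nodup_row _ hRb) (nodup_col _ hAs'.2) ?_ ?_ ?_
      · intro d hd
        simp only [List.mem_map] at hd
        obtain ⟨b, hb, rfl⟩ := hd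
        exact ⟨ka, kR _ hb⟩
      · intro d hd
        simp only [List.mem_map] at hd
        obtain ⟨b, hb, rfl⟩ := hd
        exact ⟨kA' _ hb, hy⟩
      · intro d hd d' hd' he
        simp only [List.mem_map] at hd hd'
        obtain ⟨b, hb, rfl⟩ := hd
        obtain ⟨a', ha', rfl⟩ := hd'
        have := kA' _ ha'
        have := kR _ hb
        rcases edg_eq he with h | h <;> simp at h <;> grind
    · refine disj_tag κ [s(s(0, 2), s(2, 3))] [s(s(2, 3), s(2, 1))] ?_ ?_ (by decide)
      · intro z hz
        rw [mem_X] at hz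
        obtain ⟨d, hd, d', hd', rfl⟩ := hz
        simp only [List.mem_singleton, List.mem_flatMap, List.mem_reverse, List.mem_map] at hd hd'
        obtain ⟨a', ha', b, hb, rfl⟩ := hd'
        subst hd
        simp [edg, hx, ka, kA' _ ha', kL _ hb]
      · intro z hz
        rw [mem_X] at hz
        obtain ⟨d, hd, d', hd', rfl⟩ := hz
        simp only [List.mem_map] at hd hd'
        obtain ⟨b, hb, rfl⟩ := hd
        obtain ⟨a', ha', rfl⟩ := hd'
        simp [edg, hy, ka, kA' _ ha', kR _ hb]
    · refine disj_occ a ?_ ?_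
      · intro z hz
        rw [Multiset.mem_add, mem_X, mem_X] at hz
        rcases hz with ⟨d, hd, d', hd', rfl⟩ | ⟨d, hd, d', hd', rfl⟩
        · simp only [List.mem_singleton] at hd
          subst hd
          exact ⟨edg (x, a), by simp, by simp [edg]⟩
        · simp only [List.mem_map] at hd
          obtain ⟨b, hb, rfl⟩ := hd
          exact ⟨edg (a, b), by simp, by simp [edg]⟩
      · intro z hz
        obtain ⟨a1, h1, a2, h2, -, ⟨b, hb, rfl⟩ | ⟨b, hb, rfl⟩⟩ := mem_cA hAs'.2 hz <;>
        · rw [occ_iff]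
          have := kA' _ h1
          have := kA' _ h2
          first | have := kL _ hb | have := kR _ hb
          grind

lemma rc_nodup (κ : V → Fin 4) {a : V} (ka : κ a = 2) {As Bs : List V}
    (hAs : As.Nodup) (hBs : Bs.Nodup) (kA : ∀ a ∈ As, κ a = 2)
    (kB : ∀ b ∈ Bs, κ b = 3) : (rc a As Bs).Nodup := by
  induction Bs with
  | nil => simp [rc]
  | cons b Bs ih =>
    have hBs' := List.nodup_cons.1 hBs
    have kb := kB b (by simp)
    have kB' : ∀ a ∈ Bs, κ a = 3 := fun a h => kB a (by simp [h])
    rw [rc, Multiset.nodup_add]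
    refine ⟨?_, ih hBs'.2 kB', ?_⟩
    · refine X_nodup' κ 2 3 2 3 (by decide) (by decide) (nodup_row _ hBs'.2) (nodup_col _ hAs) ?_ ?_ ?_
      · intro d hd
        simp only [List.mem_map] at hd
        obtain ⟨b, hb, rfl⟩ := hd
        exact ⟨ka, kB' _ hb⟩
      · intro d hd
        simp only [List.mem_map] at hd
        obtain ⟨a, ha, rfl⟩ := hd
        exact ⟨kA _ ha, kb⟩
      · intro d hd d' hd' he
        simp only [List.mem_map] at hd hd'
        obtain ⟨b, hb, rfl⟩ := hd
        obtain ⟨a', ha', rfl⟩ := hd'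
        have := kA _ ha'
        have := kB' _ hb
        rcases edg_eq he with h | h <;> simp at h <;> grind
    · refine disj_occ b ?_ ?_
      · intro z hz
        rw [mem_X] at hz
        obtain ⟨d, hd, d', hd', rfl⟩ := hz
        simp only [List.mem_map] at hd'
        obtain ⟨a', ha', rfl⟩ := hd'
        exact ⟨edg (a', b), by simp, by simp [edg]⟩
      · intro z hz
        obtain ⟨a', ha', b1, hb1, b2, hb2, -, rfl⟩ := mem_rc hBs'.2 hz
        rw [occ_iff]
        have := kA _ ha'
        grind

lemma sc_nodup (κ : V → Fin 4) {As Bs : List V}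
    (hAs : As.Nodup) (hBs : Bs.Nodup) (kA : ∀ a ∈ As, κ a = 2)
    (kB : ∀ b ∈ Bs, κ b = 3) : (sc Bs As).Nodup := by
  induction As with
  | nil => simp [sc]
  | cons a As ih =>
    have hAs' := List.nodup_cons.1 hAs
    have ka := kA a (by simp)
    have kA' : ∀ a ∈ As, κ a = 2 := fun a h => kA a (by simp [h])
    rw [sc, Multiset.nodup_add]
    refine ⟨rc_nodup κ ka hAs'.2 hBs kA' kB, ih hAs'.2 kA', ?_⟩
    refine disj_occ a ?_ ?_
    · intro z hz
      obtain ⟨a', ha', b1, hb1, b2, hb2, -, rfl⟩ := mem_rc hBs hz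
      simp [occ_iff]
    · intro z hz
      obtain ⟨a1, h1, a2, h2, -, b1, hb1, b2, hb2, -, rfl⟩ := mem_sc hAs'.2 hBs hz
      rw [occ_iff]
      have := kB _ hb1
      have := kB _ hb2
      grind

lemma cB_nodup (κ : V → Fin 4) {x y : V} (hx : κ x = 0) (hy : κ y = 1) {GA HA Bs : List V}
    (hBs : Bs.Nodup) (hG : GA.Nodup) (hH : HA.Nodup) (kB : ∀ b ∈ Bs, κ b = 3)
    (kG : ∀ a ∈ GA, κ a = 2) (kH : ∀ a ∈ HA, κ a = 2) : (cB x y GA HA Bs).Nodup := by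
  induction Bs with
  | nil => simp [cB]
  | cons b Bs ih =>
    have hBs' := List.nodup_cons.1 hBs
    have kb := kB b (by simp)
    have kB' : ∀ b ∈ Bs, κ b = 3 := fun a h => kB a (by simp [h])
    rw [cB, Multiset.nodup_add, Multiset.nodup_add]
    refine ⟨⟨?_, ?_, ?_⟩, ih hBs'.2 kB', ?_⟩
    · refine X_nodup' κ 2 3 0 3 (by decide) (by decide) 
        (nodup_cols hG hBs'.2) (by simp) ?_ (by simp [hx, kb]) ?_
      · intro d hd
        simp only [List.mem_flatMap, List.mem_map] at hd
        obtain ⟨b', hb', a, ha, rfl⟩ := hd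
        exact ⟨kG _ ha, kB' _ hb'⟩
      · intro d hd d' hd' he
        simp only [List.mem_singleton, List.mem_flatMap, List.mem_map] at hd hd'
        obtain ⟨b', hb', a, ha, rfl⟩ := hd
        subst hd'
        have := kB' _ hb'
        have := kG _ ha
        rcases edg_eq he with h | h <;> simp at h <;> grind
    · refine X_nodup' κ 3 1 2 3 (by decide) (by decide) (nodup_col _ hBs'.2) (nodup_col _ hH) ?_ ?_ ?_
      · intro d hd
        simp only [List.mem_map] at hd
        obtain ⟨b, hb, rfl⟩ := hd
        exact ⟨kB' _ hb, hy⟩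
      · intro d hd
        simp only [List.mem_map] at hd
        obtain ⟨a, ha, rfl⟩ := hd
        exact ⟨kH _ ha, kb⟩
      · intro d hd d' hd' he
        simp only [List.mem_map] at hd hd'
        obtain ⟨b, hb, rfl⟩ := hd
        obtain ⟨a', ha', rfl⟩ := hd'
        have := kH _ ha'
        have := kB' _ hb
        rcases edg_eq he with h | h <;> simp at h <;> grind
    · refine disj_tag κ [s(s(2, 3), s(0, 3))] [s(s(3, 1), s(2, 3))] ?_ ?_ (by decide)
      · intro z hz
        rw [mem_X] at hz
        obtain ⟨d, hd, d', hd', rfl⟩ := hz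
        simp only [List.mem_singleton, List.mem_flatMap, List.mem_map] at hd hd'
        obtain ⟨b', hb', a, ha, rfl⟩ := hd
        subst hd'
        simp [edg, hx, kb, kB' _ hb', kG _ ha]
      · intro z hz
        rw [mem_X] at hz
        obtain ⟨d, hd, d', hd', rfl⟩ := hz
        simp only [List.mem_map] at hd hd'
        obtain ⟨b', hb', rfl⟩ := hd
        obtain ⟨a', ha', rfl⟩ := hd'
        simp [edg, hy, kb, kB' _ hb', kH _ ha']
    · refine disj_occ b ?_ ?_
      · intro z hz
        rw [Multiset.mem_add, mem_X, mem_X] at hz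
        rcases hz with ⟨d, hd, d', hd', rfl⟩ | ⟨d, hd, d', hd', rfl⟩
        · simp only [List.mem_singleton] at hd'
          subst hd'
          exact ⟨edg (x, b), by simp, by simp [edg]⟩
        · simp only [List.mem_map] at hd'
          obtain ⟨a, ha, rfl⟩ := hd'
          exact ⟨edg (a, b), by simp, by simp [edg]⟩
      · intro z hz
        obtain ⟨a1, h1, a2, h2, -, ⟨b, hb, rfl⟩ | ⟨b, hb, rfl⟩⟩ := mem_cB hBs'.2 hz <;>
        · rw [occ_iff]
          have := kB' _ h1
          have := kB' _ h2
          first | have := kG _ hb | have := kH _ hb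
          grind

end CN

namespace CN

/-- nodup, with all tags in a given list -/
def NT (μ : V → Fin 6) (C : Multiset (Sym2 (Sym2 V))) (T : List (Sym2 (Sym2 (Fin 6)))) : Prop :=
  C.Nodup ∧ ∀ z ∈ C, Sym2.map (Sym2.map μ) z ∈ T

lemma NT.add {μ : V → Fin 6} {C C' T T'} (h : NT μ C T) (h' : NT μ C' T')
    (hT : ∀ t ∈ T, t ∉ T') : NT μ (C + C') (T ++ T') := by
  refine ⟨Multiset.nodup_add.2 ⟨h.1, h'.1, disj_tag μ T T' h.2 h'.2 hT⟩, ?_⟩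
  intro z hz
  rw [Multiset.mem_add] at hz
  rw [List.mem_append]
  exact hz.imp (h.2 z) (h'.2 z)

/-- independence of the two edges of a crossing -/
def Ind (G : SimpleGraph V) (z : Sym2 (Sym2 V)) : Prop :=
  ∃ e f, z = s(e, f) ∧ e ∈ G.edgeSet ∧ f ∈ G.edgeSet ∧ ∀ a ∈ e, a ∉ f

lemma ind_mk {G : SimpleGraph V} {a b c d : V} (h1 : G.Adj a b) (h2 : G.Adj c d) (h3 : a ≠ c) (h4 : a ≠ d)
    (h5 : b ≠ c) (h6 : b ≠ d) : Ind G s(s(a, b), s(c, d)) := by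
  refine ⟨s(a, b), s(c, d), rfl, h1, h2, ?_⟩
  intro v hv hv'
  rw [Sym2.mem_iff] at hv hv'
  grind

section
variable {G : SimpleGraph V} (κ : V → Fin 4) (hG : ∀ u v, G.Adj u v ↔ κ u ≠ κ v)
  {x y : V} (hx : κ x = 0) (hy : κ y = 1)

lemma ind_cA (hG : ∀ u v, G.Adj u v ↔ κ u ≠ κ v) (hx : κ x = 0) (hy : κ y = 1) {Lb Rb As : List V}
    (hAs : As.Nodup) (kA : ∀ a ∈ As, κ a = 2)
    (kL : ∀ b ∈ Lb, κ b = 3) (kR : ∀ b ∈ Rb, κ b = 3) : ∀ z ∈ cA x y Lb Rb As, Ind G z := by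
  intro z hz
  obtain ⟨a, ha, a', ha', hne, ⟨b, hb, rfl⟩ | ⟨b, hb, rfl⟩⟩ := mem_cA hAs hz <;>
  · have := kA _ ha
    have := kA _ ha'
    first | have := kL _ hb | have := kR _ hb
    apply ind_mk <;> grind

lemma ind_sc (hG : ∀ u v, G.Adj u v ↔ κ u ≠ κ v) {As Bs : List V}
    (hAs : As.Nodup) (hBs : Bs.Nodup) (kA : ∀ a ∈ As, κ a = 2)
    (kB : ∀ b ∈ Bs, κ b = 3) : ∀ z ∈ sc Bs As, Ind G z := by
  intro z hz
  obtain ⟨a, ha, a', ha', hne, b, hb, b', hb', hne', rfl⟩ := mem_sc hAs hBs hz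
  have := kA _ ha
  have := kA _ ha'
  have := kB _ hb
  have := kB _ hb'
  apply ind_mk <;> grind

lemma ind_cB (hG : ∀ u v, G.Adj u v ↔ κ u ≠ κ v) (hx : κ x = 0) (hy : κ y = 1) {GA HA Bs : List V}
    (hBs : Bs.Nodup) (kB : ∀ b ∈ Bs, κ b = 3)
    (kG : ∀ a ∈ GA, κ a = 2) (kH : ∀ a ∈ HA, κ a = 2) : ∀ z ∈ cB x y GA HA Bs, Ind G z := by
  intro z hz
  obtain ⟨a, ha, a', ha', hne, ⟨b, hb, rfl⟩ | ⟨b, hb, rfl⟩⟩ := mem_cB hBs hz <;>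
  · have := kB _ ha
    have := kB _ ha'
    first | have := kG _ hb | have := kH _ hb
    apply ind_mk <;> grind

lemma nt_cA (hx : κ x = 0) (hy : κ y = 1) (μ : V → Fin 6) {Lb Rb As : List V} {i j k : Fin 6}
    (mx : μ x = 0) (my : μ y = 1) (mA : ∀ a ∈ As, μ a = i) (mL : ∀ b ∈ Lb, μ b = j) (mR : ∀ b ∈ Rb, μ b = k)
    (hAs : As.Nodup) (hLb : Lb.Nodup) (hRb : Rb.Nodup) (kA : ∀ a ∈ As, κ a = 2)
    (kL : ∀ b ∈ Lb, κ b = 3) (kR : ∀ b ∈ Rb, κ b = 3) :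
    NT μ (cA x y Lb Rb As) [s(s(0, i), s(i, j)), s(s(i, k), s(i, 1))] := by
  refine ⟨cA_nodup κ hx hy hAs hLb hRb kA kL kR, ?_⟩
  intro z hz
  obtain ⟨a, ha, a', ha', hne, ⟨b, hb, rfl⟩ | ⟨b, hb, rfl⟩⟩ := mem_cA hAs hz
  · simp only [Sym2.map_mk, mx, mA a ha, mA a' ha', mL b hb]; simp
  · simp only [Sym2.map_mk, my, mA a ha, mA a' ha', mR b hb]; simp

lemma nt_sc (μ : V → Fin 6) {As Bs : List V} {i j : Fin 6}
    (mA : ∀ a ∈ As, μ a = i) (mB : ∀ b ∈ Bs, μ b = j)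
    (hAs : As.Nodup) (hBs : Bs.Nodup) (kA : ∀ a ∈ As, κ a = 2)
    (kB : ∀ b ∈ Bs, κ b = 3) :
    NT μ (sc Bs As) [s(s(i, j), s(i, j))] := by
  refine ⟨sc_nodup κ hAs hBs kA kB, ?_⟩
  intro z hz
  obtain ⟨a, ha, a', ha', hne, b, hb, b', hb', hne', rfl⟩ := mem_sc hAs hBs hz
  simp only [Sym2.map_mk, mA a ha, mA a' ha', mB b hb, mB b' hb']; simp

lemma nt_cB (hx : κ x = 0) (hy : κ y = 1) (μ : V → Fin 6) {GA HA Bs : List V} {i j k : Fin 6}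
    (mx : μ x = 0) (my : μ y = 1) (mB : ∀ a ∈ Bs, μ a = i) (mG : ∀ b ∈ GA, μ b = j) (mH : ∀ b ∈ HA, μ b = k)
    (hBs : Bs.Nodup) (hGA : GA.Nodup) (hHA : HA.Nodup) (kB : ∀ a ∈ Bs, κ a = 3)
    (kG : ∀ b ∈ GA, κ b = 2) (kH : ∀ b ∈ HA, κ b = 2) :
    NT μ (cB x y GA HA Bs) [s(s(j, i), s(0, i)), s(s(i, 1), s(k, i))] := by
  refine ⟨cB_nodup κ hx hy hBs hGA hHA kB kG kH, ?_⟩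
  intro z hz
  obtain ⟨a, ha, a', ha', hne, ⟨b, hb, rfl⟩ | ⟨b, hb, rfl⟩⟩ := mem_cB hBs hz
  · simp only [Sym2.map_mk, mx, mB a ha, mB a' ha', mG b hb]; simp
  · simp only [Sym2.map_mk, my, mB a ha, mB a' ha', mH b hb]; simp

end

/-- the crossings of the optimal drawing -/
def total (x y : V) (A1 A2 B1 B2 : List V) : Multiset (Sym2 (Sym2 V)) :=
  cA x y B2.reverse B1 A1 + cA x y B1.reverse B2 A2 +
    X (A1.flatMap fun a => B1.map (Prod.mk a)) [(x, y)] +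
    sc B1 A1 + sc B1.reverse A2.reverse + sc B2 A2 + sc B2.reverse A1.reverse +
    cB x y A1 A2.reverse B1 + cB x y A2 A1.reverse B2

lemma der_total (x y : V) (A1 A2 B1 B2 : List V) (N : V → List V)
    (nx : N x = A1 ++ [y] ++ B1 ++ A2 ++ B2)
    (ny : N y = (A1 ++ [x] ++ B1 ++ A2 ++ B2).reverse)
    (nA1 : ∀ a ∈ A1, N a = x :: B2.reverse ++ y :: B1)
    (nA2 : ∀ a ∈ A2, N a = x :: B1.reverse ++ y :: B2)
    (nB1 : ∀ b ∈ B1, N b = A2.reverse.reverse ++ x :: A1.reverse ++ [y])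
    (nB2 : ∀ b ∈ B2, N b = A1.reverse.reverse ++ x :: A2.reverse ++ [y]) :
    Der ((([x, y] ++ A1 ++ A2 ++ B1 ++ B2).map fun v => (v, N v) : List _) : Multiset _)
      (total x y A1 A2 B1 B2) [] [] := by
  have h0 := Der.single (Step.birth [] [] x (N x))
  rw [nx] at h0
  have h1 := (blockA x y B2.reverse B1 N A1 nA1).ctx [] ([(x, y)] ++ B1.map (Prod.mk x) ++ A2.map (Prod.mk x) ++
    B2.map (Prod.mk x))
  set L1 := A1.reverse.flatMap fun a => B2.reverse.map (Prod.mk a)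
  set Y1 := A1.map fun a => (a, y)
  set R1 := A1.flatMap fun a => B1.map (Prod.mk a)
  have h2 := (blockA x y B1.reverse B2 N A2 nA2).ctx (L1 ++ Y1 ++ R1 ++ [(x, y)] ++ B1.map (Prod.mk x))
    (B2.map (Prod.mk x))
  set L2 := A2.reverse.flatMap fun a => B1.reverse.map (Prod.mk a)
  set Y2 := A2.map fun a => (a, y)
  set R2 := A2.flatMap fun a => B2.map (Prod.mk a)
  have h3 := (move R1 [(x, y)]).ctx (L1 ++ Y1) (B1.map (Prod.mk x) ++ L2 ++ Y2 ++ R2 ++ B2.map (Prod.mk x))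
  have h4 := (((h0.cast rfl rfl rfl rfl).trans (h1.cast rfl rfl (by simp) rfl)).trans
    (h2.cast rfl rfl (by simp) rfl)).trans (h3.cast rfl rfl (by simp) rfl)
  have h5 := rot (u := L1) (h4.cast rfl rfl (by simp) (by simp only [List.append_assoc]; rfl))
  have g1 := (sort A1 B1).ctx (Y1 ++ [(x, y)]) (B1.map (Prod.mk x) ++ L2 ++ Y2 ++ R2 ++ B2.map (Prod.mk x) ++ L1)
  set R1' := B1.flatMap fun b => A1.map fun a' => (a', b)
  have g2 := (sort A2.reverse B1.reverse).ctx (Y1 ++ [(x, y)] ++ R1' ++ B1.map (Prod.mk x))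
    (Y2 ++ R2 ++ B2.map (Prod.mk x) ++ L1)
  set L2' := B1.reverse.flatMap fun b => A2.reverse.map fun a' => (a', b)
  have g3 := (sort A2 B2).ctx (Y1 ++ [(x, y)] ++ R1' ++ B1.map (Prod.mk x) ++ L2' ++ Y2)
    (B2.map (Prod.mk x) ++ L1)
  set R2' := B2.flatMap fun b => A2.map fun a' => (a', b)
  have g4 := (sort A1.reverse B2.reverse).ctx (Y1 ++ [(x, y)] ++ R1' ++ B1.map (Prod.mk x) ++ L2' ++ Y2
    ++ R2' ++ B2.map (Prod.mk x)) []
  set L1' := B2.reverse.flatMap fun b => A1.reverse.map fun a' => (a', b)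
  have k1 := (blockB x y A1 A2.reverse N B1 nB1).ctx (Y1 ++ [(x, y)]) (Y2 ++ R2' ++ B2.map (Prod.mk x) ++ L1')
  have k2 := (blockB x y A2 A1.reverse N B2 nB2).ctx (Y1 ++ [(x, y)] ++ (B1.map fun b => (b, y)) ++ Y2) []
  set W := Y1 ++ [(x, y)] ++ (B1.map fun b => (b, y)) ++ Y2 ++ B2.map fun b => (b, y)
  have k3 := Der.single (Step.birth W [] y (N y))
  have k4 : W ++ (N y).map (Prod.mk y) = W ++ rb W := by
    rw [ny]
    simp [W, Y1, Y2, rb, Function.comp_def]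
  have k5 := caps W
  have f1 := (((h5.trans (g1.cast rfl rfl (by simp [R1]) rfl)).trans (g2.cast rfl rfl (by simp [L2]) rfl)).trans
    (g3.cast rfl rfl (by simp [R2]) rfl)).trans (g4.cast rfl rfl (by simp [L1]) rfl)
  have f2 := ((f1.trans (k1.cast rfl rfl (by simp [R1', L2']) rfl)).trans
    (k2.cast rfl rfl (by simp [R2', L1']) rfl))
  have f3 := (f2.trans (k3.cast rfl rfl (by simp [W]) rfl)).trans (k5.cast rfl rfl (by simp [← k4]) rfl)
  refine f3.cast ?_ ?_ rfl rfl
  · simp only [List.map_append, List.map_cons, List.map_nil, ← Multiset.coe_add, ← nx]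
    have : (↑[(x, N x), (y, N y)] : Multiset (V × List V)) = {(x, N x)} + {(y, N y)} := rfl
    rw [this]
    simp only [add_zero]
    abel
  · simp only [total, add_zero, zero_add]
    abel

lemma card_total (x y : V) (A1 A2 B1 B2 : List V) (s t : ℕ) (h1 : A1.length = s) (h2 : A2.length = s)
    (h3 : B1.length = t) (h4 : B2.length = t) :
    (total x y A1 A2 B1 B2).card + 2 * s * t = s * t * (s * t + s + t) := by
  have e1 := card_cA x y B2.reverse B1 A1 t (by simpa) h3
  have e2 := card_cA x y B1.reverse B2 A2 t (by simpa) h4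
  have e3 := card_sc A1 B1
  have e4 := card_sc A2.reverse B1.reverse
  have e5 := card_sc A2 B2
  have e6 := card_sc A1.reverse B2.reverse
  have e7 := card_cB x y A1 A2.reverse B1 s h1 (by simpa)
  have e8 := card_cB x y A2 A1.reverse B2 s h2 (by simpa)
  have e9 : (X (A1.flatMap fun a => B1.map (Prod.mk a)) [(x, y)]).card = s * t := by
    simp [List.length_flatMap, h1, h3]
  simp only [List.length_reverse, h1, h2, h3, h4] at e1 e2 e3 e4 e5 e6 e7 e8
  simp only [total, Multiset.card_add, e9]
  nlinarith

set_option maxRecDepth 20000 in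
set_option maxHeartbeats 2000000 in
theorem upper [Fintype V] {G : SimpleGraph V} (κ : V → Fin 4)
    (hG : ∀ u v, G.Adj u v ↔ κ u ≠ κ v) (x y : V) (hx : ∀ v, κ v = 0 ↔ v = x)
    (hy : ∀ v, κ v = 1 ↔ v = y) (s t : ℕ)
    (hs : (Finset.univ.filter fun v => κ v = 2).card = 2 * s)
    (ht : (Finset.univ.filter fun v => κ v = 3).card = 2 * t) :
    ∃ N C, Valid G N C ∧ C.card + 2 * s * t = s * t * (s * t + s + t) := by
  classical
  have split : ∀ (c : Fin 4) (s : ℕ), (Finset.univ.filter fun v => κ v = c).card = 2 * s →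
      ∃ A1 A2 : List V, (A1 ++ A2).Nodup ∧ A1.length = s ∧ A2.length = s ∧
        ∀ v, v ∈ A1 ++ A2 ↔ κ v = c := by
    intro c s h
    refine ⟨(Finset.univ.filter fun v => κ v = c).toList.take s,
      (Finset.univ.filter fun v => κ v = c).toList.drop s, ?_, ?_, ?_, ?_⟩
    · rw [List.take_append_drop]; exact Finset.nodup_toList _
    · rw [List.length_take, Finset.length_toList, h]; omega
    · rw [List.length_drop, Finset.length_toList, h]; omega
    · intro v; rw [List.take_append_drop]; simp
  obtain ⟨A1, A2, hA, hA1, hA2, mA⟩ := split 2 s hs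
  obtain ⟨B1, B2, hB, hB1, hB2, mB⟩ := split 3 t ht
  have kx : κ x = 0 := (hx x).2 rfl
  have ky : κ y = 1 := (hy y).2 rfl
  have kA1 : ∀ a ∈ A1, κ a = 2 := fun a h => (mA a).1 (by simp [h])
  have kA2 : ∀ a ∈ A2, κ a = 2 := fun a h => (mA a).1 (by simp [h])
  have kB1 : ∀ a ∈ B1, κ a = 3 := fun a h => (mB a).1 (by simp [h])
  have kB2 : ∀ a ∈ B2, κ a = 3 := fun a h => (mB a).1 (by simp [h])
  rw [List.nodup_append'] at hA hB
  obtain ⟨nA1, nA2, dA⟩ := hA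
  obtain ⟨nB1, nB2, dB⟩ := hB
  have dA' : ∀ a ∈ A2, a ∉ A1 := fun a h h' => dA h' h
  have dB' : ∀ a ∈ B2, a ∉ B1 := fun a h h' => dB h' h
  let μ : V → Fin 6 := fun v => if κ v = 0 then 0 else if κ v = 1 then 1 else
    if v ∈ A1 then 2 else if κ v = 2 then 3 else if v ∈ B1 then 4 else 5
  have mx : μ x = 0 := by simp [μ, kx]
  have my : μ y = 1 := by simp [μ, ky]
  have mA1 : ∀ a ∈ A1, μ a = 2 := fun a h => by simp [μ, kA1 a h, h]
  have mA2 : ∀ a ∈ A2, μ a = 3 := fun a h => by simp [μ, kA2 a h, dA' a h]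
  have nBA : ∀ b, κ b = 3 → b ∉ A1 := fun b h h' => by rw [kA1 b h'] at h; exact absurd h (by decide)
  have mB1 : ∀ a ∈ B1, μ a = 4 := fun a h => by simp [μ, kB1 a h, h, nBA a (kB1 a h)]
  have mB2 : ∀ a ∈ B2, μ a = 5 := fun a h => by simp [μ, kB2 a h, dB' a h, nBA a (kB2 a h)]
  let F : Fin 6 → List V := ![A1 ++ [y] ++ B1 ++ A2 ++ B2, (A1 ++ [x] ++ B1 ++ A2 ++ B2).reverse,
    x :: B2.reverse ++ y :: B1, x :: B1.reverse ++ y :: B2,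
    A2.reverse.reverse ++ x :: A1.reverse ++ [y], A1.reverse.reverse ++ x :: A2.reverse ++ [y]]
  have hcov : ∀ v, v = x ∨ v = y ∨ v ∈ A1 ∨ v ∈ A2 ∨ v ∈ B1 ∨ v ∈ B2 := by
    intro v
    have : ∀ c : Fin 4, c = 0 ∨ c = 1 ∨ c = 2 ∨ c = 3 := by decide
    have h1 := mA v
    have h2 := mB v
    rw [List.mem_append] at h1 h2
    rcases this (κ v) with h | h | h | h
    · exact Or.inl ((hx v).1 h)
    · exact Or.inr (Or.inl ((hy v).1 h))
    · have := h1.2 h; tauto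
    · have := h2.2 h; tauto
  have hxy : x ≠ y := fun h => by rw [h, ky] at kx; exact absurd kx (by decide)
  refine ⟨fun v => F (μ v), total x y A1 A2 B1 B2, ⟨?_, ?_, ?_, ?_, ?_⟩,
    card_total x y A1 A2 B1 B2 s t hA1 hA2 hB1 hB2⟩
  · refine (der_total x y A1 A2 B1 B2 (fun v => F (μ v)) ?_ ?_ ?_ ?_ ?_ ?_).cast ?_ rfl rfl rfl
    · simp [mx, F]
    · simp [my, F]
    · intro a ha; simp [mA1 a ha, F]
    · intro a ha; simp [mA2 a ha, F]
    · intro a ha; simp [mB1 a ha, F]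
    · intro a ha; simp [mB2 a ha, F]
    · have hu : (Finset.univ : Finset V).val = ↑([x, y] ++ A1 ++ A2 ++ B1 ++ B2) := by
        refine (Multiset.Nodup.ext Finset.univ.nodup ?_).2 ?_
        · rw [Multiset.coe_nodup]
          simp only [List.nodup_append']
          refine ⟨⟨⟨⟨by simp [hxy], nA1, ?_⟩, nA2, ?_⟩, nB1, ?_⟩, nB2, ?_⟩ <;> intro v hv hv' <;>
            simp only [List.mem_append, List.mem_cons, List.not_mem_nil, or_false] at hv <;> grind
        · intro v
          have := hcov v
          simp
          tauto
      rw [Finset.sum, hu, Multiset.map_coe, ← Multiset.map_coe, ← Multiset.map_coe]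
      rw [← Multiset.sum_map_singleton (Multiset.map (fun v => (v, F (μ v))) _), Multiset.map_map]
      rfl
  · intro v
    have key : ∀ c, (F c).Nodup := by
      intro c
      have hxA1 : x ∉ A1 := fun h => by have := kA1 x h; rw [kx] at this; exact absurd this (by decide)
      have hxA2 : x ∉ A2 := fun h => by have := kA2 x h; rw [kx] at this; exact absurd this (by decide)
      have hxB1 : x ∉ B1 := fun h => by have := kB1 x h; rw [kx] at this; exact absurd this (by decide)
      have hxB2 : x ∉ B2 := fun h => by have := kB2 x h; rw [kx] at this; exact absurd this (by decide)
      have hyA1 : y ∉ A1 := fun h => by have := kA1 y h; rw [ky] at this; exact absurd this (by decide)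
      have hyA2 : y ∉ A2 := fun h => by have := kA2 y h; rw [ky] at this; exact absurd this (by decide)
      have hyB1 : y ∉ B1 := fun h => by have := kB1 y h; rw [ky] at this; exact absurd this (by decide)
      have hyB2 : y ∉ B2 := fun h => by have := kB2 y h; rw [ky] at this; exact absurd this (by decide)
      have dAB : ∀ a b, κ a = 2 → κ b = 3 → a ≠ b := by
        rintro a b h h' rfl
        rw [h] at h'
        exact absurd h' (by decide)
      fin_cases c <;> simp [F, List.nodup_append, List.nodup_cons] <;> grind
    exact key _
  · intro v w
    rw [hG]
    have h1 := mA w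
    have h2 := mB w
    have h3 := hx w
    have h4 := hy w
    have h5 : ∀ c : Fin 4, c = 0 ∨ c = 1 ∨ c = 2 ∨ c = 3 := by decide
    have h6 := h5 (κ w)
    rw [List.mem_append] at h1 h2
    rcases hcov v with rfl | rfl | h | h | h | h
    · simp [mx, F]; grind
    · simp [my, F]; grind
    · simp [mA1 v h, kA1 v h, F]; grind
    · simp [mA2 v h, kA2 v h, F]; grind
    · simp [mB1 v h, kB1 v h, F]; grind
    · simp [mB2 v h, kB2 v h, F]; grind
  · have h1 := nt_cA κ kx ky μ (i := 2) (j := 5) (k := 4) (Lb := B2.reverse) (Rb := B1) mx my mA1 (by simpa using mB2) mB1 nA1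
      (by simpa) nB1 kA1 (by simpa using kB2) kB1
    have h2 := nt_cA κ kx ky μ (i := 3) (j := 4) (k := 5) (Lb := B1.reverse) (Rb := B2) mx my mA2 (by simpa using mB1) mB2 nA2
      (by simpa) nB2 kA2 (by simpa using kB1) kB2
    have h3 : NT μ (X (A1.flatMap fun a => B1.map (Prod.mk a)) [(x, y)]) [s(s(2, 4), s(0, 1))] := by
      refine ⟨X_nodup' κ 2 3 0 1 (by decide) (by decide) (nodup_rows nA1 nB1) (by simp) ?_
        (by simp [kx, ky]) ?_, ?_⟩
      · intro d hd
        simp only [List.mem_flatMap, List.mem_map] at hd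
        obtain ⟨a, ha, b, hb, rfl⟩ := hd
        exact ⟨kA1 _ ha, kB1 _ hb⟩
      · intro d hd d' hd' he
        simp only [List.mem_flatMap, List.mem_map, List.mem_singleton] at hd hd'
        obtain ⟨a, ha, b, hb, rfl⟩ := hd
        subst hd'
        have := kA1 _ ha
        rcases edg_eq he with h | h <;> simp at h <;> grind
      · intro z hz
        rw [mem_X] at hz
        obtain ⟨d, hd, d', hd', rfl⟩ := hz
        simp only [List.mem_flatMap, List.mem_map, List.mem_singleton] at hd hd'
        obtain ⟨a, ha, b, hb, rfl⟩ := hd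
        subst hd'
        simp [edg, mx, my, mA1 a ha, mB1 b hb]
    have h4 := nt_sc κ μ mA1 mB1 nA1 nB1 kA1 kB1
    have h5 := nt_sc κ μ (i := 3) (j := 4) (As := A2.reverse) (Bs := B1.reverse) (by simpa using mA2) (by simpa using mB1)
      (by simpa) (by simpa) (by simpa using kA2) (by simpa using kB1)
    have h6 := nt_sc κ μ mA2 mB2 nA2 nB2 kA2 kB2
    have h7 := nt_sc κ μ (i := 2) (j := 5) (As := A1.reverse) (Bs := B2.reverse) (by simpa using mA1) (by simpa using mB2)
      (by simpa) (by simpa) (by simpa using kA1) (by simpa using kB2)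
    have h8 := nt_cB κ kx ky μ (i := 4) (j := 2) (k := 3) (GA := A1) (HA := A2.reverse) mx my mB1 mA1 (by simpa using mA2) nB1 nA1
      (by simpa) kB1 kA1 (by simpa using kA2)
    have h9 := nt_cB κ kx ky μ (i := 5) (j := 3) (k := 2) (GA := A2) (HA := A1.reverse) mx my mB2 mA2 (by simpa using mA1) nB2 nA2
      (by simpa) kB2 kA2 (by simpa using kA1)
    exact ((((((((h1.add h2 (by decide)).add h3 (by decide)).add h4 (by decide)).add h5 (by decide)).add h6
      (by decide)).add h7 (by decide)).add h8 (by decide)).add h9 (by decide)).1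
  · intro z hz
    change Ind G z
    simp only [total, Multiset.mem_add] at hz
    rcases hz with (((((((hz | hz) | hz) | hz) | hz) | hz) | hz) | hz) | hz
    · exact ind_cA κ hG kx ky nA1 kA1 (by simpa using kB2) kB1 z hz
    · exact ind_cA κ hG kx ky nA2 kA2 (by simpa using kB1) kB2 z hz
    · rw [mem_X] at hz
      obtain ⟨d, hd, d', hd', rfl⟩ := hz
      simp only [List.mem_flatMap, List.mem_map, List.mem_singleton] at hd hd'
      obtain ⟨a, ha, b, hb, rfl⟩ := hd
      subst hd'
      have := kA1 _ ha
      have := kB1 _ hb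
      apply ind_mk <;> grind
    · exact ind_sc κ hG nA1 nB1 kA1 kB1 z hz
    · exact ind_sc κ hG (by simpa) (by simpa) (by simpa using kA2) (by simpa using kB1) z hz
    · exact ind_sc κ hG nA2 nB2 kA2 kB2 z hz
    · exact ind_sc κ hG (by simpa) (by simpa) (by simpa using kA1) (by simpa using kB2) z hz
    · exact ind_cB κ hG kx ky nB1 kB1 kA1 (by simpa using kA2) z hz
    · exact ind_cB κ hG kx ky nB2 kB2 kA2 (by simpa using kA1) z hz

end CN

/-- Assuming Zarankiewicz's conjecture, if `m` and `n` are both even positive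
integers, then `cr(K_{1,1,m,n}) = Z(m+2,n+2) − mn + ⌊m/2⌋⌊n/2⌋`. -/
theorem statement7
    (hZC : ∀ a b : ℕ, 0 < a → 0 < b → crossingNumber (bipK a b) = Z a b)
    (m n : ℕ) (hm : 0 < m) (hn : 0 < n) (hme : Even m) (hne : Even n) :
    (crossingNumber (quadK 1 1 m n) : ℤ) =
      (Z (m + 2) (n + 2) : ℤ) - (m : ℤ) * n + ((m / 2 : ℕ) : ℤ) * ((n / 2 : ℕ) : ℤ) := by
  obtain ⟨s, rfl⟩ := even_iff_exists_two_mul.1 hme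
  obtain ⟨t, rfl⟩ := even_iff_exists_two_mul.1 hne
  let W := Σ i : Fin 4, (![Fin 1, Fin 1, Fin (2 * s), Fin (2 * t)] : Fin 4 → Type) i
  have inst : ∀ i : Fin 4, Fintype ((![Fin 1, Fin 1, Fin (2 * s), Fin (2 * t)] : Fin 4 → Type) i) := by
    intro i
    match i with
    | 0 => exact (inferInstance : Fintype (Fin 1))
    | 1 => exact (inferInstance : Fintype (Fin 1))
    | 2 => exact (inferInstance : Fintype (Fin (2 * s)))
    | 3 => exact (inferInstance : Fintype (Fin (2 * t)))
  let κ : W → Fin 4 := Sigma.fst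
  have hG : ∀ u v : W, (quadK 1 1 (2 * s) (2 * t)).Adj u v ↔ κ u ≠ κ v := fun u v => Iff.rfl
  let x : W := ⟨0, (0 : Fin 1)⟩
  let y : W := ⟨1, (0 : Fin 1)⟩
  have hx : ∀ v : W, κ v = 0 ↔ v = x := by
    rintro ⟨i, v⟩
    constructor
    · rintro (rfl : i = 0)
      have : v = (0 : Fin 1) := Subsingleton.elim (α := Fin 1) _ _
      rw [this]
    · intro h; exact congrArg Sigma.fst h
  have hy : ∀ v : W, κ v = 1 ↔ v = y := by
    rintro ⟨i, v⟩
    constructor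
    · rintro (rfl : i = 1)
      have : v = (0 : Fin 1) := Subsingleton.elim (α := Fin 1) _ _
      rw [this]
    · intro h; exact congrArg Sigma.fst h
  have hcard : ∀ (c : Fin 4) (k : ℕ), Nat.card ((![Fin 1, Fin 1, Fin (2 * s), Fin (2 * t)] : Fin 4 → Type) c) = k →
      (Finset.univ.filter fun v : W => κ v = c).card = k := by
    intro c k h
    rw [← h, ← Fintype.card_subtype, ← Nat.card_eq_fintype_card]
    refine Nat.card_congr ⟨fun v => v.2 ▸ v.1.2, fun v => ⟨⟨c, v⟩, rfl⟩, ?_, fun v => rfl⟩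
    rintro ⟨⟨i, v⟩, (rfl : i = c)⟩
    rfl
  have hs := hcard 2 (2 * s) (Nat.card_fin _)
  have ht := hcard 3 (2 * t) (Nat.card_fin _)
  obtain ⟨N, C, hV, hC⟩ := CN.upper κ hG x y hx hy s t hs ht
  obtain ⟨D, hD, hD'⟩ := CN.claimB hV
  have hup : crossingNumber (quadK 1 1 (2 * s) (2 * t)) ≤ D.crNum := Nat.sInf_le ⟨D, hD, rfl⟩
  obtain ⟨D1, hD1, hD1'⟩ : crossingNumber (quadK 1 1 (2 * s) (2 * t)) ∈
      {n | ∃ D : Drawing (quadK 1 1 (2 * s) (2 * t)), D.IsGood ∧ D.crNum = n} :=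
    Nat.sInf_mem ⟨_, D, hD, rfl⟩
  obtain ⟨N1, C1, hV1, hC1⟩ := CN.claimA D1 hD1
  have hlow := CN.lower κ hG x y hx hy s t hs ht (fun a b ha hb => hZC a b ha hb) hV1
  have hfin : crossingNumber (quadK 1 1 (2 * s) (2 * t)) + 2 * s * t = s * t * (s * t + s + t) := by
    omega
  have hz : Z (2 * s + 2) (2 * t + 2) = (s + 1) * s * (t + 1) * t := by
    rw [Z]
    congr 1
    · congr 1
      · congr 1 <;> omega
      · omega
    · omega
  rw [hz]
  have e1 : 2 * s / 2 = s := by omega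
  have e2 : 2 * t / 2 = t := by omega
  rw [e1, e2]
  have hfin' : (crossingNumber (quadK 1 1 (2 * s) (2 * t)) : ℤ) + 2 * s * t = s * t * (s * t + s + t) := by
    exact_mod_cast hfin
  push_cast
  linarith
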